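/- Let p > 5 be a prime, q a power of p, and n ≥ 3. If Γ is a lattice of minimum covolume in SL_n(𝔽_q((t⁻¹))) (i.e., the covolume of Γ is less than or equal to the covolume of every lattice in SL_n(𝔽_q((t⁻¹)))), then there exists a group automorphism φ of SL_n(𝔽_q((t⁻¹))) which is also a homeomorphism such that φ(Γ) = SL_n(𝔽_q[t]). (This is the type A case of the paper's Main Theorem.) -/

import Mathlib

/-!
STATEMENT 0: A lattice of minimum covolume in `SL_n(𝔽_q((t⁻¹)))` (p > 5 prime, q a power
of p, n ≥ 3) is, up to a bicontinuous group automorphism, `SL_n(𝔽_q[t])`.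
-/

noncomputable section
open Matrix MeasureTheory
open scoped ENNReal

variable (Fq : Type) [Field Fq] [Fintype Fq] (n : ℕ)

/-- `F = 𝔽_q((t⁻¹))`, realized as the field of formal Laurent series over `𝔽_q`
with uniformizer `X = t⁻¹`. -/
abbrev F := LaurentSeries Fq

/-- `SL_n(F)` carries the topology induced entrywise from `F`. -/
instance : TopologicalSpace (SpecialLinearGroup (Fin n) (F Fq)) :=
  TopologicalSpace.induced
    ((↑) : SpecialLinearGroup (Fin n) (F Fq) → Matrix (Fin n) (Fin n) (F Fq)) inferInstance

instance : MeasurableSpace (SpecialLinearGroup (Fin n) (F Fq)) := borel _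

/-- The ring embedding `𝔽_q[t] → F` sending `t` to `X⁻¹`. -/
def polyEmb : Polynomial Fq →+* F Fq :=
  Polynomial.eval₂RingHom (HahnSeries.C : Fq →+* F Fq)
    ((HahnSeries.ofPowerSeries ℤ Fq PowerSeries.X)⁻¹)

/-- `SL_n(𝔽_q[t])`, the image of `SL_n` of the polynomial ring in `SL_n(F)`. -/
def SLpoly : Subgroup (SpecialLinearGroup (Fin n) (F Fq)) :=
  (SpecialLinearGroup.map (n := Fin n) (polyEmb Fq)).range

/-- A lattice in `SL_n(F)`: a discrete subgroup admitting a Borel fundamental domain of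
finite measure. -/
def IsLattice (μ : Measure (SpecialLinearGroup (Fin n) (F Fq)))
    (Γ : Subgroup (SpecialLinearGroup (Fin n) (F Fq))) : Prop :=
  DiscreteTopology Γ ∧
    ∃ s : Set (SpecialLinearGroup (Fin n) (F Fq)), IsFundamentalDomain Γ s μ ∧ μ s < ⊤

section
variable {Fq n}

/-- `N`-scaled valuation lower bound: `N * v(c) ≥ m`. -/
def VN (N m : ℤ) (c : F Fq) : Prop := ∀ k : ℤ, N * k < m → c.coeff k = 0

/-- `v(c) ≥ m`. -/
def V (m : ℤ) (c : F Fq) : Prop := VN 1 m c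

lemma V_iff {m : ℤ} {c : F Fq} : V m c ↔ ∀ k < m, c.coeff k = 0 := by
  simp [V, VN]

lemma VN.add {N m : ℤ} {c d : F Fq} (h : VN N m c) (h' : VN N m d) : VN N m (c + d) := by
  intro k hk; simp [h k hk, h' k hk]

lemma VN.neg {N m : ℤ} {c : F Fq} (h : VN N m c) : VN N m (-c) := by
  intro k hk; simp [h k hk]

lemma VN.sub {N m : ℤ} {c d : F Fq} (h : VN N m c) (h' : VN N m d) : VN N m (c - d) := by
  intro k hk; simp [h k hk, h' k hk]

lemma VN.zero {N m : ℤ} : VN N m (0 : F Fq) := by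
  intro k hk; simp

lemma VN.sum {ι : Type*} {s : Finset ι} {N m : ℤ} {f : ι → F Fq} (h : ∀ i ∈ s, VN N m (f i)) :
    VN N m (∑ i ∈ s, f i) := by
  classical
  induction s using Finset.induction_on with
  | empty => simpa using VN.zero
  | insert a s ha ih =>
    rw [Finset.sum_insert ha]
    exact (h _ (Finset.mem_insert_self _ _)).add (ih fun i hi => h i (Finset.mem_insert_of_mem hi))

lemma VN.mono {N m m' : ℤ} {c : F Fq} (h : VN N m c) (hm : m' ≤ m) : VN N m' c :=
  fun k hk => h k (hk.trans_le hm)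

lemma VN.mul {N m l : ℤ} {c d : F Fq} (h : VN N m c) (h' : VN N l d) : VN N (m + l) (c * d) := by
  intro k hk
  rw [HahnSeries.coeff_mul]
  refine Finset.sum_eq_zero fun ij hij => ?_
  rw [Finset.mem_antidiagonal] at hij
  by_cases h1 : N * ij.1 < m
  · rw [h _ h1, zero_mul]
  · have : N * ij.2 < l := by
      have := hij.2.2
      rw [← this, mul_add] at hk
      linarith
    rw [h' _ this, mul_zero]

lemma V.mul {m l : ℤ} {c d : F Fq} (h : V m c) (h' : V l d) : V (m + l) (c * d) := VN.mul h h'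
lemma V.add {m : ℤ} {c d : F Fq} (h : V m c) (h' : V m d) : V m (c + d) := VN.add h h'
lemma V.sub {m : ℤ} {c d : F Fq} (h : V m c) (h' : V m d) : V m (c - d) := VN.sub h h'
lemma V.neg {m : ℤ} {c : F Fq} (h : V m c) : V m (-c) := VN.neg h
lemma V.mono {m m' : ℤ} {c : F Fq} (h : V m c) (hm : m' ≤ m) : V m' c := VN.mono h hm
lemma V.zero {m : ℤ} : V m (0 : F Fq) := VN.zero
lemma V.sum {ι : Type*} {s : Finset ι} {m : ℤ} {f : ι → F Fq} (h : ∀ i ∈ s, V m (f i)) :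
    V m (∑ i ∈ s, f i) := VN.sum h

lemma VN_single {N m k : ℤ} (a : Fq) (h : m ≤ N * k) : VN N m (HahnSeries.single k a : F Fq) := by
  intro j hj
  rw [HahnSeries.coeff_single_of_ne]
  rintro rfl; omega

lemma V_single {m k : ℤ} (a : Fq) (h : m ≤ k) : V m (HahnSeries.single k a : F Fq) :=
  VN_single a (by simpa)

lemma V_C (a : Fq) : V 0 (HahnSeries.C a : F Fq) := V_single a le_rfl
lemma V_one : V 0 (1 : F Fq) := by simpa using V_C (1 : Fq)

lemma VN_order {N : ℤ} (hN : 0 < N) {c : F Fq} (hc : c ≠ 0) {m : ℤ} :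
    VN N m c ↔ m ≤ N * c.order := by
  constructor
  · intro h
    by_contra hlt
    exact HahnSeries.coeff_order_eq_zero.not.mpr hc (h _ (by omega))
  · intro h k hk
    apply HahnSeries.coeff_eq_zero_of_lt_order
    by_contra hlt
    nlinarith

lemma V_order {c : F Fq} (hc : c ≠ 0) {m : ℤ} : V m c ↔ m ≤ c.order := by
  simpa [V] using VN_order (N := 1) one_pos hc (m := m)

lemma eq_zero_of_V {c : F Fq} (h : ∀ m : ℕ, V m c) : c = 0 := by
  ext k
  exact V_iff.1 (h (k.toNat + 1)) k (by push_cast; have := Int.self_le_toNat k; omega)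

lemma V_ofPowerSeries (f : PowerSeries Fq) : V 0 (HahnSeries.ofPowerSeries ℤ Fq f : F Fq) := by
  rw [V_iff]; intro k hk
  exact (PowerSeries.coeff_coe _ _).trans (if_pos hk)

lemma coeff_ofPowerSeries (f : PowerSeries Fq) (m : ℕ) :
    (HahnSeries.ofPowerSeries ℤ Fq f).coeff (m : ℤ) = PowerSeries.coeff m f :=
  HahnSeries.ofPowerSeries_apply_coeff _ _

lemma coeff_zero_ofPowerSeries (f : PowerSeries Fq) :
    (HahnSeries.ofPowerSeries ℤ Fq f).coeff (0 : ℤ) = PowerSeries.constantCoeff f := by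
  simpa using coeff_ofPowerSeries f 0

lemma exists_ofPowerSeries {c : F Fq} (h : V 0 c) :
    ∃ f : PowerSeries Fq, HahnSeries.ofPowerSeries ℤ Fq f = c := by
  refine ⟨PowerSeries.mk fun k => c.coeff k, ?_⟩
  ext k
  rcases lt_or_ge k 0 with hk | hk
  · rw [V_iff.1 h k hk, V_iff.1 (V_ofPowerSeries _) k hk]
  · lift k to ℕ using hk
    rw [coeff_ofPowerSeries, PowerSeries.coeff_mk]

lemma V_nhds (m : ℤ) : {c : F Fq | V m c} ∈ nhds (0 : F Fq) := by
  rw [Valued.mem_nhds_zero]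
  obtain ⟨x, hx⟩ : ∃ x : F Fq, Valued.v x = WithZero.exp (-m) :=
    ⟨HahnSeries.single m 1, by
      simpa using LaurentSeries.valuation_single_zpow Fq m⟩
  have hr : Valued.v.restrict x ≠ 0 := by
    rw [Ne, Valuation.restrict_eq_zero_iff, hx]; simp
  refine ⟨Units.mk0 _ hr, fun c hc => ?_⟩
  change Valued.v.restrict c < Valued.v.restrict x at hc
  rw [Valuation.restrict_lt_iff, hx] at hc
  exact V_iff.2 ((LaurentSeries.valuation_le_iff_coeff_lt_eq_zero Fq).1 hc.le)

lemma nhds_V {s : Set (F Fq)} (hs : s ∈ nhds (0 : F Fq)) : ∃ m : ℕ, {c : F Fq | V m c} ⊆ s := by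
  rw [Valued.mem_nhds_zero] at hs
  obtain ⟨γ, hγ⟩ := hs
  have hx0 : MonoidWithZeroHom.ValueGroup₀.embedding γ.1 ≠ 0 := by simp
  obtain ⟨m, hm⟩ : ∃ m : ℤ, MonoidWithZeroHom.ValueGroup₀.embedding γ.1 = WithZero.exp (-m) :=
    ⟨-WithZero.log _, by rw [neg_neg, WithZero.exp_log hx0]⟩
  refine ⟨(m+1).toNat, fun c hc => hγ ?_⟩
  have hc' := (hc : V _ c).mono (Int.self_le_toNat _)
  rw [V_iff, ← LaurentSeries.valuation_le_iff_coeff_lt_eq_zero] at hc'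
  change Valued.v.restrict c < γ.1
  rw [Valuation.restrict_lt_iff_lt_embedding, hm]
  refine hc'.trans_lt ?_
  rw [WithZero.exp_lt_exp]; omega

lemma basis_V : (nhds (0 : F Fq)).HasBasis (fun _ : ℕ => True) fun m => {c | V m c} :=
  ⟨fun s => ⟨fun hs => by simpa using nhds_V hs, fun ⟨m, _, hm⟩ => Filter.mem_of_superset (V_nhds m) hm⟩⟩

lemma continuous_of_V {A : Type*} [TopologicalSpace A] {f : A → F Fq}
    (h : ∀ a, ∀ m : ℕ, ∀ᶠ b in nhds a, V m (f b - f a)) : Continuous f := by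
  rw [continuous_iff_continuousAt]
  intro a
  rw [ContinuousAt, ← tendsto_sub_nhds_zero_iff, basis_V.tendsto_right_iff]
  exact fun m _ => h a m

lemma isOpen_V (m : ℤ) : IsOpen {c : F Fq | V m c} := by
  rw [isOpen_iff_mem_nhds]
  intro c hc
  have : {d : F Fq | V m (d - c)} ∈ nhds c := by
    have h1 : Filter.Tendsto (fun d : F Fq => d - c) (nhds c) (nhds 0) := by
      have : ContinuousAt (fun d : F Fq => d - c) c := by fun_prop
      simpa [ContinuousAt] using this
    exact h1 (V_nhds m)
  filter_upwards [this] with d hd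
  have := hd.add hc
  simpa using this

end
section
variable {Fq n}

lemma isCompact_O : IsCompact {c : F Fq | V 0 c} := by
  letI : TopologicalSpace Fq := ⊥
  haveI : DiscreteTopology Fq := ⟨rfl⟩
  have hcont : Continuous fun a : ℕ → Fq =>
      (HahnSeries.ofPowerSeries ℤ Fq (PowerSeries.mk a) : F Fq) := by
    apply continuous_of_V
    intro a m
    have : ∀ᶠ b in nhds a, ∀ i < m, b i = a i := by
      have h : ∀ i ∈ Finset.range m, ∀ᶠ b in nhds a, b i = a i := fun i _ => by
        have := (continuous_apply (A := fun _ : ℕ => Fq) i).continuousAt (x := a)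
        exact this.eventually (p := fun y => y = a i) (by simp [nhds_discrete])
      simpa using (Filter.eventually_all_finset _).2 h
    filter_upwards [this] with b hb
    rw [V_iff]
    intro k hk
    rcases lt_or_ge k 0 with h | h
    · simp [V_iff.1 (V_ofPowerSeries _) k h]
    · lift k to ℕ using h
      rw [HahnSeries.coeff_sub, coeff_ofPowerSeries, coeff_ofPowerSeries]
      simp [hb k (by omega)]
  have := isCompact_range hcont
  convert this
  ext c
  constructor
  · intro hc
    obtain ⟨f, rfl⟩ := exists_ofPowerSeries hc
    exact ⟨fun k => PowerSeries.coeff k f, by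
      dsimp only; congr 1; ext k; simp⟩
  · rintro ⟨a, rfl⟩
    exact V_ofPowerSeries _

lemma exists_V (c : F Fq) : ∃ m : ℕ, V (-m) c := by
  by_cases hc : c = 0
  · subst hc; exact ⟨0, V.zero⟩
  · exact ⟨c.order.natAbs, (V_order hc).2 (by omega)⟩

lemma isCompact_V (m : ℤ) : IsCompact {c : F Fq | V m c} := by
  have : {c : F Fq | V m c} = (fun c => (HahnSeries.single m (1 : Fq) : F Fq) * c) '' {c | V 0 c} := by
    ext c
    constructor
    · intro hc
      refine ⟨HahnSeries.single (-m) 1 * c, ?_, ?_⟩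
      · simpa using (V_single (m := -m) (1 : Fq) le_rfl).mul hc
      · simp only [← mul_assoc, HahnSeries.single_mul_single]; simp
    · rintro ⟨c, hc, rfl⟩
      simpa using (V_single (m := m) (1 : Fq) le_rfl).mul hc
  rw [this]
  exact isCompact_O.image (by fun_prop)

instance : SecondCountableTopology (F Fq) := by
  haveI : (nhds (0 : F Fq)).IsCountablyGenerated := basis_V.isCountablyGenerated
  haveI : (_root_.uniformity (F Fq)).IsCountablyGenerated :=
    IsUniformAddGroup.uniformity_countably_generated
  haveI : SigmaCompactSpace (F Fq) :=
    ⟨⟨fun m : ℕ => {c | V (-m) c}, fun m => isCompact_V _, by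
      ext c; simpa using exists_V c⟩⟩
  letI := UniformSpace.pseudoMetricSpace (F Fq)
  haveI : TopologicalSpace.SeparableSpace (F Fq) := inferInstance
  exact UniformSpace.secondCountable_of_separable _

instance : LocallyCompactSpace (F Fq) :=
  IsCompact.locallyCompactSpace_of_mem_nhds_of_addGroup isCompact_O (V_nhds 0)
instance : T2Space (F Fq) := inferInstance
end

section
variable {Fq n}

abbrev SG (Fq : Type) [Field Fq] (n : ℕ) := SpecialLinearGroup (Fin n) (F Fq)
abbrev GF (Fq : Type) [Field Fq] (n : ℕ) := GL (Fin n) (F Fq)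
abbrev MF (Fq : Type) [Field Fq] (n : ℕ) := Matrix (Fin n) (Fin n) (F Fq)

instance : IsTopologicalGroup (SG Fq n) :=
  @SpecialLinearGroup.topologicalGroup (Fin n) (F Fq) _ _ _ _ _

instance : BorelSpace (SG Fq n) := ⟨rfl⟩

lemma isClosedEmbedding_val : Topology.IsClosedEmbedding (fun g : SG Fq n => (g : MF Fq n)) :=
  SpecialLinearGroup.isClosedEmbedding_val

instance : SecondCountableTopology (SG Fq n) :=
  haveI : SecondCountableTopology (MF Fq n) :=
    inferInstanceAs (SecondCountableTopology (Fin n → Fin n → F Fq))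
  isClosedEmbedding_val.isInducing.secondCountableTopology

instance : LocallyCompactSpace (SG Fq n) :=
  haveI : LocallyCompactSpace (MF Fq n) := inferInstanceAs (LocallyCompactSpace (Fin n → Fin n → F Fq))
  isClosedEmbedding_val.locallyCompactSpace

instance : T2Space (SG Fq n) := isClosedEmbedding_val.isEmbedding.t2Space

lemma continuous_entry (i j : Fin n) : Continuous fun g : SG Fq n => g i j :=
  (continuous_id.matrix_elem i j).comp isClosedEmbedding_val.continuous

lemma continuous_SG {A : Type*} [TopologicalSpace A] {f : A → SG Fq n}
    (h : ∀ i j, Continuous fun a => f a i j) : Continuous f :=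
  isClosedEmbedding_val.isInducing.continuous_iff.2 (continuous_matrix h)

lemma isCompact_bdd (m : ℤ) : IsCompact {g : SG Fq n | ∀ i j, V m (g i j)} := by
  have : IsCompact {M : MF Fq n | ∀ i j, V m (M i j)} := by
    have h := isCompact_univ_pi (X := fun _ : Fin n => Fin n → F Fq) fun _ : Fin n => isCompact_univ_pi (X := fun _ : Fin n => F Fq)
      fun _ : Fin n => isCompact_V (Fq := Fq) m
    have e : {M : MF Fq n | ∀ i j, V m (M i j)} =
      Set.univ.pi fun _ : Fin n => Set.univ.pi fun _ : Fin n => {c : F Fq | V m c} := by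
      ext M
      exact ⟨fun h i _ j _ => h i j, fun h i j => h i trivial j trivial⟩
    rw [e]; exact h
  exact isClosedEmbedding_val.isCompact_preimage this

lemma finite_bdd (Γ : Subgroup (SG Fq n)) (hΓ : DiscreteTopology Γ) (m : ℤ) :
    {g : SG Fq n | g ∈ Γ ∧ ∀ i j, V m (g i j)}.Finite := by
  have hcl : IsClosed (Γ : Set (SG Fq n)) := Subgroup.isClosed_of_discrete
  have hc : IsCompact ((Γ : Set (SG Fq n)) ∩ {g : SG Fq n | ∀ i j, V m (g i j)}) :=
    (isCompact_bdd m).inter_left hcl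
  refine hc.finite ?_
  have : IsDiscrete (Γ : Set (SG Fq n)) := ⟨hΓ⟩
  exact this.mono Set.inter_subset_left

lemma exists_V_mat {ι κ : Type*} [Finite ι] [Finite κ] (A : Matrix ι κ (F Fq)) :
    ∃ m : ℕ, ∀ i j, V (-m) (A i j) := by
  cases nonempty_fintype ι
  cases nonempty_fintype κ
  choose f hf using fun p : ι × κ => exists_V (A p.1 p.2)
  refine ⟨∑ p, f p, fun i j => (hf (i, j)).mono ?_⟩
  have := Finset.single_le_sum (f := f) (fun _ _ => Nat.zero_le _) (Finset.mem_univ (i, j))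
  omega

lemma V_matmul {ι κ ν : Type*} [Fintype κ] {A : Matrix ι κ (F Fq)} {B : Matrix κ ν (F Fq)} {m l : ℤ}
    (hA : ∀ i j, V m (A i j)) (hB : ∀ i j, V l (B i j)) (i j) : V (m + l) ((A * B) i j) := by
  rw [Matrix.mul_apply]
  exact V.sum fun k _ => (hA _ _).mul (hB _ _)

lemma det_cj (z : GF Fq n) (g : SG Fq n) : (z.1 * g.1 * z⁻¹.1).det = 1 := by
  rw [Matrix.det_mul, Matrix.det_mul, g.2, mul_one, ← Matrix.det_mul, Units.mul_inv, Matrix.det_one]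

/-- conjugation by an element of `GL_n(F)` -/
def cj (z : GF Fq n) : SG Fq n ≃* SG Fq n where
  toFun g := ⟨z.1 * g.1 * z⁻¹.1, det_cj z g⟩
  invFun g := ⟨z⁻¹.1 * g.1 * z.1, det_cj z⁻¹ g⟩
  left_inv g := by
    apply Subtype.ext
    change z⁻¹.1 * (z.1 * g.1 * z⁻¹.1) * z.1 = g.1
    simp only [← mul_assoc, Units.inv_mul, one_mul]
    rw [mul_assoc, Units.inv_mul, mul_one]
  right_inv g := by
    apply Subtype.ext
    change z.1 * (z⁻¹.1 * g.1 * z.1) * z⁻¹.1 = g.1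
    simp only [← mul_assoc, Units.mul_inv, one_mul]
    rw [mul_assoc, Units.mul_inv, mul_one]
  map_mul' g h := by
    apply Subtype.ext
    change z.1 * (g.1 * h.1) * z⁻¹.1 = (z.1 * g.1 * z⁻¹.1) * (z.1 * h.1 * z⁻¹.1)
    simp only [mul_assoc]
    rw [← mul_assoc (z⁻¹.1) z.1, Units.inv_mul, one_mul]

lemma cj_coe (z : GF Fq n) (g : SG Fq n) : (cj z g : MF Fq n) = z.1 * g.1 * z⁻¹.1 := rfl

lemma cj_mul (z w : GF Fq n) (g : SG Fq n) : cj (z * w) g = cj z (cj w g) := by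
  apply Subtype.ext
  rw [cj_coe, cj_coe, cj_coe]
  simp [mul_assoc]

lemma cj_one (g : SG Fq n) : cj 1 g = g := by
  apply Subtype.ext
  rw [cj_coe]; simp

lemma cj_inv_cj (z : GF Fq n) (g : SG Fq n) : cj z⁻¹ (cj z g) = g := by
  rw [← cj_mul, inv_mul_cancel, cj_one]
lemma cj_cj_inv (z : GF Fq n) (g : SG Fq n) : cj z (cj z⁻¹ g) = g := by
  rw [← cj_mul, mul_inv_cancel, cj_one]
lemma cj_symm (z : GF Fq n) : (cj z).symm = cj z⁻¹ := by
  ext1 g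
  rw [MulEquiv.symm_apply_eq, cj_cj_inv]

lemma cj_SL (z g : SG Fq n) : cj (z : GF Fq n) g = z * g * z⁻¹ := by
  apply Subtype.ext
  rw [cj_coe]
  have : ((z : GF Fq n)⁻¹).1 = ((z⁻¹ : SG Fq n) : MF Fq n) := by
    rw [← map_inv]; rfl
  rw [this]; rfl

lemma continuous_cj (z : GF Fq n) : Continuous (cj z) := by
  refine isClosedEmbedding_val.isInducing.continuous_iff.2 ?_
  change Continuous fun g : SG Fq n => z.1 * (g : MF Fq n) * z⁻¹.1
  exact (continuous_const.matrix_mul isClosedEmbedding_val.continuous).matrix_mul continuous_const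

/-- the embedding `𝔽_q[[X]] → F` -/
abbrev ofO : PowerSeries Fq →+* F Fq := HahnSeries.ofPowerSeries ℤ Fq

lemma ofO_inj : Function.Injective (ofO : PowerSeries Fq →+* F Fq) :=
  HahnSeries.ofPowerSeries_injective

abbrev SO (Fq : Type) [Field Fq] (n : ℕ) := SpecialLinearGroup (Fin n) (PowerSeries Fq)

def ιK : SO Fq n →* SG Fq n := SpecialLinearGroup.map ofO
lemma ιK_apply (g : SO Fq n) (i j) : ιK g i j = ofO (g i j) := rfl
lemma ιK_inj : Function.Injective (ιK : SO Fq n →* SG Fq n) := by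
  intro g h hgh
  ext1 i j
  apply ofO_inj
  rw [← ιK_apply, hgh, ιK_apply]

/-- `SL_n(O)` -/
def KK (Fq : Type) [Field Fq] (n : ℕ) : Subgroup (SG Fq n) := (ιK (Fq := Fq) (n := n)).range

def red : SO Fq n →* SpecialLinearGroup (Fin n) Fq := SpecialLinearGroup.map PowerSeries.constantCoeff
lemma red_apply (g : SO Fq n) (i j) : red g i j = PowerSeries.constantCoeff (g i j) := rfl

lemma exists_ofO_mat {A : MF Fq n} (h : ∀ i j, V 0 (A i j)) :
    ∃ B : Matrix (Fin n) (Fin n) (PowerSeries Fq), B.map ofO = A := by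
  choose B hB using fun i j => exists_ofPowerSeries (h i j)
  exact ⟨Matrix.of B, by ext1 i j; exact hB i j⟩

lemma mem_KK {g : SG Fq n} : g ∈ KK Fq n ↔ ∀ i j, V 0 (g i j) := by
  constructor
  · rintro ⟨h, rfl⟩ i j
    exact V_ofPowerSeries _
  · intro h
    obtain ⟨B, hB⟩ := exists_ofO_mat h
    refine ⟨⟨B, ?_⟩, ?_⟩
    · apply ofO_inj
      rw [RingHom.map_det, RingHom.mapMatrix_apply, hB, map_one]; exact g.2
    · ext1 i j
      change ofO (B i j) = _
      rw [← hB]; rfl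

/-- the first congruence subgroup -/
def K1 (Fq : Type) [Field Fq] (n : ℕ) : Subgroup (SG Fq n) := (red (Fq := Fq) (n := n)).ker.map ιK

lemma V_one_ofO {f : PowerSeries Fq} : V 1 (ofO f) ↔ PowerSeries.constantCoeff f = 0 := by
  rw [← coeff_zero_ofPowerSeries, V_iff]
  constructor
  · intro h; exact h 0 one_pos
  · intro h k hk
    rcases (show k < 0 ∨ k = 0 by omega) with h' | rfl
    · exact V_iff.1 (V_ofPowerSeries f) k h'
    · exact h

lemma K1_le : K1 Fq n ≤ KK Fq n := by
  rintro _ ⟨h, _, rfl⟩; exact ⟨h, rfl⟩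

lemma ιK_mem_K1 {h : SO Fq n} : ιK h ∈ K1 Fq n ↔ red h = 1 := by
  constructor
  · rintro ⟨h', hh, he⟩
    rw [← ιK_inj he]; exact hh
  · intro hh; exact ⟨h, hh, rfl⟩

lemma mem_K1 {g : SG Fq n} : g ∈ K1 Fq n ↔ ∀ i j, V 1 ((g.1 - 1) i j) := by
  have key : ∀ h : SO Fq n, red h = 1 ↔ ∀ i j, V 1 (((ιK h).1 - 1) i j) := by
    intro h
    have : ∀ i j, ((ιK h).1 - 1) i j = ofO ((h.1 - 1) i j) := by
      intro i j
      rw [Matrix.sub_apply, Matrix.sub_apply, map_sub]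
      congr 1
      by_cases hij : i = j <;> simp [hij, Matrix.one_apply]
    simp only [this, V_one_ofO]
    simp only [Matrix.sub_apply, map_sub]
    constructor
    · intro e i j
      have := congrArg (fun m : SpecialLinearGroup (Fin n) Fq => m i j) e
      simp only [red_apply] at this
      rw [this]
      by_cases hij : i = j <;> simp [hij, Matrix.one_apply]
    · intro e
      ext1 i j
      have := sub_eq_zero.1 (e i j)
      rw [red_apply, this]
      by_cases hij : i = j <;> simp [hij, Matrix.one_apply]
  constructor
  · intro hg
    obtain ⟨h, rfl⟩ := K1_le hg
    exact (key h).1 (ιK_mem_K1.1 hg)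
  · intro hg
    have : g ∈ KK Fq n := mem_KK.2 fun i j => by
      have h1 : V 0 ((1 : MF Fq n) i j) := by
        by_cases hij : i = j <;> simp [hij, Matrix.one_apply, V_one, V.zero]
      have := ((hg i j).mono zero_le_one).add h1
      simpa using this
    obtain ⟨h, rfl⟩ := this
    exact ιK_mem_K1.2 ((key h).2 hg)

lemma isOpen_KK : IsOpen (KK Fq n : Set (SG Fq n)) := by
  have : (KK Fq n : Set (SG Fq n)) = ⋂ i, ⋂ j, (fun g : SG Fq n => g i j) ⁻¹' {c | V 0 c} := by
    ext g; simp [mem_KK]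
  rw [this]
  exact isOpen_iInter_of_finite fun i => isOpen_iInter_of_finite fun j =>
    (isOpen_V 0).preimage (continuous_entry i j)

lemma isOpen_K1 : IsOpen (K1 Fq n : Set (SG Fq n)) := by
  have : (K1 Fq n : Set (SG Fq n)) =
      ⋂ i, ⋂ j, (fun g : SG Fq n => g i j - (1 : MF Fq n) i j) ⁻¹' {c | V 1 c} := by
    ext g; simp [mem_K1]
  rw [this]
  exact isOpen_iInter_of_finite fun i => isOpen_iInter_of_finite fun j =>
    (isOpen_V 1).preimage ((continuous_entry i j).sub continuous_const)

lemma isCompact_KK : IsCompact (KK Fq n : Set (SG Fq n)) := by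
  convert isCompact_bdd (Fq := Fq) (n := n) 0 using 1
  ext g; simp [mem_KK]

/-- `Γ ∩ z K z⁻¹` -/
def stab (Γ : Subgroup (SG Fq n)) (z : GF Fq n) : Subgroup (SG Fq n) :=
  Γ ⊓ (KK Fq n).map (cj z).toMonoidHom

lemma mem_stab {Γ : Subgroup (SG Fq n)} {z : GF Fq n} {g : SG Fq n} :
    g ∈ stab Γ z ↔ g ∈ Γ ∧ cj z⁻¹ g ∈ KK Fq n := by
  rw [stab, Subgroup.mem_inf]
  refine and_congr_right fun _ => ⟨?_, fun h => ⟨_, h, cj_cj_inv z g⟩⟩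
  rintro ⟨k, hk, rfl⟩
  change cj z⁻¹ (cj z k) ∈ _
  rw [cj_inv_cj]; exact hk

lemma finite_stab (Γ : Subgroup (SG Fq n)) (hΓ : DiscreteTopology Γ) (z : GF Fq n) :
    Finite (stab Γ z) := by
  obtain ⟨a, ha⟩ := exists_V_mat z.1
  obtain ⟨b, hb⟩ := exists_V_mat z⁻¹.1
  refine ((finite_bdd Γ hΓ (-a + 0 + -b)).subset fun g hg => ?_).to_subtype
  obtain ⟨h1, h2⟩ := mem_stab.1 hg
  refine ⟨h1, fun i j => ?_⟩
  have := V_matmul (V_matmul ha (mem_KK.1 h2)) hb i j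
  rw [← cj_coe, cj_cj_inv] at this
  exact this

lemma stab_map (Γ : Subgroup (SG Fq n)) (w z : GF Fq n) :
    Nat.card (stab (Γ.map (cj w).toMonoidHom) z) = Nat.card (stab Γ (w⁻¹ * z)) := by
  refine Nat.card_congr ((cj w⁻¹).toEquiv.subtypeEquiv fun g => ?_)
  change g ∈ stab _ _ ↔ cj w⁻¹ g ∈ stab _ _
  rw [mem_stab, mem_stab, _root_.mul_inv_rev, inv_inv, cj_mul, cj_cj_inv]
  refine and_congr_left fun _ => ⟨?_, fun h => ⟨_, h, cj_cj_inv w g⟩⟩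
  rintro ⟨k, hk, rfl⟩
  change cj w⁻¹ (cj w k) ∈ _
  rw [cj_inv_cj]; exact hk

end

section
variable {Fq n}

/-- finiteness consequence of discreteness -/
def FB (Γ : Subgroup (SG Fq n)) : Prop :=
  ∀ (g : GF Fq n) (m : ℤ), {γ : SG Fq n | γ ∈ Γ ∧ ∀ i j, V m (cj g⁻¹ γ i j)}.Finite

lemma FB_of_discrete (Γ : Subgroup (SG Fq n)) (hΓ : DiscreteTopology Γ) : FB Γ := by
  intro z m
  obtain ⟨a, ha⟩ := exists_V_mat z.1
  obtain ⟨b, hb⟩ := exists_V_mat z⁻¹.1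
  refine (finite_bdd Γ hΓ (-a + m + -b)).subset fun g hg => ⟨hg.1, fun i j => ?_⟩
  have := V_matmul (V_matmul ha hg.2) hb i j
  rw [← cj_coe, cj_cj_inv] at this
  exact this

lemma exists_fixed {p : ℕ} (hp : p.Prime) {H : Type*} [Group H] [Finite H] (hH : IsPGroup p H)
    {Q : Type*} [AddCommGroup Q] [DistribMulAction H Q] [Nontrivial Q] (hQ : ∀ x : Q, p • x = 0) :
    ∃ x : Q, x ≠ 0 ∧ ∀ h : H, h • x = x := by
  haveI : Fact p.Prime := ⟨hp⟩
  obtain ⟨x, hx⟩ := exists_ne (0 : Q)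
  let A := AddSubgroup.closure (Set.range fun h : H => h • x)
  have hA : ∀ (h : H), ∀ y ∈ A, h • y ∈ A := by
    intro h y hy
    induction hy using AddSubgroup.closure_induction with
    | mem y hy =>
      obtain ⟨h', rfl⟩ := hy
      exact AddSubgroup.subset_closure ⟨h * h', mul_smul _ _ _⟩
    | zero => rw [smul_zero]; exact A.zero_mem
    | add a b _ _ h1 h2 => rw [smul_add]; exact A.add_mem h1 h2
    | neg a _ h1 => rw [smul_neg]; exact A.neg_mem h1
  haveI : AddGroup.FG A := by
    rw [AddGroup.fg_iff_addSubgroup_fg]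
    exact (AddSubgroup.fg_iff _).2 ⟨_, rfl, Set.finite_range _⟩
  have htor : AddMonoid.IsTorsion A := fun a => isOfFinAddOrder_iff_nsmul_eq_zero.2
    ⟨p, hp.pos, Subtype.ext (hQ a)⟩
  haveI : Finite A := AddCommGroup.finite_of_fg_torsion _ htor
  letI : MulAction H A :=
    { smul := fun h a => ⟨h • (a : Q), hA h a a.2⟩
      one_smul := fun a => Subtype.ext (one_smul _ _)
      mul_smul := fun a b c => Subtype.ext (mul_smul _ _ _) }
  have hmem : x ∈ A := AddSubgroup.subset_closure ⟨1, one_smul _ _⟩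
  have hdvd : p ∣ Nat.card A := by
    have h1 : addOrderOf (⟨x, hmem⟩ : A) = p := addOrderOf_eq_prime (Subtype.ext (hQ x))
      (fun h => hx (congrArg Subtype.val h))
    rw [← h1]; exact addOrderOf_dvd_natCard _
  have h0 : (0 : A) ∈ MulAction.fixedPoints H A := fun h => Subtype.ext (smul_zero _)
  obtain ⟨b, hb, hb0⟩ := hH.exists_fixed_point_of_prime_dvd_card_of_fixed_point A hdvd h0
  exact ⟨b, fun h => hb0 (Subtype.ext h.symm), fun h => congrArg Subtype.val (hb h)⟩

lemma p_smul {p : ℕ} [CharP Fq p] (x : F Fq) : p • x = 0 := by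
  rw [nsmul_eq_mul, show ((p : ℕ) : F Fq) = HahnSeries.C ((p : ℕ) : Fq) from (map_natCast _ _).symm, CharP.cast_eq_zero,
    map_zero, zero_mul]

lemma exists_fixed_vec {p : ℕ} (hp : p.Prime) [CharP Fq p] {H : Type*} [Group H] [Finite H]
    (hH : IsPGroup p H) {ι : Type*} [Fintype ι] [DecidableEq ι] [Nonempty ι]
    (ρ : H →* Matrix ι ι (F Fq)) : ∃ v : ι → F Fq, v ≠ 0 ∧ ∀ h, ρ h *ᵥ v = v := by
  letI : DistribMulAction H (ι → F Fq) :=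
    { smul := fun h v => ρ h *ᵥ v
      one_smul := fun v => by change ρ 1 *ᵥ v = v; simp
      mul_smul := fun a b v => by change ρ (a * b) *ᵥ v = ρ a *ᵥ (ρ b *ᵥ v); simp
      smul_zero := fun a => Matrix.mulVec_zero _
      smul_add := fun a b c => Matrix.mulVec_add _ _ _ }
  exact exists_fixed hp hH (fun x => by ext1 i; exact p_smul _)

/-- scaled congruence set -/
def Sc (Γ : Subgroup (SG Fq n)) (g : GF Fq n) (a : Fin n → ℤ) (r : ℤ) : Set (SG Fq n) :=
  {γ | γ ∈ Γ ∧ ∀ i j, VN (n * (n + 1)) (r + a i - a j) (((cj g⁻¹ γ).1 - 1) i j)}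

lemma VN_matmul {N : ℤ} {A B : MF Fq n} {a b c : Fin n → ℤ} {r s : ℤ}
    (hA : ∀ i j, VN N (r + a i - b j) (A i j)) (hB : ∀ i j, VN N (s + b i - c j) (B i j)) (i j) :
    VN N (r + s + a i - c j) ((A * B) i j) := by
  rw [Matrix.mul_apply]
  exact VN.sum fun k _ => ((hA _ _).mul (hB _ _)).mono (by linarith)

lemma VN_to_V {N : ℤ} (hN : 0 < N) {k : ℤ} {c : F Fq} (h : VN N (N * k) c) : V k c :=
  V_iff.2 fun j hj => h j (by nlinarith)

lemma Sc_mono {Γ : Subgroup (SG Fq n)} {g : GF Fq n} {a : Fin n → ℤ} {r s : ℤ} (h : r ≤ s) :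
    Sc Γ g a s ⊆ Sc Γ g a r := fun _ hγ => ⟨hγ.1, fun i j => (hγ.2 i j).mono (by linarith)⟩

lemma Sc_finite (hn : 0 < n) {Γ : Subgroup (SG Fq n)} (hΓ : FB Γ) (g : GF Fq n) (a : Fin n → ℤ)
    (r : ℤ) : (Sc Γ g a r).Finite := by
  set N : ℤ := n * (n + 1) with hNdef
  have hN : 0 < N := by positivity
  let b : ℕ := ∑ i, (a i).natAbs
  have hb : ∀ i, (a i).natAbs ≤ b := fun i =>
    Finset.single_le_sum (f := fun i => (a i).natAbs) (fun _ _ => Nat.zero_le _) (Finset.mem_univ i)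
  let m : ℤ := -(|r| + 2 * b)
  refine (hΓ g m).subset fun γ hγ => ⟨hγ.1, fun i j => ?_⟩
  have h1 : V m (((cj g⁻¹ γ).1 - 1) i j) := by
    apply VN_to_V hN
    refine (hγ.2 i j).mono ?_
    have hm : m ≤ 0 := by have := abs_nonneg r; omega
    have h2 : N * m ≤ m := by nlinarith
    have := hb i; have := hb j
    have := neg_abs_le r
    omega
  have h2 : V m ((1 : MF Fq n) i j) := by
    refine V.mono (m := 0) ?_ (by have := abs_nonneg r; omega)
    by_cases hij : i = j <;> simp [hij, Matrix.one_apply, V_one, V.zero]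
  simpa using h1.add h2

lemma Sc_one {Γ : Subgroup (SG Fq n)} {g : GF Fq n} {a : Fin n → ℤ} {r : ℤ} : 1 ∈ Sc Γ g a r := by
  refine ⟨Γ.one_mem, fun i j => ?_⟩
  simpa using VN.zero

lemma Sc_mul {Γ : Subgroup (SG Fq n)} {g : GF Fq n} {a : Fin n → ℤ} {r : ℤ} (hr : 0 ≤ r)
    {γ δ : SG Fq n} (h1 : γ ∈ Sc Γ g a r) (h2 : δ ∈ Sc Γ g a r) : γ * δ ∈ Sc Γ g a r := by
  refine ⟨Γ.mul_mem h1.1 h2.1, fun i j => ?_⟩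
  have e : (cj g⁻¹ (γ * δ)).1 - 1 = ((cj g⁻¹ γ).1 - 1) * ((cj g⁻¹ δ).1 - 1) +
      (((cj g⁻¹ γ).1 - 1) + ((cj g⁻¹ δ).1 - 1)) := by
    rw [map_mul]
    change (cj g⁻¹ γ).1 * (cj g⁻¹ δ).1 - 1 = _
    noncomm_ring
  rw [e]
  exact ((VN_matmul h1.2 h2.2 i j).mono (by linarith)).add ((h1.2 i j).add (h2.2 i j))

lemma charP_MF (hn : 0 < n) {p : ℕ} [CharP Fq p] : CharP (MF Fq n) p := by
  haveI : CharP (F Fq) p := charP_of_injective_ringHom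
    (f := (HahnSeries.C : Fq →+* F Fq)) HahnSeries.C_injective p
  haveI : Nonempty (Fin n) := ⟨⟨0, hn⟩⟩
  infer_instance

lemma Sc_pow (hn : 0 < n) {p : ℕ} (hp : p.Prime) [CharP Fq p] {Γ : Subgroup (SG Fq n)} (hΓ : FB Γ)
    {g : GF Fq n} {a : Fin n → ℤ} {r : ℤ} (hr : 1 ≤ r) {γ : SG Fq n} (hγ : γ ∈ Sc Γ g a r) :
    ∃ k : ℕ, γ ^ p ^ k = 1 := by
  haveI := charP_MF (Fq := Fq) hn (p := p)
  haveI : Fact p.Prime := ⟨hp⟩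
  set N : ℤ := n * (n + 1) with hNdef
  have hN : 0 < N := by positivity
  set A := (cj g⁻¹ γ).1 - 1 with hA
  have hpow : ∀ m : ℕ, ∀ i j, VN N (m * r + a i - a j) ((A ^ (m + 1)) i j) := by
    intro m
    induction m with
    | zero => intro i j; rw [zero_add, pow_one]; exact (hγ.2 i j).mono (by push_cast; linarith)
    | succ m ih =>
      intro i j
      rw [pow_succ]
      exact (VN_matmul ih hγ.2 i j).mono (by push_cast; linarith)
  have hmem : ∀ k : ℕ, γ ^ k ∈ Sc Γ g a r := by
    intro k
    induction k with
    | zero => exact Sc_one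
    | succ k ih => rw [pow_succ]; exact Sc_mul (by omega) ih hγ
  have hfr : ∀ k : ℕ, (cj g⁻¹ (γ ^ p ^ k)).1 - 1 = A ^ p ^ k := by
    intro k
    rw [hA, sub_pow_char_pow_of_commute _ _ (Commute.one_right _), one_pow, map_pow]
    rfl
  haveI := (Sc_finite hn hΓ g a r).to_subtype
  obtain ⟨y, hy⟩ := Finite.exists_infinite_fiber
    (fun k : ℕ => (⟨γ ^ p ^ k, hmem _⟩ : Sc Γ g a r))
  have hinf := Set.infinite_coe_iff.1 hy
  obtain ⟨k0, hk0⟩ := hinf.nonempty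
  refine ⟨k0, ?_⟩
  have hzero : A ^ p ^ k0 = 0 := by
    ext1 i j
    refine eq_zero_of_V fun m => ?_
    obtain ⟨k, hk, hkm⟩ := hinf.exists_gt ((N * m).toNat + (a i).natAbs + (a j).natAbs + 1)
    have hAk : A ^ p ^ k0 = A ^ p ^ k := by
      rw [← hfr, ← hfr]
      have : γ ^ p ^ k0 = γ ^ p ^ k := congrArg Subtype.val ((hk0 : _ = y).trans (hk : _ = y).symm)
      rw [this]
    rw [hAk]
    have hkp : k < p ^ k := Nat.lt_pow_self hp.one_lt
    obtain ⟨l, hl⟩ : ∃ l, p ^ k = l + 1 := ⟨p ^ k - 1, by omega⟩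
    rw [hl]
    apply VN_to_V hN
    refine (hpow l i j).mono ?_
    have h1 : (l : ℤ) ≤ l * r := by nlinarith
    have h2 := Int.self_le_toNat (N * m)
    omega
  have h1 : (cj g⁻¹ (γ ^ p ^ k0)).1 = 1 := by
    rw [← sub_eq_zero, hfr, hzero]
  have : cj g⁻¹ (γ ^ p ^ k0) = 1 := Subtype.ext h1
  exact (map_eq_one_iff _ (cj g⁻¹).injective).1 this

/-- `Sc` as a subgroup -/
def Sg (hn : 0 < n) {p : ℕ} (hp : p.Prime) [CharP Fq p] {Γ : Subgroup (SG Fq n)} (hΓ : FB Γ)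
    (g : GF Fq n) (a : Fin n → ℤ) {r : ℤ} (hr : 1 ≤ r) : Subgroup (SG Fq n) where
  carrier := Sc Γ g a r
  one_mem' := Sc_one
  mul_mem' := Sc_mul (by omega)
  inv_mem' := by
    intro γ hγ
    obtain ⟨k, hk⟩ := Sc_pow hn hp hΓ hr hγ
    have hmem : ∀ k : ℕ, γ ^ k ∈ Sc Γ g a r := by
      intro k
      induction k with
      | zero => exact Sc_one
      | succ k ih => rw [pow_succ]; exact Sc_mul (by omega) ih hγ
    have hpk : 0 < p ^ k := pow_pos hp.pos _
    have : γ⁻¹ = γ ^ (p ^ k - 1) := by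
      rw [inv_eq_iff_mul_eq_one, ← pow_succ', Nat.sub_add_cancel hpk, hk]
    change γ⁻¹ ∈ Sc Γ g a r
    rw [this]; exact hmem _

lemma Sc_change {Γ : Subgroup (SG Fq n)} {g k : GF Fq n} {a : Fin n → ℤ}
    (h1 : ∀ i j, VN (n * (n + 1)) (0 + a i - a j) (k.1 i j))
    (h2 : ∀ i j, VN (n * (n + 1)) (0 + a i - a j) (k⁻¹.1 i j)) (r : ℤ) :
    Sc Γ (g * k) a r = Sc Γ g a r := by
  have key : ∀ (g k : GF Fq n), (∀ i j, VN (n * (n + 1)) (0 + a i - a j) (k.1 i j)) →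
      (∀ i j, VN (n * (n + 1)) (0 + a i - a j) (k⁻¹.1 i j)) → Sc Γ g a r ⊆ Sc Γ (g * k) a r := by
    intro g k h1 h2 γ hγ
    refine ⟨hγ.1, fun i j => ?_⟩
    have e : (cj (g * k)⁻¹ γ).1 - 1 = k⁻¹.1 * ((cj g⁻¹ γ).1 - 1) * k.1 := by
      rw [_root_.mul_inv_rev, cj_mul, cj_coe, inv_inv, mul_sub, sub_mul, mul_one, Units.inv_mul]
    rw [e]
    exact (VN_matmul (VN_matmul h2 hγ.2) h1 i j).mono (by linarith)
  refine subset_antisymm ?_ (key g k h1 h2)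
  have := key (g * k) k⁻¹ h2 (by rw [inv_inv]; exact h1)
  rwa [mul_inv_cancel_right] at this
end

section
variable {Fq n}

/-- `M - 1` in coordinates `g` -/
abbrev Nm (g : GF Fq n) (γ : SG Fq n) : MF Fq n := (cj g⁻¹ γ).1 - 1

lemma Nm_change (g k : GF Fq n) (γ : SG Fq n) : Nm (g * k) γ = k⁻¹.1 * Nm g γ * k.1 := by
  rw [Nm, _root_.mul_inv_rev, cj_mul, cj_coe, inv_inv, mul_sub, sub_mul, mul_one, Units.inv_mul]

/-- the unipotent matrix `1 + u e_{i0}ᵀ` -/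
def colU (i0 : Fin n) (u : Fin n → F Fq) (hu : u i0 = 0) : GF Fq n where
  val := 1 + Matrix.vecMulVec u (Pi.single i0 1)
  inv := 1 - Matrix.vecMulVec u (Pi.single i0 1)
  val_inv := by
    have : Matrix.vecMulVec u (Pi.single i0 1) * Matrix.vecMulVec u (Pi.single i0 1) = 0 := by
      rw [Matrix.vecMulVec_mul_vecMulVec]; simp [hu]
    rw [add_mul, mul_sub, mul_sub, this]; simp
  inv_val := by
    have : Matrix.vecMulVec u (Pi.single i0 1) * Matrix.vecMulVec u (Pi.single i0 1) = 0 := by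
      rw [Matrix.vecMulVec_mul_vecMulVec]; simp [hu]
    rw [sub_mul, mul_add, mul_add, this]; simp

/-- partial flag predicate -/
def Fl (T : Set (SG Fq n)) (g : GF Fq n) (J : Finset (Fin n)) (ρ : Fin n → ℕ) : Prop :=
  (∀ j ∈ J, ρ j < J.card) ∧
    ∀ γ ∈ T, ∀ i j, j ∈ J → (i ∉ J ∨ ρ j ≤ ρ i) → Nm g γ i j = 0

lemma flag_step (hn : 0 < n) {p : ℕ} (hp : p.Prime) [CharP Fq p] {Γ : Subgroup (SG Fq n)} (hΓ : FB Γ)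
    (g : GF Fq n) (a : Fin n → ℤ) (J : Finset (Fin n)) (ρ : Fin n → ℕ)
    (hF : Fl (Sc Γ g a 1) g J ρ) (hJ : ∃ i, i ∉ J) :
    ∃ (g' : GF Fq n) (i0 : Fin n) (ρ' : Fin n → ℕ), i0 ∉ J ∧ (∀ r, Sc Γ g' a r = Sc Γ g a r) ∧
      Fl (Sc Γ g a 1) g' (insert i0 J) ρ' := by
  classical
  set N : ℤ := n * (n + 1) with hNdef
  have hN : 0 < N := by positivity
  haveI : Nonempty {i // i ∉ J} := hJ.elim fun i hi => ⟨⟨i, hi⟩⟩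
  let S := Sg hn hp hΓ g a (r := 1) le_rfl
  haveI : Finite S := (Sc_finite hn hΓ g a 1).to_subtype
  have hS : IsPGroup p S := fun γ => by
    obtain ⟨k, hk⟩ := Sc_pow hn hp hΓ le_rfl γ.2
    exact ⟨k, Subtype.ext hk⟩
  have hz : ∀ γ ∈ Sc Γ g a 1, ∀ i j, i ∉ J → j ∈ J → (cj g⁻¹ γ) i j = 0 := by
    intro γ hγ i j hi hj
    have := hF.2 γ hγ i j hj (Or.inl hi)
    have hij : i ≠ j := fun h => hi (h ▸ hj)
    simpa [Nm, hij] using this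
  let R : S →* Matrix {i // i ∉ J} {i // i ∉ J} (F Fq) :=
    { toFun := fun γ => (cj g⁻¹ γ.1).1.submatrix Subtype.val Subtype.val
      map_one' := by
        ext1 i j
        simp [Matrix.one_apply, Subtype.ext_iff]
      map_mul' := fun γ δ => by
        ext1 i j
        have : (cj g⁻¹ (γ.1 * δ.1)).1 = (cj g⁻¹ γ.1).1 * (cj g⁻¹ δ.1).1 := by rw [map_mul]; rfl
        change (cj g⁻¹ (γ.1 * δ.1)).1 i.1 j.1 = _
        rw [this, Matrix.mul_apply, Matrix.mul_apply,
          ← Fintype.sum_subtype_add_sum_subtype (fun i => i ∉ J)]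
        simp only [Matrix.submatrix_apply, add_eq_left]
        exact Finset.sum_eq_zero fun k _ => by
          rw [hz γ.1 γ.2 i.1 k.1 i.2 (not_not.1 k.2), zero_mul] }
  obtain ⟨v, hv0, hv⟩ := exists_fixed_vec hp hS R
  -- minimal index
  obtain ⟨i1, hi1⟩ := Function.ne_iff.1 hv0
  obtain ⟨i0, hi0, hmin⟩ := Finset.exists_min_image (Finset.univ.filter fun i => v i ≠ 0)
    (fun i => N * (v i).order - a i.1) ⟨i1, by simpa using hi1⟩
  simp only [Finset.mem_filter, Finset.mem_univ, true_and] at hi0 hmin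
  let c : Fin n → F Fq := fun i => if h : i ∉ J then v ⟨i, h⟩ * (v i0)⁻¹ else 0
  have hci0 : c i0 = 1 := by
    simp [c, i0.2, hi0]
  have hcV : ∀ i, VN N (a i - a i0) (c i) := by
    intro i
    by_cases h : i ∉ J
    · have hc : c i = v ⟨i, h⟩ * (v i0)⁻¹ := by simp [c, h]
      by_cases hvi : v ⟨i, h⟩ = 0
      · rw [hc, hvi, zero_mul]; exact VN.zero
      · have h1 := hmin ⟨i, h⟩ hvi
        have h2 : c i * v i0 = v ⟨i, h⟩ := by rw [hc, inv_mul_cancel_right₀ hi0]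
        have hcne : c i ≠ 0 := by
          intro h0; rw [h0, zero_mul] at h2; exact hvi h2.symm
        have h3 : (v ⟨i, h⟩).order = (c i).order + (v i0).order := by
          rw [← h2, HahnSeries.order_mul hcne hi0]
        rw [VN_order hN hcne]
        dsimp only at h1
        rw [h3] at h1
        linarith
    · have hc : c i = 0 := by simp [c, h]
      rw [hc]; exact VN.zero
  have hcJ : ∀ i ∈ J, c i = 0 := fun i hi => by simp [c, hi]
  have hcfix : ∀ γ ∈ Sc Γ g a 1, ∀ i ∉ J, (Nm g γ *ᵥ c) i = 0 := by
    intro γ hγ i hi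
    have h1 := congrFun (hv ⟨γ, hγ⟩) ⟨i, hi⟩
    have h2 : ((cj g⁻¹ γ).1 *ᵥ c) i = c i := by
      have hc : c i = v ⟨i, hi⟩ * (v i0)⁻¹ := by simp [c, hi]
      rw [hc, ← h1, Matrix.mulVec, Matrix.mulVec, dotProduct, dotProduct,
        ← Fintype.sum_subtype_add_sum_subtype (fun i => i ∉ J), Finset.sum_mul]
      have : ∑ j : {i // ¬ i ∉ J}, (cj g⁻¹ γ).1 i j * c j = 0 :=
        Finset.sum_eq_zero fun k _ => by rw [hcJ _ (not_not.1 k.2), mul_zero]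
      rw [this, add_zero]
      refine Finset.sum_congr rfl fun k _ => ?_
      have : c k.1 = v k * (v i0)⁻¹ := by simp [c, k.2]
      rw [this, ← mul_assoc]; rfl
    rw [Nm, Matrix.sub_mulVec, Matrix.one_mulVec, Pi.sub_apply, h2, sub_self]
  let u : Fin n → F Fq := fun i => if i = i0 then 0 else c i
  have hu0 : u i0 = 0 := by simp [u]
  have huV : ∀ i, VN N (a i - a i0) (u i) := by
    intro i; by_cases h : i = i0
    · simpa [u, h] using VN.zero
    · simpa [u, h] using hcV i
  have huc : ∀ i, u i + Pi.single (M := fun _ => F Fq) i0.1 1 i = c i := by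
    intro i; by_cases h : i = i0
    · subst h; simp [hu0, hci0]
    · simp [u, h]
  let k : GF Fq n := colU i0 u hu0
  have hk : ∀ i j, VN N (0 + a i - a j) (Matrix.vecMulVec u (Pi.single i0.1 1) i j) := by
    intro i j
    rw [Matrix.vecMulVec_apply]
    by_cases h : j = i0
    · subst h; simpa using huV i
    · simpa [h] using VN.zero
  have hone : ∀ i j, VN N (0 + a i - a j) ((1 : MF Fq n) i j) := by
    intro i j
    by_cases h : i = j
    · subst h
      simpa using VN_single (N := N) (k := 0) (1 : Fq) (m := 0) (by simp)
    · simpa [h] using VN.zero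
  refine ⟨g * k, i0, fun i => if i = i0 then J.card else ρ i, i0.2,
    Sc_change (fun i j => (hone i j).add (hk i j)) (fun i j => (hone i j).sub (hk i j)), ?_, ?_⟩
  · intro j hj
    rw [Finset.card_insert_of_notMem i0.2]
    rcases Finset.mem_insert.1 hj with rfl | h
    · simp
    · have := hF.1 j h
      dsimp only
      split_ifs <;> omega
  · intro γ hγ i j hj hij
    have hW : ∀ i j, Nm (g * k) γ i j = (Nm g γ * k.1) i j - u i * (Nm g γ * k.1) i0 j := by
      intro i j
      rw [Nm_change, mul_assoc]
      change ((1 - Matrix.vecMulVec u (Pi.single i0.1 1)) * _ : MF Fq n) i j = _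
      rw [sub_mul, one_mul, Matrix.sub_apply, Matrix.vecMulVec_mul, Matrix.vecMulVec_apply,
        Matrix.single_one_vecMul]
      rfl
    have hcol : ∀ i j, (Nm g γ * k.1) i j = if j = i0 then (Nm g γ *ᵥ c) i else Nm g γ i j := by
      intro i j
      change (_ * (1 + Matrix.vecMulVec u (Pi.single i0.1 1)) : MF Fq n) i j = _
      rw [mul_add, mul_one, Matrix.add_apply, Matrix.mul_vecMulVec, Matrix.vecMulVec_apply]
      have hc : c = u + Pi.single i0.1 1 := by ext1 i; exact (huc i).symm
      split_ifs with h
      · subst h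
        rw [hc, Matrix.mulVec_add, Pi.add_apply]
        simp [add_comm]
      · simp [h]
    rw [hW, hcol, hcol]
    rcases eq_or_ne j i0 with h | h
    · have hi : i ∉ J := by
        intro hi
        rcases hij with h' | h'
        · exact h' (Finset.mem_insert_of_mem hi)
        · have h1 := hF.1 i hi
          have h2 : i ≠ i0.1 := fun e => i0.2 (e ▸ hi)
          simp only [h, h2, if_true, if_false] at h'
          omega
      rw [if_pos h, if_pos h, hcfix γ hγ i hi, hcfix γ hγ i0 i0.2]; simp
    · have hjJ : j ∈ J := (Finset.mem_insert.1 hj).resolve_left h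
      rw [if_neg h, if_neg h, hF.2 γ hγ i0 j hjJ (Or.inl i0.2), mul_zero, sub_zero]
      apply hF.2 γ hγ i j hjJ
      rcases hij with h' | h'
      · left; exact fun e => h' (Finset.mem_insert_of_mem e)
      · by_cases hi : i = i0
        · left; rw [hi]; exact i0.2
        · right; simpa [h, hi] using h'

lemma exists_flag (hn : 0 < n) {p : ℕ} (hp : p.Prime) [CharP Fq p] {Γ : Subgroup (SG Fq n)}
    (hΓ : FB Γ) (g : GF Fq n) (a : Fin n → ℤ) :
    ∃ (g' : GF Fq n) (ρ : Fin n → ℕ), (∀ r, Sc Γ g' a r = Sc Γ g a r) ∧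
      Fl (Sc Γ g a 1) g' Finset.univ ρ := by
  have : ∀ k ≤ n, ∃ (J : Finset (Fin n)) (g' : GF Fq n) (ρ : Fin n → ℕ), J.card = k ∧
      (∀ r, Sc Γ g' a r = Sc Γ g a r) ∧ Fl (Sc Γ g a 1) g' J ρ := by
    intro k
    induction k with
    | zero => exact fun _ => ⟨∅, g, fun _ => 0, rfl, fun _ => rfl, by simp, by simp⟩
    | succ k ih =>
      intro hk
      obtain ⟨J, g', ρ, hJ, h1, h2⟩ := ih (by omega)
      have hJ' : ∃ i, i ∉ J := by
        by_contra! h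
        have : J = Finset.univ := Finset.eq_univ_iff_forall.2 h
        rw [this] at hJ; simp at hJ; omega
      rw [← h1] at h2
      obtain ⟨g'', i0, ρ', hi0, h3, h4⟩ := flag_step hn hp hΓ g' a J ρ h2 hJ'
      rw [h1] at h4
      exact ⟨insert i0 J, g'', ρ', by rw [Finset.card_insert_of_notMem hi0, hJ],
        fun r => (h3 r).trans (h1 r), h4⟩
  obtain ⟨J, g', ρ, hJ, h1, h2⟩ := this n le_rfl
  have : J = Finset.univ := by
    rw [← Finset.card_eq_iff_eq_univ]; simpa using hJ
  subst this
  exact ⟨g', ρ, h1, h2⟩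

lemma exists_trivial_Sc (hn : 0 < n) {p : ℕ} (hp : p.Prime) [CharP Fq p] {Γ : Subgroup (SG Fq n)}
    (hΓ : FB Γ) : ∃ (g : GF Fq n) (a : Fin n → ℤ), ∀ γ ∈ Sc Γ g a n, γ = 1 := by
  set N : ℤ := n * (n + 1) with hNdef
  have hN : 0 < N := by positivity
  let f : GF Fq n × (Fin n → ℤ) → ℕ := fun x => (Sc Γ x.1 x.2 n).ncard
  have main : ∀ r : ℕ, ∀ x, (∀ y, f x ≤ f y) → Sc Γ x.1 x.2 n ⊆ Sc Γ x.1 x.2 (n + r) := by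
    intro r
    induction r with
    | zero => intro x _; simp
    | succ r ih =>
      rintro ⟨g, a⟩ hx
      obtain ⟨g', ρ, h1, h2⟩ := exists_flag hn hp hΓ g a
      rw [← h1, ← h1]
      rw [← h1] at h2
      simp only [Fl, Finset.mem_univ, forall_const, Finset.card_univ, Fintype.card_fin, not_true,
        false_or] at h2
      let a' : Fin n → ℤ := fun i => a i - ρ i
      have hsub1 : Sc Γ g' a' n ⊆ Sc Γ g' a 1 := fun γ hγ => ⟨hγ.1, fun i j =>
        (hγ.2 i j).mono (by
          have := h2.1 i; have := h2.1 j; simp only [a']; omega)⟩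
      have hsub2 : ∀ s : ℤ, ∀ γ ∈ Sc Γ g' a' n, γ ∈ Sc Γ g' a' s → γ ∈ Sc Γ g' a (s + 1) := by
        intro s γ h0 hγ
        refine ⟨hγ.1, fun i j => ?_⟩
        by_cases hij : ρ j ≤ ρ i
        · have := h2.2 γ (hsub1 h0) i j hij
          change VN _ _ (Nm g' γ i j)
          rw [this]; exact VN.zero
        · exact (hγ.2 i j).mono (by simp only [a']; omega)
      have hsub3 : Sc Γ g' a' n ⊆ Sc Γ g' a n := fun γ hγ =>
        Sc_mono (by omega) (hsub2 n γ hγ hγ)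
      have heq : Sc Γ g' a' n = Sc Γ g' a n := by
        apply Set.eq_of_subset_of_ncard_le hsub3 _ (Sc_finite hn hΓ _ _ _)
        rw [h1]; exact hx (g', a')
      have hmin' : ∀ y, f (g', a') ≤ f y := by
        intro y
        refine le_trans (le_of_eq ?_) (hx y)
        change (Sc Γ g' a' n).ncard = (Sc Γ g a n).ncard
        rw [heq, h1]
      intro γ hγ
      rw [← heq] at hγ
      have := hsub2 _ γ hγ (ih (g', a') hmin' hγ)
      push_cast
      rwa [← add_assoc]
  obtain ⟨x, hx⟩ : ∃ x, ∀ y, f x ≤ f y :=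
    haveI : Nonempty (GF Fq n × (Fin n → ℤ)) := ⟨(1, 0)⟩
    ⟨Function.argmin f, fun y => Function.argmin_le f y⟩
  refine ⟨x.1, x.2, fun γ hγ => ?_⟩
  have h0 : Nm x.1 γ = 0 := by
    ext1 i j
    refine eq_zero_of_V fun m => VN_to_V hN ?_
    have := (main ((N * m).toNat + (x.2 i).natAbs + (x.2 j).natAbs) x hx hγ).2 i j
    refine VN.mono this ?_
    have h2 := Int.self_le_toNat (N * m)
    simp only [Nat.cast_add]; omega
  have h1 : (cj x.1⁻¹ γ).1 = 1 := sub_eq_zero.1 h0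
  exact (map_eq_one_iff _ (cj x.1⁻¹).injective).1 (Subtype.ext h1)

/-- diagonal matrix of powers of `X` -/
def dg (m : Fin n → ℤ) : GF Fq n where
  val := Matrix.diagonal fun i => HahnSeries.single (m i) 1
  inv := Matrix.diagonal fun i => HahnSeries.single (-m i) 1
  val_inv := by simp [Matrix.diagonal_mul_diagonal]
  inv_val := by simp [Matrix.diagonal_mul_diagonal]

lemma cj_dg (m : Fin n → ℤ) (γ : SG Fq n) (i j : Fin n) :
    cj (dg m) γ i j = HahnSeries.single (m i - m j) 1 * γ i j := by
  change (Matrix.diagonal (fun i => HahnSeries.single (m i) (1 : Fq)) * γ.1 *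
    Matrix.diagonal (fun i => HahnSeries.single (-m i) (1 : Fq))) i j = _
  rw [Matrix.mul_diagonal, Matrix.diagonal_mul, mul_right_comm, HahnSeries.single_mul_single]
  simp [sub_eq_add_neg]

lemma dg_inv (m : Fin n → ℤ) : (dg m : GF Fq n)⁻¹ = dg (-m) := by
  ext1
  rfl

/-- Kazhdan–Margulis type statement. -/
theorem KM (hn : 0 < n) {p : ℕ} (hp : p.Prime) [CharP Fq p] {Γ : Subgroup (SG Fq n)}
    (hΓ : FB Γ) : ∃ x : GF Fq n, ∀ γ ∈ Γ, cj x⁻¹ γ ∈ K1 Fq n → γ = 1 := by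
  obtain ⟨g, a, hga⟩ := exists_trivial_Sc hn hp hΓ
  have hn' : (0 : ℤ) < n := by exact_mod_cast hn
  obtain ⟨k, hk⟩ : ∃ k : Fin (n + 1), ∀ i, (k : ℤ) ≠ (a i / n + 1) % (n + 1) := by
    by_contra! h
    choose φ hφ using h
    have : Function.Injective φ := by
      intro x y hxy
      have h1 := hφ x
      rw [hxy, ← hφ y] at h1
      exact Fin.ext (by exact_mod_cast h1)
    have := Fintype.card_le_of_injective φ this
    simp at this
  let m : Fin n → ℤ := fun i => (a i / n - k) / (n + 1)
  have hm : ∀ i, 0 ≤ a i - n * k - n * (n + 1) * m i ∧ a i - n * k - n * (n + 1) * m i ≤ n * n := by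
    intro i
    have e1 := Int.mul_ediv_add_emod (a i) n
    have e2 := Int.mul_ediv_add_emod (a i / n - k) (n + 1)
    have b1 := Int.emod_nonneg (a i) hn'.ne'
    have b2 := Int.emod_lt_of_pos (a i) hn'
    have b3 := Int.emod_nonneg (a i / n - k) (show (n : ℤ) + 1 ≠ 0 by omega)
    have b4 := Int.emod_lt_of_pos (a i / n - k) (show 0 < (n : ℤ) + 1 by omega)
    have b5 : (a i / n - k) % (n + 1) ≠ n := by
      intro h
      apply hk i
      have hk2 := k.2
      have e3 : a i / n + 1 = k + (n + 1) * ((a i / n - k) / (n + 1) + 1) := by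
        rw [h] at e2; linarith
      rw [e3, Int.add_mul_emod_self_left, Int.emod_eq_of_lt] <;> omega
    have b6 : (a i / n - k) % (n + 1) ≤ n - 1 := by omega
    have e4 : a i - n * k - n * (n + 1) * m i = n * ((a i / n - k) % (n + 1)) + a i % n := by
      simp only [m]
      linear_combination (-1 : ℤ) * e1 - n * e2
    rw [e4]
    constructor
    · positivity
    · nlinarith
  refine ⟨g * dg m, fun γ hγ h => hga γ ⟨hγ, fun i j => ?_⟩⟩
  have h1 := mem_K1.1 h i j
  have h2 : Nm g γ i j = HahnSeries.single (m i - m j) 1 * Nm (g * dg m) γ i j := by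
    have : cj g⁻¹ γ = cj (dg m) (cj (g * dg m)⁻¹ γ) := by
      rw [← cj_mul]; simp
    by_cases hij : i = j
    · subst hij
      rw [Nm, this, Matrix.sub_apply, cj_dg]
      simp [Nm]
    · rw [Nm, this, Matrix.sub_apply, cj_dg]
      simp [Nm, hij]
  change VN _ _ (Nm g γ i j)
  rw [h2]
  have h3 : VN (n * (n + 1)) (n * (n + 1)) (Nm (g * dg m) γ i j) := by
    intro l hl
    refine V_iff.1 h1 l ?_
    by_contra! hl'
    nlinarith [mul_nonneg hn'.le (show (0 : ℤ) ≤ n + 1 by omega)]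
  refine ((VN_single (N := n * (n + 1)) (1 : Fq) le_rfl).mul h3).mono ?_
  have := hm i; have := hm j
  nlinarith
end

section
variable {Fq n}

/-- elementary matrices in `SL_n(F)` -/
def tv (i j : Fin n) (h : i ≠ j) (c : F Fq) : SG Fq n :=
  ⟨Matrix.transvection i j c, Matrix.det_transvection_of_ne i j h c⟩

lemma tv_coe (i j : Fin n) (h : i ≠ j) (c : F Fq) : (tv i j h c).1 = 1 + Matrix.single i j c := rfl

lemma tv_apply (i j : Fin n) (h : i ≠ j) (c : F Fq) (k l : Fin n) :
    tv i j h c k l = (1 : MF Fq n) k l + if i = k ∧ j = l then c else 0 := by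
  change (1 + Matrix.single i j c) k l = _
  rw [Matrix.add_apply, Matrix.single_apply]

/-- the elementary group over `𝔽_q[t]` -/
def EE (Fq : Type) [Field Fq] (n : ℕ) : Subgroup (SG Fq n) :=
  Subgroup.closure {g | ∃ (i j : Fin n) (h : i ≠ j) (f : Polynomial Fq), g = tv i j h (polyEmb Fq f)}

lemma tv_mem_EE (i j : Fin n) (h : i ≠ j) (f : Polynomial Fq) : tv i j h (polyEmb Fq f) ∈ EE Fq n :=
  Subgroup.subset_closure ⟨i, j, h, f, rfl⟩

lemma EE_row (i0 : Fin n) (y : Fin n → Polynomial Fq) (s : Finset (Fin n)) (hs : i0 ∉ s) :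
    ∃ e ∈ EE Fq n, e.1 = 1 + ∑ i ∈ s, Matrix.single i0 i (polyEmb Fq (y i)) := by
  induction s using Finset.induction_on with
  | empty => exact ⟨1, one_mem _, by simp⟩
  | insert a s ha ih =>
    obtain ⟨e, he, h1⟩ := ih (fun h => hs (Finset.mem_insert_of_mem h))
    have hai : i0 ≠ a := fun h => hs (h ▸ Finset.mem_insert_self _ _)
    refine ⟨e * tv i0 a hai (polyEmb Fq (y a)), mul_mem he (tv_mem_EE _ _ _ _), ?_⟩
    change e.1 * (tv i0 a hai (polyEmb Fq (y a))).1 = _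
    rw [h1, tv_coe, Finset.sum_insert ha, mul_add, mul_one, add_mul, one_mul, Finset.sum_mul]
    have : ∑ i ∈ s, Matrix.single i0 i (polyEmb Fq (y i)) * Matrix.single i0 a (polyEmb Fq (y a)) =
        (0 : MF Fq n) := Finset.sum_eq_zero fun i hi =>
      Matrix.single_mul_single_of_ne _ _ _ _ (show i ≠ i0 from fun h => hs (by
        subst h; exact Finset.mem_insert_of_mem hi)) _
    rw [this]; abel

lemma polyEmb_X : polyEmb Fq Polynomial.X = HahnSeries.single (-1) 1 := by
  rw [polyEmb, Polynomial.coe_eval₂RingHom, Polynomial.eval₂_X, HahnSeries.ofPowerSeries_X]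
  apply inv_eq_of_mul_eq_one_right
  simp

lemma polyEmb_C (a : Fq) : polyEmb Fq (Polynomial.C a) = HahnSeries.C a := by
  simp [polyEmb]

lemma polyEmb_monomial (d : ℕ) (a : Fq) :
    polyEmb Fq (Polynomial.monomial d a) = HahnSeries.single (-(d : ℤ)) a := by
  rw [← Polynomial.C_mul_X_pow_eq_monomial, map_mul, map_pow, polyEmb_X, polyEmb_C,
    HahnSeries.single_pow, HahnSeries.C_apply, HahnSeries.single_mul_single]
  simp

lemma V_lead {m : ℤ} {c : F Fq} (h : V m c) (h0 : c.coeff m = 0) : V (m + 1) c := by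
  rw [V_iff]; intro k hk
  rcases (show k < m ∨ k = m by omega) with h' | rfl
  · exact V_iff.1 h k h'
  · exact h0

lemma coeff_single_mul' (c : F Fq) (d k : ℤ) (a : Fq) :
    ((HahnSeries.single d a : F Fq) * c).coeff k = a * c.coeff (k - d) := by
  have := HahnSeries.coeff_single_mul_add (r := a) (x := c) (a := k - d) (b := d)
  rwa [sub_add_cancel] at this

lemma V_one_le {m : ℤ} (h : V m (1 : F Fq)) : m ≤ 0 := by
  have := (V_order (one_ne_zero)).1 h
  simpa using this

lemma det_scaled (m : Fin n → ℤ) (g : SG Fq n) :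
    ((dg (-m)).1 * g.1 : MF Fq n).det = HahnSeries.single (-∑ i, m i) 1 := by
  rw [Matrix.det_mul, g.2, mul_one]
  change (Matrix.diagonal _).det = _
  rw [Matrix.det_diagonal]
  have : ∀ s : Finset (Fin n), ∏ i ∈ s, (HahnSeries.single ((-m) i) 1 : F Fq) =
      HahnSeries.single (-∑ i ∈ s, m i) 1 := by
    intro s
    induction s using Finset.induction_on with
    | empty => simp
    | insert a s ha ih =>
      rw [Finset.prod_insert ha, ih, HahnSeries.single_mul_single, Finset.sum_insert ha]
      simp [add_comm]
  exact this _

lemma scaled_apply (m : Fin n → ℤ) (g : SG Fq n) (i j : Fin n) :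
    ((dg (-m)).1 * g.1 : MF Fq n) i j = HahnSeries.single (-m i) 1 * g i j := by
  change (Matrix.diagonal _ * _ : MF Fq n) i j = _
  rw [Matrix.diagonal_mul]; rfl

lemma birk_step (g : SG Fq n) (m : Fin n → ℤ) (h : ∀ i j, V (m i) (g i j)) (hm : ∑ i, m i < 0) :
    ∃ e ∈ EE Fq n, ∃ i0, ∀ i j, V (Function.update m i0 (m i0 + 1) i) ((e * g) i j) := by
  classical
  have hW : ∀ i j, V 0 (((dg (-m)).1 * g.1 : MF Fq n) i j) := by
    intro i j
    rw [scaled_apply]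
    simpa using (V_single (1 : Fq) (le_refl (-m i))).mul (h i j)
  obtain ⟨B, hB⟩ := exists_ofO_mat hW
  have hdet : (B.map (PowerSeries.constantCoeff (R := Fq))).det = 0 := by
    change ((PowerSeries.constantCoeff (R := Fq)).mapMatrix B).det = 0
    rw [← RingHom.map_det, ← V_one_ofO, RingHom.map_det, RingHom.mapMatrix_apply, hB, det_scaled]
    exact V_single _ (by omega)
  obtain ⟨lam, hl0, hl⟩ := Matrix.exists_vecMul_eq_zero_iff.2 hdet
  have hcoeff : ∀ i j, PowerSeries.constantCoeff (B i j) = (g i j).coeff (m i) := by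
    intro i j
    rw [← coeff_zero_ofPowerSeries]
    have : ofO (B i j) = HahnSeries.single (-m i) 1 * g i j := by
      rw [← scaled_apply, ← hB]; rfl
    rw [this, coeff_single_mul']; simp
  obtain ⟨i1, hi1⟩ := Function.ne_iff.1 hl0
  obtain ⟨i0, hi0, hmin⟩ := Finset.exists_min_image (Finset.univ.filter fun i => lam i ≠ 0) m
    ⟨i1, by simpa using hi1⟩
  simp only [Finset.mem_filter, Finset.mem_univ, true_and] at hi0 hmin
  let y : Fin n → Polynomial Fq := fun i =>
    Polynomial.monomial (m i - m i0).toNat (lam i * (lam i0)⁻¹)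
  have hy : ∀ i, polyEmb Fq (y i) = HahnSeries.single (m i0 - m i) (lam i * (lam i0)⁻¹) := by
    intro i
    by_cases hi : lam i = 0
    · simp [y, hi]
    · simp only [y]
      rw [polyEmb_monomial, Int.toNat_of_nonneg (by have := hmin i hi; omega)]
      congr 1; ring
  obtain ⟨e, he, he1⟩ := EE_row i0 y (Finset.univ.erase i0) (Finset.notMem_erase _ _)
  refine ⟨e, he, i0, fun i j => ?_⟩
  change V _ ((e.1 * g.1) i j)
  rw [he1, add_mul, one_mul, Finset.sum_mul, Matrix.add_apply, Matrix.sum_apply]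
  by_cases hi : i = i0
  · subst hi
    rw [Function.update_self]
    have e1 : g i j + ∑ k ∈ Finset.univ.erase i, (Matrix.single i k (polyEmb Fq (y k)) * g.1) i j =
        ∑ k, HahnSeries.single (m i - m k) (lam k * (lam i)⁻¹) * g k j := by
      rw [← Finset.add_sum_erase _ _ (Finset.mem_univ i)]
      congr 1
      · simp [hi0]
      · refine Finset.sum_congr rfl fun k _ => ?_
        rw [Matrix.single_mul_apply_same, hy]
    change V _ (g i j + _)
    rw [e1]
    apply V_lead
    · refine V.sum fun k _ => ?_
      have := (V_single (lam k * (lam i)⁻¹) (le_refl (m i - m k))).mul (h k j)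
      simpa using this
    · have : ∀ s : Finset (Fin n), (∑ k ∈ s, (HahnSeries.single (m i - m k) (lam k * (lam i)⁻¹) : F Fq)
          * g k j).coeff (m i) = ∑ k ∈ s, lam k * (lam i)⁻¹ * (g k j).coeff (m k) := by
        intro s
        rw [HahnSeries.coeff_sum]
        refine Finset.sum_congr rfl fun k _ => ?_
        rw [coeff_single_mul']; simp
      rw [this]
      have h2 := congrFun hl j
      simp only [Matrix.vecMul, dotProduct, Matrix.map_apply, hcoeff, Pi.zero_apply] at h2
      calc _ = (lam i)⁻¹ * ∑ k, lam k * (g k j).coeff (m k) := by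
            rw [Finset.mul_sum]; exact Finset.sum_congr rfl fun k _ => by ring
        _ = 0 := by rw [h2, mul_zero]
  · rw [Function.update_of_ne hi]
    rw [Finset.sum_eq_zero, add_zero]
    · exact h i j
    · intro k _
      rw [Matrix.single_mul_apply_of_ne]
      exact hi

lemma birk_aux (N : ℕ) : ∀ (g : SG Fq n) (m : Fin n → ℤ), (∀ i j, V (m i) (g i j)) →
    -∑ i, m i ≤ N → ∃ e ∈ EE Fq n, ∃ m' : Fin n → ℤ, ∑ i, m' i = 0 ∧ ∀ i j, V (m' i) ((e * g) i j) := by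
  induction N with
  | zero =>
    intro g m h hN
    have h1 : V (∑ i, m i) (1 : F Fq) := by
      have hW : ∀ i j, V 0 (((dg (-m)).1 * g.1 : MF Fq n) i j) := by
        intro i j
        rw [scaled_apply]
        simpa using (V_single (1 : Fq) (le_refl (-m i))).mul (h i j)
      obtain ⟨B, hB⟩ := exists_ofO_mat hW
      have : V 0 (((dg (-m)).1 * g.1 : MF Fq n).det) := by
        rw [← hB]
        change V 0 ((RingHom.mapMatrix ofO B).det)
        rw [← RingHom.map_det]; exact V_ofPowerSeries _
      rw [det_scaled] at this
      have h2 := (V_single (1 : Fq) (le_refl (∑ i, m i))).mul this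
      simpa using h2
    have := V_one_le h1
    exact ⟨1, one_mem _, m, by push_cast at hN; omega, by simpa using h⟩
  | succ N ih =>
    intro g m h hN
    by_cases hm : ∑ i, m i < 0
    · obtain ⟨e, he, i0, h1⟩ := birk_step g m h hm
      obtain ⟨e', he', m', h2, h3⟩ := ih _ _ h1 (by
        rw [Finset.sum_update_of_mem (Finset.mem_univ i0)]
        rw [← Finset.add_sum_erase _ _ (Finset.mem_univ i0)] at hN
        rw [Finset.sdiff_singleton_eq_erase]
        push_cast at hN; linarith)
      exact ⟨e' * e, mul_mem he' he, m', h2, by simpa [mul_assoc] using h3⟩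
    · exact ih g m h (by omega)

lemma EE_swap (i j : Fin n) (hij : i ≠ j) (m : Fin n → ℤ) (g : SG Fq n)
    (h : ∀ k l, V (m k) (g k l)) :
    ∃ e ∈ EE Fq n, ∀ k l, V (m (Equiv.swap i j k)) ((e * g) k l) := by
  have hrow : ∀ (a b : Fin n) (hab : a ≠ b) (c : F Fq) (g : SG Fq n) (k l : Fin n),
      (tv a b hab c * g) k l = if k = a then g a l + c * g b l else g k l := by
    intro a b hab c g k l
    change ((tv a b hab c).1 * g.1) k l = _
    rw [tv_coe, add_mul, one_mul, Matrix.add_apply]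
    split_ifs with h
    · subst h; rw [Matrix.single_mul_apply_same]
    · rw [Matrix.single_mul_apply_of_ne _ _ _ _ _ h, add_zero]
  have h1 : (1 : F Fq) = polyEmb Fq 1 := by simp
  have h2 : (-1 : F Fq) = polyEmb Fq (-1) := by simp
  refine ⟨tv i j hij 1 * tv j i hij.symm (-1) * tv i j hij 1, ?_, fun k l => ?_⟩
  · rw [h2, h1]
    exact mul_mem (mul_mem (tv_mem_EE _ _ _ _) (tv_mem_EE _ _ _ _)) (tv_mem_EE _ _ _ _)
  · rw [mul_assoc, mul_assoc]
    simp only [hrow]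
    by_cases hk : k = i
    · subst hk
      simpa [hij, hij.symm] using h j l
    · by_cases hk' : k = j
      · subst hk'
        simpa [hij, hij.symm] using (h i l).neg
      · simpa [hk, hk', Equiv.swap_apply_of_ne_of_ne hk hk'] using h k l

lemma EE_perm (σ : Equiv.Perm (Fin n)) : ∀ (m : Fin n → ℤ) (g : SG Fq n),
    (∀ k l, V (m k) (g k l)) → ∃ e ∈ EE Fq n, ∀ k l, V (m (σ k)) ((e * g) k l) := by
  induction σ using Equiv.Perm.swap_induction_on with
  | one => intro m g h; exact ⟨1, one_mem _, by simpa using h⟩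
  | swap_mul f x y hxy ih =>
    intro m g h
    obtain ⟨e, he, h1⟩ := EE_swap x y hxy m g h
    obtain ⟨e', he', h2⟩ := ih _ _ h1
    exact ⟨e' * e, mul_mem he' he, by simpa [mul_assoc] using h2⟩

/-- `diag(X^{m_i})` in `SL_n` -/
def yS (m : Fin n → ℤ) (hm : ∑ i, m i = 0) : SG Fq n :=
  ⟨(dg m).1, by
    have := det_scaled (Fq := Fq) (-m) 1
    rw [neg_neg] at this
    simpa [hm] using this⟩

lemma yS_GL (m : Fin n → ℤ) (hm : ∑ i, m i = 0) : ((yS m hm : SG Fq n) : GF Fq n) = dg m := by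
  ext1; rfl

/-- Birkhoff / Grothendieck decomposition -/
lemma birk (g : SG Fq n) : ∃ e ∈ EE Fq n, ∃ (m : Fin n → ℤ) (hm : ∑ i, m i = 0), Monotone m ∧
    ∃ k ∈ KK Fq n, e * g = yS m hm * k := by
  obtain ⟨b, hb⟩ := exists_V_mat g.1
  obtain ⟨e, he, m, hm, h1⟩ := birk_aux (n * b) g (fun _ => -b) hb (by simp)
  obtain ⟨e', he', h2⟩ := EE_perm (Tuple.sort m) m _ h1
  have hs : ∑ i, (m ∘ Tuple.sort m) i = 0 := by
    rw [← hm]; exact Equiv.sum_comp (Tuple.sort m) m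
  refine ⟨e' * e, mul_mem he' he, m ∘ Tuple.sort m, hs, Tuple.monotone_sort m,
    (yS _ hs)⁻¹ * (e' * e * g), ?_, by group⟩
  rw [mem_KK]
  intro i j
  have : ((yS _ hs : SG Fq n)⁻¹ * (e' * e * g)).1 = (dg (-(m ∘ Tuple.sort m))).1 * (e' * e * g).1 := by
    have h3 : ((yS _ hs : SG Fq n)⁻¹).1 = (dg (-(m ∘ Tuple.sort m)) : GF Fq n).1 := by
      rw [← dg_inv, ← yS_GL _ hs, ← map_inv]; rfl
    rw [← h3]; rfl
  rw [this, scaled_apply, mul_assoc]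
  simpa using (V_single (1 : Fq) (le_refl (-(m ∘ Tuple.sort m) i))).mul (h2 i j)
end

section
variable {Fq n}

lemma tr_mul {K : Type*} [CommRing K] {ι : Type*} [Fintype ι] [DecidableEq ι] {a b : ι} (hab : a ≠ b) (c : K)
    (g : SpecialLinearGroup ι K) (k l : ι) :
    (SpecialLinearGroup.transvection hab c * g) k l = if k = a then g a l + c * g b l else g k l := by
  change ((1 + Matrix.single a b c) * g.1) k l = _
  rw [add_mul, one_mul, Matrix.add_apply]
  split_ifs with h
  · subst h; rw [Matrix.single_mul_apply_same]
  · rw [Matrix.single_mul_apply_of_ne _ _ _ _ _ h, add_zero]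

lemma tr_diag {K : Type*} [Field K] {ι : Type*} [Fintype ι] [DecidableEq ι] (H : Subgroup (SpecialLinearGroup ι K))
    (h : ∀ (i j : ι) (hij : i ≠ j) (c : K), SpecialLinearGroup.transvection hij c ∈ H)
    (i j : ι) (hij : i ≠ j) (a : K) (ha : a ≠ 0) :
    ∃ g ∈ H, g.1 = Matrix.diagonal (Function.update (Function.update 1 i a) j a⁻¹) := by
  refine ⟨SpecialLinearGroup.transvection hij.symm (-(a-1)/a) * (SpecialLinearGroup.transvection hij 1 *
    (SpecialLinearGroup.transvection hij.symm (a-1) * (SpecialLinearGroup.transvection hij (-1/a) * 1))),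
    mul_mem (h _ _ _ _) (mul_mem (h _ _ _ _) (mul_mem (h _ _ _ _) (mul_mem (h _ _ _ _) (one_mem _)))), ?_⟩
  ext1 k l
  change (SpecialLinearGroup.transvection hij.symm (-(a-1)/a) * (SpecialLinearGroup.transvection hij 1 *
    (SpecialLinearGroup.transvection hij.symm (a-1) * (SpecialLinearGroup.transvection hij (-1/a) * 1))) :
      SpecialLinearGroup ι K) k l = _
  simp only [tr_mul]
  rw [Matrix.diagonal_apply]
  have e : ∀ k l, (1 : SpecialLinearGroup ι K) k l = if k = l then 1 else 0 := fun k l => Matrix.one_apply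
  simp only [e, if_true, if_neg hij, if_neg hij.symm]
  by_cases hk : k = i
  · subst hk
    rw [Function.update_of_ne hij, Function.update_self]
    by_cases hl : k = l
    · subst hl; simp [hij, hij.symm]
    · by_cases hl' : j = l
      · subst hl'; simp [hij]; field_simp; ring
      · simp [hij, hl, hl']
  · by_cases hk' : k = j
    · subst hk'
      rw [Function.update_self]
      by_cases hl : i = l
      · subst hl; simp [hij.symm]; field_simp; ring
      · by_cases hl' : k = l
        · subst hl'; simp [hij]; field_simp; ring
        · simp [hl, hl']
    · simp [hk, hk']

lemma SLgen {K : Type*} [Field K] {ι : Type*} [Fintype ι] [DecidableEq ι]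
    (H : Subgroup (SpecialLinearGroup ι K))
    (h : ∀ (i j : ι) (hij : i ≠ j) (c : K), SpecialLinearGroup.transvection hij c ∈ H) : H = ⊤ := by
  rw [eq_top_iff]
  intro g _
  suffices hs : ∃ g' ∈ H, g'.1 = g.1 by
    obtain ⟨g', hg', e⟩ := hs
    rwa [← Subtype.ext e]
  apply Matrix.diagonal_transvection_induction (fun M => ∃ g' ∈ H, g'.1 = M) g.1
  · intro D hD
    rw [g.2, Matrix.det_diagonal] at hD
    have hD0 : ∀ i, D i ≠ 0 := fun i hi => by
      rw [Finset.prod_eq_zero (Finset.mem_univ i) hi] at hD; exact zero_ne_one hD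
    rcases isEmpty_or_nonempty ι with he | ⟨⟨i0⟩⟩
    · exact ⟨1, one_mem _, by ext i; exact (he.false i).elim⟩
    have key : ∀ s : Finset ι, i0 ∉ s → ∃ g' ∈ H, g'.1 =
        Matrix.diagonal (fun k => if k = i0 then ∏ i ∈ s, (D i)⁻¹ else if k ∈ s then D k else 1) := by
      intro s
      induction s using Finset.induction_on with
      | empty =>
        intro _
        refine ⟨1, one_mem _, ?_⟩
        simp
      | insert a s ha ih =>
        intro hs
        obtain ⟨g1, hg1, e1⟩ := ih (fun h => hs (Finset.mem_insert_of_mem h))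
        have hai : a ≠ i0 := fun h => hs (h ▸ Finset.mem_insert_self _ _)
        obtain ⟨g2, hg2, e2⟩ := tr_diag H h a i0 hai (D a) (hD0 a)
        refine ⟨g2 * g1, mul_mem hg2 hg1, ?_⟩
        change g2.1 * g1.1 = _
        rw [e1, e2, Matrix.diagonal_mul_diagonal]
        congr 1; funext k
        by_cases hk : k = i0
        · subst hk; simp [Finset.prod_insert ha]
        · by_cases hk' : k = a
          · subst hk'; simp [hk, ha]
          · simp [hk, hk']
    obtain ⟨g', hg', e⟩ := key (Finset.univ.erase i0) (Finset.notMem_erase _ _)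
    refine ⟨g', hg', ?_⟩
    rw [e]
    congr 1; funext k
    by_cases hk : k = i0
    · subst hk
      rw [← Finset.mul_prod_erase _ _ (Finset.mem_univ k)] at hD
      simp only [if_true, Finset.prod_inv_distrib]
      rw [inv_eq_of_mul_eq_one_left hD]
    · simp [hk]
  · intro t
    exact ⟨_, h t.i t.j t.hij t.c, rfl⟩
  · rintro A B ⟨a, ha, rfl⟩ ⟨b, hb, rfl⟩
    exact ⟨a * b, mul_mem ha hb, rfl⟩

/-- constant matrices -/
def cS : SpecialLinearGroup (Fin n) Fq →* SG Fq n := SpecialLinearGroup.map HahnSeries.C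

lemma cS_apply (g : SpecialLinearGroup (Fin n) Fq) (i j) : cS g i j = HahnSeries.C (g i j) := rfl

lemma cS_tr {i j : Fin n} (h : i ≠ j) (a : Fq) :
    cS (SpecialLinearGroup.transvection h a) = tv i j h (HahnSeries.C a) := by
  ext1 k l
  rw [tv_apply, cS_apply]
  change HahnSeries.C ((1 + Matrix.single i j a) k l) = _
  rw [Matrix.add_apply, map_add, Matrix.single_apply, Matrix.one_apply, Matrix.one_apply]
  split_ifs <;> simp

lemma cS_mem_EE (g : SpecialLinearGroup (Fin n) Fq) : cS g ∈ EE Fq n := by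
  have : (EE Fq n).comap cS = ⊤ := SLgen _ fun i j hij c => by
    rw [Subgroup.mem_comap, cS_tr, ← polyEmb_C]; exact tv_mem_EE _ _ _ _
  exact Subgroup.mem_comap.1 (this ▸ Subgroup.mem_top g)

lemma EE_le_SLpoly : EE Fq n ≤ SLpoly Fq n := by
  rw [EE, Subgroup.closure_le]
  rintro _ ⟨i, j, h, f, rfl⟩
  refine ⟨SpecialLinearGroup.transvection h f, ?_⟩
  ext1 k l
  rw [tv_apply]
  change polyEmb Fq ((1 + Matrix.single i j f) k l) = _
  rw [Matrix.add_apply, map_add, Matrix.single_apply, Matrix.one_apply, Matrix.one_apply]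
  split_ifs <;> simp

lemma polyEmb_coeff (f : Polynomial Fq) (d : ℕ) : (polyEmb Fq f).coeff (-(d : ℤ)) = f.coeff d := by
  induction f using Polynomial.induction_on' with
  | add f g hf hg => rw [map_add, HahnSeries.coeff_add, hf, hg, Polynomial.coeff_add]
  | monomial e a =>
    rw [polyEmb_monomial, Polynomial.coeff_monomial, HahnSeries.coeff_single]
    simp [eq_comm]

lemma polyEmb_coeff_pos (f : Polynomial Fq) (d : ℤ) (hd : 0 < d) : (polyEmb Fq f).coeff d = 0 := by
  induction f using Polynomial.induction_on' with
  | add f g hf hg => rw [map_add, HahnSeries.coeff_add, hf, hg, add_zero]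
  | monomial e a =>
    rw [polyEmb_monomial, HahnSeries.coeff_single_of_ne]
    omega

lemma V_polyEmb {f : Polynomial Fq} {m : ℕ} : V (-(m : ℤ)) (polyEmb Fq f) ↔ f.natDegree ≤ m := by
  rw [V_iff, Polynomial.natDegree_le_iff_coeff_eq_zero]
  constructor
  · intro h d hd
    rw [← polyEmb_coeff]; exact h _ (by omega)
  · intro h k hk
    rw [show k = -((-k).toNat : ℤ) by omega, polyEmb_coeff]
    exact h _ (by omega)

lemma V_one_polyEmb {f : Polynomial Fq} (h : V 1 (polyEmb Fq f)) : f = 0 := by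
  ext d
  rw [← polyEmb_coeff]
  exact V_iff.1 h _ (by omega)

lemma SLpoly_KK {g : SG Fq n} (hg : g ∈ SLpoly Fq n) (hk : g ∈ KK Fq n) : ∃ h, cS h = g := by
  obtain ⟨h, rfl⟩ := hg
  rw [mem_KK] at hk
  have hc : ∀ i j, h i j = Polynomial.C ((h i j).coeff 0) := fun i j =>
    Polynomial.eq_C_of_natDegree_le_zero ((V_polyEmb (m := 0)).1 (by simpa using hk i j))
  refine ⟨SpecialLinearGroup.map (Polynomial.constantCoeff) h, ?_⟩
  ext1 i j
  rw [cS_apply]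
  change _ = polyEmb Fq (h i j)
  rw [hc i j, polyEmb_C]; rfl

lemma SLpoly_K1 {g : SG Fq n} (hg : g ∈ SLpoly Fq n) (hk : g ∈ K1 Fq n) : g = 1 := by
  obtain ⟨h, rfl⟩ := hg
  rw [mem_K1] at hk
  ext1 i j
  have h1 := hk i j
  have e : ((SpecialLinearGroup.map (polyEmb Fq) h).1 - 1) i j =
      polyEmb Fq ((h.1 - 1) i j) := by
    rw [Matrix.sub_apply, Matrix.sub_apply, map_sub, Matrix.one_apply, Matrix.one_apply]
    congr 1
    split_ifs <;> simp
  rw [e] at h1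
  rw [V_one_polyEmb h1, map_zero, Matrix.sub_apply] at e
  exact sub_eq_zero.1 e

lemma K1_conj {k g : SG Fq n} (hk : k ∈ KK Fq n) (hg : g ∈ K1 Fq n) : k * g * k⁻¹ ∈ K1 Fq n := by
  obtain ⟨k, rfl⟩ := hk
  obtain ⟨g, hg, rfl⟩ := hg
  rw [← map_inv, ← map_mul, ← map_mul, ιK_mem_K1]
  have : red g = 1 := hg
  simp [this]

lemma cj_dg_tv (m : Fin n → ℤ) (i j : Fin n) (h : i ≠ j) (c : F Fq) :
    cj (dg m) (tv i j h c) = tv i j h (HahnSeries.single (m i - m j) 1 * c) := by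
  ext1 k l
  rw [cj_dg, tv_apply, tv_apply, mul_add, Matrix.one_apply]
  congr 1
  · split_ifs with hkl
    · subst hkl; simp
    · simp
  · split_ifs with hkl
    · rw [hkl.1, hkl.2]
    · simp

lemma tv_mem_K1 (i j : Fin n) (h : i ≠ j) {c : F Fq} (hc : V 1 c) : tv i j h c ∈ K1 Fq n := by
  rw [mem_K1]
  intro k l
  rw [tv_coe, add_sub_cancel_left, Matrix.single_apply]
  split_ifs
  · exact hc
  · exact V.zero

lemma tv_ne_one (i j : Fin n) (h : i ≠ j) {c : F Fq} (hc : c ≠ 0) : tv i j h c ≠ 1 := by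
  intro he
  have : tv i j h c i j = (1 : SG Fq n) i j := by rw [he]
  rw [tv_apply] at this
  have h2 : (1 : SG Fq n) i j = (1 : MF Fq n) i j := rfl
  rw [h2] at this
  simp at this
  exact hc this

/-- Step 6 -/
lemma eq_EE (Γ : Subgroup (SG Fq n)) (h1 : EE Fq n ≤ Γ) (h2 : ∀ g ∈ Γ, g ∈ K1 Fq n → g = 1)
    (h3 : ∀ g ∈ Γ, g ∈ KK Fq n → g ∈ EE Fq n) : Γ = EE Fq n := by
  refine le_antisymm (fun g hg => ?_) h1
  obtain ⟨e, he, m, hm, hmono, k, hk, hek⟩ := birk g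
  have hy : yS m hm * k ∈ Γ := hek ▸ mul_mem (h1 he) hg
  by_cases hm0 : ∃ i j, m i < m j
  · exfalso
    obtain ⟨i, j, hij⟩ := hm0
    have hne : i ≠ j := fun h => by subst h; exact lt_irrefl _ hij
    have ht : tv i j hne (1 : F Fq) ∈ Γ := by
      have := h1 (tv_mem_EE i j hne (1 : Polynomial Fq)); rwa [map_one] at this
    have hK : cj (dg (-m)) (tv i j hne (1 : F Fq)) ∈ K1 Fq n := by
      rw [cj_dg_tv]
      apply tv_mem_K1
      rw [mul_one]
      exact V_single _ (by simp only [Pi.neg_apply]; omega)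
    rw [← dg_inv, ← yS_GL m hm, ← map_inv, cj_SL, inv_inv] at hK
    have h4 := K1_conj (inv_mem hk) hK
    have h5 : k⁻¹ * ((yS m hm)⁻¹ * tv i j hne 1 * yS m hm) * k⁻¹⁻¹ =
      (yS m hm * k)⁻¹ * tv i j hne (1 : F Fq) * (yS m hm * k) := by group
    rw [h5] at h4
    have h6 := h2 _ (mul_mem (mul_mem (inv_mem hy) ht) hy) h4
    have h7 : tv i j hne (1 : F Fq) = 1 := by
      have : tv i j hne (1 : F Fq) = (yS m hm * k) * 1 * (yS m hm * k)⁻¹ := by rw [← h6]; group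
      simpa using this
    exact tv_ne_one i j hne one_ne_zero h7
  · push Not at hm0
    have hmz : m = 0 := by
      funext i
      have : ∀ j, m j = m i := fun j => le_antisymm (hm0 _ _) (hm0 _ _)
      simp only [this, Finset.sum_const, Finset.card_univ, Fintype.card_fin, smul_eq_mul] at hm
      have hn : 0 < n := i.pos
      simp only [nsmul_eq_mul, mul_eq_zero] at hm
      rcases hm with h | h
      · exfalso; have : n = 0 := by exact_mod_cast h
        omega
      · exact h
    have hyone : yS m hm = (1 : SG Fq n) := by
      subst hmz
      apply Subtype.ext
      change Matrix.diagonal _ = (1 : MF Fq n)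
      rw [← Matrix.diagonal_one]; congr 1
    rw [hyone, one_mul] at hek hy
    have := h3 k hy hk
    rw [← hek] at this
    exact (Subgroup.mul_mem_cancel_left _ he).1 this

lemma SLpoly_eq : SLpoly Fq n = EE Fq n :=
  eq_EE _ EE_le_SLpoly (fun _ => SLpoly_K1) fun g hg hk => by
    obtain ⟨h, rfl⟩ := SLpoly_KK hg hk
    exact cS_mem_EE h
end

section
variable {Fq n}

/-- substitution automorphism of the power series ring -/
lemma exists_subst_equiv (s : PowerSeries Fq) (h0 : PowerSeries.constantCoeff s = 0)
    (h1 : PowerSeries.coeff 1 s ≠ 0) :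
    ∃ e : PowerSeries Fq ≃+* PowerSeries Fq, e PowerSeries.X = s ∧
      ∃ s' : PowerSeries Fq, PowerSeries.constantCoeff s' = 0 ∧ PowerSeries.coeff 1 s' ≠ 0 ∧
        e.symm PowerSeries.X = s' ∧ ∀ a, e (PowerSeries.C a) = PowerSeries.C a := by
  have hu : IsUnit (PowerSeries.coeff 1 s) := isUnit_iff_ne_zero.2 h1
  have hs : PowerSeries.HasSubst s := PowerSeries.HasSubst.of_constantCoeff_zero' h0
  have hs' := PowerSeries.HasSubst.substInvOfIsUnit s hu
  have hl := PowerSeries.subst_substInvOfIsUnit_left s h0 hu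
  have hr := PowerSeries.subst_substInvOfIsUnit_right s h0 hu
  let e : PowerSeries Fq ≃+* PowerSeries Fq :=
    { toFun := fun f => PowerSeries.subst s f
      invFun := fun f => PowerSeries.subst (s.substInvOfIsUnit hu) f
      left_inv := fun f => by
        change PowerSeries.subst (s.substInvOfIsUnit hu) (PowerSeries.subst s f) = f
        rw [PowerSeries.subst_comp_subst_apply hs hs', hr, ← PowerSeries.map_algebraMap_eq_subst_X]
        simp
      right_inv := fun f => by
        change PowerSeries.subst s (PowerSeries.subst (s.substInvOfIsUnit hu) f) = f
        rw [PowerSeries.subst_comp_subst_apply hs' hs, hl, ← PowerSeries.map_algebraMap_eq_subst_X]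
        simp
      map_mul' := fun f g => PowerSeries.subst_mul hs f g
      map_add' := fun f g => PowerSeries.subst_add hs f g }
  refine ⟨e, PowerSeries.subst_X hs, s.substInvOfIsUnit hu, by simp, ?_, PowerSeries.subst_X hs', ?_⟩
  · rw [PowerSeries.coeff_one_substInvOfIsUnit]; exact Units.ne_zero _
  · intro a; exact PowerSeries.subst_C a

lemma autV (ψ : F Fq →+* F Fq) (e : PowerSeries Fq → PowerSeries Fq) (hψ : ∀ f, ψ (ofO f) = ofO (e f))
    (h0 : PowerSeries.constantCoeff (e PowerSeries.X) = 0)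
    (h1 : PowerSeries.coeff 1 (e PowerSeries.X) ≠ 0) {m : ℤ} {c : F Fq} (hc : V m c) : V m (ψ c) := by
  obtain ⟨w, hw⟩ := PowerSeries.X_dvd_iff.2 h0
  have hwu : IsUnit w := by
    rw [PowerSeries.isUnit_iff_constantCoeff, isUnit_iff_ne_zero]
    rw [hw, show (1 : ℕ) = 0 + 1 from rfl, PowerSeries.coeff_succ_X_mul] at h1
    simpa using h1
  obtain ⟨u, rfl⟩ := hwu
  have hX : (HahnSeries.single 1 1 : F Fq) = ofO PowerSeries.X := (HahnSeries.ofPowerSeries_X (Γ := ℤ) (R := Fq)).symm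
  have hz : ∀ m : ℤ, (HahnSeries.single m 1 : F Fq) = (ofO PowerSeries.X) ^ m := by
    intro m
    rw [HahnSeries.ofPowerSeries_X]; exact RatFunc.single_zpow m
  have hpos : ∀ m : ℤ, V m (ψ (HahnSeries.single m 1)) := by
    intro m
    rw [hz, map_zpow₀, hψ, hw, map_mul, mul_zpow, ← hz]
    have : (ofO (u : PowerSeries Fq)) ^ m = ofO ((u ^ m : (PowerSeries Fq)ˣ) : PowerSeries Fq) := by
      have := (Units.coe_map (ofO : PowerSeries Fq →+* F Fq).toMonoidHom (u ^ m))
      rw [map_zpow, Units.val_zpow_eq_zpow_val] at this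
      exact this
    rw [this]
    simpa using (V_single (1 : Fq) (le_refl m)).mul (V_ofPowerSeries _)
  have hd : V 0 (HahnSeries.single (-m) 1 * c) := by
    simpa using (V_single (1 : Fq) (le_refl (-m))).mul hc
  obtain ⟨f, hf⟩ := exists_ofPowerSeries hd
  have : c = HahnSeries.single m 1 * ofO f := by
    rw [hf, ← mul_assoc, HahnSeries.single_mul_single]; simp
  rw [this, map_mul, hψ]
  simpa using (hpos m).mul (V_ofPowerSeries _)

lemma continuous_of_autV (ψ : F Fq →+* F Fq) (h : ∀ (m : ℤ) c, V m c → V m (ψ c)) : Continuous ψ := by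
  refine continuous_of_V fun a m => ?_
  have ht : Filter.Tendsto (fun b : F Fq => b - a) (nhds a) (nhds 0) :=
    tendsto_sub_nhds_zero_iff.2 Filter.tendsto_id
  filter_upwards [ht (V_nhds m)] with b hb
  rw [← map_sub]; exact h _ _ hb

lemma exists_aut (τ : F Fq) (hV : V (-1) τ) (hc : τ.coeff (-1) ≠ 0) :
    ∃ ψ : F Fq ≃+* F Fq, ψ τ = HahnSeries.single (-1) 1 ∧ (∀ a, ψ (HahnSeries.C a) = HahnSeries.C a) ∧
      (∀ (m : ℤ) c, V m c → V m (ψ c)) ∧ (∀ (m : ℤ) c, V m c → V m (ψ.symm c)) := by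
  -- τ = X⁻¹ * unit
  have hd : V 0 (HahnSeries.single 1 1 * τ) := by
    simpa using (V_single (1 : Fq) (le_refl 1)).mul hV
  obtain ⟨f, hf⟩ := exists_ofPowerSeries hd
  have hf0 : PowerSeries.constantCoeff f ≠ 0 := by
    rw [← coeff_zero_ofPowerSeries, hf, coeff_single_mul']
    simpa using hc
  have hfu : IsUnit f := by
    rw [PowerSeries.isUnit_iff_constantCoeff, isUnit_iff_ne_zero]; exact hf0
  obtain ⟨u, rfl⟩ := hfu
  set s : PowerSeries Fq := PowerSeries.X * ((u⁻¹ : (PowerSeries Fq)ˣ) : PowerSeries Fq) with hs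
  have hs0 : PowerSeries.constantCoeff s = 0 := by simp [hs]
  have hs1 : PowerSeries.coeff 1 s ≠ 0 := by
    rw [hs, show (1 : ℕ) = 0 + 1 from rfl, PowerSeries.coeff_succ_X_mul]
    have : IsUnit (PowerSeries.constantCoeff ((u⁻¹ : (PowerSeries Fq)ˣ) : PowerSeries Fq)) :=
      (Units.isUnit _).map _
    simpa using this.ne_zero
  obtain ⟨e, he, s', h0', h1', he', heC⟩ := exists_subst_equiv s hs0 hs1
  let ψ : F Fq ≃+* F Fq := IsFractionRing.ringEquivOfRingEquiv (A := PowerSeries Fq) (B := PowerSeries Fq) e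
  have hψ : ∀ f, ψ (ofO f) = ofO (e f) := fun f =>
    IsFractionRing.ringEquivOfRingEquiv_algebraMap (K := F Fq) (L := F Fq) e f
  have hψ' : ∀ f, ψ.symm (ofO f) = ofO (e.symm f) := fun f => by
    rw [RingEquiv.symm_apply_eq, hψ, RingEquiv.apply_symm_apply]
  have hX : (HahnSeries.single 1 1 : F Fq) = ofO PowerSeries.X := (HahnSeries.ofPowerSeries_X (Γ := ℤ) (R := Fq)).symm
  have hXi : (HahnSeries.single (-1) 1 : F Fq) = (ofO PowerSeries.X)⁻¹ := by
    rw [← hX]; apply eq_inv_of_mul_eq_one_left; simp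
  refine ⟨ψ.symm, ?_, ?_, ?_, ?_⟩
  · rw [RingEquiv.symm_apply_eq, hXi, map_inv₀, hψ, he, hs, map_mul]
    apply eq_inv_of_mul_eq_one_left
    rw [← hX, ← mul_assoc, mul_comm τ, ← hf, ← map_mul]; simp
  · intro a
    rw [RingEquiv.symm_apply_eq]
    have : (HahnSeries.C a : F Fq) = ofO (PowerSeries.C a) := (HahnSeries.ofPowerSeries_C (Γ := ℤ) a).symm
    rw [this, hψ, heC]
  · intro m c h
    exact autV ψ.symm.toRingHom e.symm hψ' (by rw [he', h0']) (by rw [he']; exact h1') h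
  · intro m c h
    exact autV ψ.toRingHom e hψ (by rw [he, hs0]) (by rw [he]; exact hs1) h

/-- the induced automorphism of `SL_n` -/
def autSL (ψ : F Fq ≃+* F Fq) : SG Fq n ≃* SG Fq n where
  toFun := SpecialLinearGroup.map ψ.toRingHom
  invFun := SpecialLinearGroup.map ψ.symm.toRingHom
  left_inv g := by
    ext1 i j
    change ψ.symm (ψ (g i j)) = _
    simp
  right_inv g := by
    ext1 i j
    change ψ (ψ.symm (g i j)) = _
    simp
  map_mul' g h := map_mul _ g h

lemma autSL_apply (ψ : F Fq ≃+* F Fq) (g : SG Fq n) (i j) : autSL ψ g i j = ψ (g i j) := rfl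

lemma continuous_autSL (ψ : F Fq ≃+* F Fq) (h : Continuous ψ) : Continuous (autSL ψ : SG Fq n ≃* SG Fq n) :=
  continuous_SG fun i j => h.comp (continuous_entry i j)

/-- Steps 5 and 6 -/
lemma final_alg (Γ : Subgroup (SG Fq n)) (τ : F Fq) (hV : V (-1) τ) (hc : τ.coeff (-1) ≠ 0)
    (hE : ∀ (i j : Fin n) (h : i ≠ j) (f : Polynomial Fq), tv i j h (f.eval₂ HahnSeries.C τ) ∈ Γ)
    (hK1 : ∀ g ∈ Γ, g ∈ K1 Fq n → g = 1) (hKK : ∀ g ∈ Γ, g ∈ KK Fq n → ∃ h, cS h = g) :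
    ∃ φ : SG Fq n ≃* SG Fq n, Continuous φ ∧ Continuous φ.symm ∧ Γ.map φ.toMonoidHom = SLpoly Fq n := by
  obtain ⟨ψ, hτ, hC, hv, hv'⟩ := exists_aut τ hV hc
  refine ⟨autSL ψ, continuous_autSL ψ (continuous_of_autV ψ.toRingHom hv),
    continuous_autSL ψ.symm (continuous_of_autV ψ.symm.toRingHom hv'), ?_⟩
  rw [SLpoly_eq]
  apply eq_EE
  · rw [EE, Subgroup.closure_le]
    rintro _ ⟨i, j, h, f, rfl⟩
    refine ⟨_, hE i j h f, ?_⟩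
    ext1 k l
    change ψ (tv i j h _ k l) = _
    rw [tv_apply, tv_apply, map_add, Matrix.one_apply]
    have e1 : ψ (f.eval₂ HahnSeries.C τ) = polyEmb Fq f := by
      rw [← RingEquiv.coe_toRingHom, Polynomial.hom_eval₂]
      have h1 : (ψ : F Fq →+* F Fq).comp HahnSeries.C = HahnSeries.C := by ext1 a; exact hC a
      have h2 : (ψ : F Fq →+* F Fq) τ = polyEmb Fq Polynomial.X := by rw [polyEmb_X]; exact hτ
      rw [h1, h2, polyEmb]; simp
    congr 1
    · split_ifs <;> simp
    · split_ifs
      · exact e1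
      · simp
  · rintro _ ⟨g, hg, rfl⟩ hk
    have : g = 1 := by
      apply hK1 g hg
      rw [mem_K1] at hk ⊢
      intro i j
      have h1 := hv' _ _ (hk i j)
      have e : ((autSL ψ g).1 - 1) i j = ψ ((g.1 - 1) i j) := by
        rw [Matrix.sub_apply, Matrix.sub_apply, map_sub, Matrix.one_apply]
        congr 1
        split_ifs <;> simp
      have h2 := hv' _ _ (hk i j)
      change V 1 (ψ.symm (((autSL ψ g).1 - 1) i j)) at h2
      rwa [e, RingEquiv.symm_apply_apply] at h2
    rw [this, map_one]
  · rintro _ ⟨g, hg, rfl⟩ hk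
    rw [mem_KK] at hk
    have : g ∈ KK Fq n := by
      rw [mem_KK]; intro i j
      have h2 := hv' _ _ (hk i j)
      change V 0 (ψ.symm (ψ (g i j))) at h2
      rwa [RingEquiv.symm_apply_apply] at h2
    obtain ⟨h, rfl⟩ := hKK g hg this
    have e : (autSL ψ) (cS h) = cS h := by
      ext1 i j
      rw [autSL_apply, cS_apply, hC]
    change (autSL ψ) (cS h) ∈ _
    rw [e]; exact cS_mem_EE h
end

section
variable {Fq n}

lemma pgrp_K1 (hn : 0 < n) {p : ℕ} (hp : p.Prime) [CharP Fq p] {Γ : Subgroup (SG Fq n)} (hΓ : FB Γ)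
    (z : GF Fq n) (H : Subgroup (SG Fq n)) (hH : ∀ h ∈ H, h ∈ Γ ∧ cj z⁻¹ h ∈ K1 Fq n) :
    Finite H ∧ IsPGroup p H := by
  constructor
  · refine ((hΓ z 0).subset fun g hg => ?_).to_subtype
    exact ⟨(hH g hg).1, fun i j => mem_KK.1 (K1_le (hH g hg).2) i j⟩
  · rintro ⟨h, hh⟩
    have : h ∈ Sc Γ z 0 (n * (n + 1)) := by
      refine ⟨(hH h hh).1, fun i j => ?_⟩
      have h1 := V_iff.1 (mem_K1.1 (hH h hh).2 i j)
      intro k hk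
      refine h1 k ?_
      simp only [Pi.zero_apply, add_zero, sub_zero] at hk
      have : (0 : ℤ) < n * (n + 1) := by positivity
      nlinarith
    obtain ⟨k, hk⟩ := Sc_pow hn hp hΓ (by have : (0 : ℤ) < n * (n + 1) := by positivity
                                          omega) this
    exact ⟨k, Subtype.ext hk⟩

/-- weights for the neighbouring vertices -/
def mD (i0 : Fin n) (c : ℤ) : Fin n → ℤ := fun i => if i = i0 then -c else 0

lemma cj_mD (i0 : Fin n) (c : ℤ) (g : SG Fq n) (i j : Fin n) :
    cj (dg (mD i0 c))⁻¹ g i j =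
      HahnSeries.single ((if i = i0 then c else 0) - (if j = i0 then c else 0)) 1 * g i j := by
  rw [dg_inv, cj_dg]
  congr 2
  simp only [mD, Pi.neg_apply]
  split_ifs <;> simp

lemma single_zero_one : (HahnSeries.single (0 : ℤ) (1 : Fq) : F Fq) = 1 := rfl

lemma V_single_mul {m d : ℤ} {c : F Fq} : V m (HahnSeries.single d 1 * c) ↔ V (m - d) c := by
  constructor
  · intro h
    have := (V_single (1 : Fq) (le_refl (-d))).mul h
    rw [← mul_assoc, HahnSeries.single_mul_single] at this
    simp only [neg_add_cancel, mul_one, single_zero_one, one_mul] at this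
    rwa [show m - d = -d + m by ring]
  · intro h
    have := (V_single (1 : Fq) (le_refl d)).mul h
    simpa using this

lemma red_eq_iff (s : SO Fq n) (i j : Fin n) (a : Fq) :
    red s i j = a ↔ V 1 (ιK s i j - HahnSeries.C a) := by
  have : ιK s i j - HahnSeries.C a = ofO (s i j - PowerSeries.C a) := by
    rw [map_sub, ιK_apply]; congr 1; exact (HahnSeries.ofPowerSeries_C (Γ := ℤ) a).symm
  rw [this, V_one_ofO, map_sub, sub_eq_zero, red_apply]; simp

/-- coercion to matrices as a homomorphism -/
def vH : SG Fq n →* MF Fq n where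
  toFun g := g.1
  map_one' := rfl
  map_mul' _ _ := rfl

lemma vH_apply (g : SG Fq n) : vH g = g.1 := rfl

/-- elements of Γ congruent to one at z -/
def Nz (Γ : Subgroup (SG Fq n)) (z : GF Fq n) : Subgroup (SG Fq n) :=
  Γ ⊓ (K1 Fq n).comap (cj z⁻¹).toMonoidHom

lemma mem_Nz {Γ : Subgroup (SG Fq n)} {z : GF Fq n} {g : SG Fq n} :
    g ∈ Nz Γ z ↔ g ∈ Γ ∧ cj z⁻¹ g ∈ K1 Fq n := by
  rw [Nz, Subgroup.mem_inf, Subgroup.mem_comap]; exact Iff.rfl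

lemma tv_mulVec (i j : Fin n) (h : i ≠ j) (c : F Fq) (w : Fin n → F Fq) (k : Fin n) :
    ((tv i j h c).1 *ᵥ w) k = w k + if k = i then c * w j else 0 := by
  rw [tv_coe, Matrix.add_mulVec, Matrix.one_mulVec, Pi.add_apply, Matrix.single_mulVec_eq]
  congr 1
  by_cases hk : k = i
  · subst hk; simp
  · simp [hk]

/-- fixed lines at the neighbouring vertex -/
lemma step4_line (hn : 0 < n) {p : ℕ} (hp : p.Prime) [CharP Fq p] {Γ : Subgroup (SG Fq n)} (hΓ : FB Γ)
    (hC : ∀ h, cS h ∈ Γ) (i0 : Fin n) {γ : SG Fq n} (hγ : γ ∈ stab Γ (dg (mD i0 1))) :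
    ∀ i, i ≠ i0 → γ i i0 = 0 := by
  haveI : Nonempty (Fin n) := ⟨i0⟩
  set D : GF Fq n := dg (mD i0 1) with hD
  obtain ⟨hfin, hpg⟩ := pgrp_K1 hn hp hΓ D (Nz Γ D) (fun h hh => mem_Nz.1 hh)
  obtain ⟨v, hv0, hv⟩ := exists_fixed_vec hp hpg (vH.comp (Nz Γ D).subtype)
  have hv' : ∀ g ∈ Nz Γ D, g.1 *ᵥ v = v := fun g hg => hv ⟨g, hg⟩
  have htv : ∀ w : Fin n → F Fq, (∀ g ∈ Nz Γ D, g.1 *ᵥ w = w) → ∀ j, j ≠ i0 → w j = 0 := by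
    intro w hw j hj
    have ht : tv i0 j hj.symm (1 : F Fq) ∈ Nz Γ D := by
      refine mem_Nz.2 ⟨?_, ?_⟩
      · have := hC (SpecialLinearGroup.transvection hj.symm 1)
        rwa [cS_tr, map_one] at this
      · rw [hD, dg_inv, cj_dg_tv]
        apply tv_mem_K1
        rw [mul_one]
        exact V_single _ (by simp [mD, hj])
    have h1 := congrFun (hw _ ht) i0
    rw [tv_mulVec] at h1
    simpa using h1
  have hvj := htv v hv'
  have hvi0 : v i0 ≠ 0 := fun h => hv0 (by
    funext j
    by_cases hj : j = i0
    · rw [hj, h]; rfl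
    · exact hvj j hj)
  have hγ' := mem_stab.1 hγ
  have hgv : ∀ g ∈ Nz Γ D, g.1 *ᵥ (γ.1 *ᵥ v) = γ.1 *ᵥ v := by
    intro g hg
    have h1 : γ⁻¹ * g * γ ∈ Nz Γ D := by
      have hg' := mem_Nz.1 hg
      refine mem_Nz.2 ⟨mul_mem (mul_mem (inv_mem hγ'.1) hg'.1) hγ'.1, ?_⟩
      have h2 : cj D⁻¹ g ∈ K1 Fq n := hg'.2
      have := K1_conj (inv_mem hγ'.2) h2
      rwa [inv_inv, ← map_inv, ← map_mul, ← map_mul] at this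
    have h2 := hv' _ h1
    have h3 : g.1 * γ.1 = γ.1 * (γ⁻¹ * g * γ).1 := by
      exact congrArg Subtype.val (show g * γ = γ * (γ⁻¹ * g * γ) by group)
    rw [Matrix.mulVec_mulVec, h3, ← Matrix.mulVec_mulVec, h2]
  intro i hi
  have h1 := htv _ hgv i hi
  rw [Matrix.mulVec, dotProduct, Finset.sum_eq_single i0] at h1
  · exact (mul_eq_zero.1 h1).resolve_right hvi0
  · intro b _ hb; rw [hvj b hb, mul_zero]
  · simp

/-- existence of an element of the neighbouring stabilizer that is not integral -/
lemma step4_exists {Γ : Subgroup (SG Fq n)} (i0 i1 : Fin n) (h01 : i0 ≠ i1)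
    (hM : Nat.card (SpecialLinearGroup (Fin n) Fq) < 2 * Nat.card (stab Γ (dg (mD i0 1))))
    (hKK : ∀ g ∈ Γ, g ∈ KK Fq n → ∃ h, cS h = g) :
    ∃ γ ∈ stab Γ (dg (mD i0 1)), γ ∉ KK Fq n := by
  by_contra! hcon
  have hex : ∀ g : stab Γ (dg (mD i0 1)), ∃ h, cS h = g.1 := fun g =>
    hKK _ (mem_stab.1 g.2).1 (hcon _ g.2)
  choose f hf using hex
  let P : Subgroup (SpecialLinearGroup (Fin n) Fq) := (stab Γ (dg (mD i0 1))).comap cS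
  have hle : Nat.card (stab Γ (dg (mD i0 1))) ≤ Nat.card P := by
    refine Nat.card_le_card_of_injective (fun g => (⟨f g, ?_⟩ : P)) ?_
    · exact Subgroup.mem_comap.2 (by rw [hf]; exact g.2)
    · intro a b hab
      have : f a = f b := congrArg Subtype.val hab
      apply Subtype.ext
      rw [← hf, ← hf, this]
  have hne : P ≠ ⊤ := by
    intro h
    have h1 : SpecialLinearGroup.transvection h01.symm (1 : Fq) ∈ P := h ▸ Subgroup.mem_top _
    replace h1 := Subgroup.mem_comap.1 h1
    have h2 := mem_KK.1 (mem_stab.1 h1).2 i1 i0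
    rw [cj_mD, cS_tr, tv_apply, Matrix.one_apply] at h2
    simp only [h01.symm, if_false, if_true, zero_sub, and_self, zero_add, map_one, mul_one] at h2
    have := V_iff.1 h2 (-1) (by norm_num)
    rw [HahnSeries.coeff_single_same] at this
    exact one_ne_zero this
  have h2 : 2 ≤ P.index := by
    have h0 : P.index ≠ 0 := Subgroup.index_ne_zero_of_finite
    have h1 : P.index ≠ 1 := fun h => hne (Subgroup.index_eq_one.1 h)
    omega
  have h3 := P.card_mul_index
  nlinarith
end

section
variable {Fq n}

lemma cS_tv_mem {Γ : Subgroup (SG Fq n)} (hC : ∀ h, cS h ∈ Γ) (i j : Fin n) (h : i ≠ j) (a : Fq) :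
    tv i j h (HahnSeries.C a) ∈ Γ := by
  rw [← cS_tr]; exact hC _

lemma tv_one_mem {Γ : Subgroup (SG Fq n)} (hC : ∀ h, cS h ∈ Γ) (i j : Fin n) (h : i ≠ j) :
    tv i j h 1 ∈ Γ := by
  have := cS_tv_mem hC i j h 1
  rwa [map_one] at this

lemma tv_mul_apply (i j : Fin n) (h : i ≠ j) (c : F Fq) (g : SG Fq n) (k l : Fin n) :
    (tv i j h c * g) k l = if k = i then g i l + c * g j l else g k l := tr_mul h c g k l

lemma mul_tv_apply (i j : Fin n) (h : i ≠ j) (c : F Fq) (g : SG Fq n) (k l : Fin n) :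
    (g * tv i j h c) k l = if l = j then g k j + g k i * c else g k l := by
  change (g.1 * (1 + Matrix.single i j c)) k l = _
  rw [mul_add, mul_one, Matrix.add_apply]
  split_ifs with hl
  · subst hl; rw [Matrix.mul_single_apply_same]
  · rw [Matrix.mul_single_apply_of_ne _ _ _ _ _ hl, add_zero]

/-- normalising an element of the neighbouring stabilizer -/
lemma step4_norm (hn : 0 < n) {p : ℕ} (hp : p.Prime) [CharP Fq p] {Γ : Subgroup (SG Fq n)} (hΓ : FB Γ)
    (hC : ∀ h, cS h ∈ Γ) (i0 : Fin n) {γ : SG Fq n} (hγ : γ ∈ stab Γ (dg (mD i0 1)))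
    (hγK : γ ∉ KK Fq n) :
    ∃ g ∈ Γ, g ∉ KK Fq n ∧ (∀ i j, V (-1) (g i j)) ∧ (∀ i, i ≠ i0 → g i i0 = 0) ∧
      ∀ i j, (i ≠ i0 ∨ j = i0) → V 1 ((g.1 - 1) i j) := by
  have hl := step4_line hn hp hΓ hC i0 hγ
  have hl' := step4_line hn hp hΓ hC i0 (inv_mem hγ)
  have hγ' := mem_stab.1 hγ
  obtain ⟨k, hk⟩ := hγ'.2
  have hk' : ιK k⁻¹ = cj (dg (mD i0 1))⁻¹ γ⁻¹ := by rw [map_inv, hk, map_inv]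
  set h := red k with hh
  have hinv : ∀ i, i ≠ i0 → h⁻¹ i i0 = 0 := by
    intro i hi
    rw [hh, ← map_inv, red_eq_iff, hk', cj_mD, hl' i hi, mul_zero, map_zero, sub_zero]
    exact V.zero
  have hent : ∀ i j, (i ≠ i0 ∨ j = i0) → V 1 (γ i j - HahnSeries.C (h i j)) := by
    intro i j hij
    have h1 := (red_eq_iff k i j _).1 rfl
    rw [hk, cj_mD] at h1
    by_cases hi : i = i0
    · have hj : j = i0 := by tauto
      subst hi; subst hj
      simpa [single_zero_one] using h1
    · by_cases hj : j = i0
      · subst hj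
        rw [hl i hi, mul_zero] at h1
        rw [hl i hi]; exact h1
      · simpa [single_zero_one, hi, hj] using h1
  have hγV : ∀ i j, V (-1) (γ i j) := by
    intro i j
    have h1 := mem_KK.1 hγ'.2 i j
    rw [cj_mD, V_single_mul] at h1
    by_cases hi : i = i0 <;> by_cases hj : j = i0
    · exact h1.mono (by simp [hi, hj])
    · exact h1.mono (by simp [hi, hj])
    · subst hj; rw [hl i hi]; exact V.zero
    · exact h1.mono (by simp [hi, hj])
  have hmul : ∀ i j, ((cS h)⁻¹ * γ) i j = ∑ l, HahnSeries.C (h⁻¹ i l) * γ l j := by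
    intro i j; rw [← map_inv]; rfl
  refine ⟨(cS h)⁻¹ * γ, mul_mem (inv_mem (hC _)) hγ'.1, ?_, ?_, ?_, ?_⟩
  · intro hK
    apply hγK
    have : cS h ∈ KK Fq n := mem_KK.2 fun i j => V_C _
    have := mul_mem this hK
    rwa [mul_inv_cancel_left] at this
  · intro i j
    rw [hmul]
    refine V.sum fun l _ => ?_
    simpa using (V_C (h⁻¹ i l)).mul (hγV l j)
  · intro i hi
    rw [hmul]
    refine Finset.sum_eq_zero fun l _ => ?_
    by_cases hl0 : l = i0
    · rw [hl0, hinv i hi, map_zero, zero_mul]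
    · rw [hl l hl0, mul_zero]
  · intro i j hij
    have h1 : ∑ l, HahnSeries.C (h⁻¹ i l) * HahnSeries.C (h l j) = (1 : MF Fq n) i j := by
      have : (cS (h⁻¹ * h)) i j = (1 : MF Fq n) i j := by rw [inv_mul_cancel, map_one]; rfl
      rw [← this, map_mul]; rfl
    rw [Matrix.sub_apply, hmul, ← h1, ← Finset.sum_sub_distrib]
    refine V.sum fun l _ => ?_
    rw [← mul_sub]
    by_cases hlj : l ≠ i0 ∨ j = i0
    · simpa using (V_C (h⁻¹ i l)).mul (hent l j hlj)
    · push Not at hlj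
      rw [hlj.1, hinv i (by tauto), map_zero, zero_mul]; exact V.zero

/-- elements of Γ congruent to one at the second vertex are unipotent of the expected shape -/
lemma step4_uni (hn : 3 ≤ n) {p : ℕ} (hp : p.Prime) [CharP Fq p] {Γ : Subgroup (SG Fq n)} (hΓ : FB Γ)
    (hC : ∀ h, cS h ∈ Γ) (i0 : Fin n) {g : SG Fq n} (hg : g ∈ Nz Γ (dg (mD i0 2))) :
    ∀ i j, i ≠ i0 → g i j = (1 : MF Fq n) i j := by
  haveI : Nonempty (Fin n) := ⟨i0⟩
  set D : GF Fq n := dg (mD i0 2) with hD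
  obtain ⟨hfin, hpg⟩ := pgrp_K1 (by omega) hp hΓ D (Nz Γ D) (fun h hh => mem_Nz.1 hh)
  let ρ : Nz Γ D →* MF Fq n :=
    { toFun := fun g => (g.1⁻¹).1ᵀ
      map_one' := by
        change ((1 : SG Fq n)⁻¹).1ᵀ = 1
        rw [inv_one]; exact Matrix.transpose_one
      map_mul' := fun a b => by
        change ((a.1 * b.1)⁻¹).1ᵀ = _
        rw [_root_.mul_inv_rev, ← Matrix.transpose_mul]; rfl }
  obtain ⟨v, hv0, hv⟩ := exists_fixed_vec hp hpg ρ
  let U : (Fin n → F Fq) → Prop := fun w => ∀ g ∈ Nz Γ D, w ᵥ* g.1 = w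
  have hvU : U v := by
    intro g hg
    have := hv (⟨g, hg⟩⁻¹)
    have h2 : ρ (⟨g, hg⟩⁻¹) = g.1ᵀ := by
      change ((g⁻¹)⁻¹).1ᵀ = _
      rw [inv_inv]
    rwa [h2, Matrix.mulVec_transpose] at this
  have htv : ∀ (w : Fin n → F Fq) (i j : Fin n) (h : i ≠ j) (l : Fin n),
      (w ᵥ* (tv i j h 1).1) l = w l + if l = j then w i else 0 := by
    intro w i j h l
    rw [tv_coe, Matrix.vecMul_add, Matrix.vecMul_one, Pi.add_apply]
    congr 1
    rw [Matrix.vecMul, dotProduct, Finset.sum_eq_single i]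
    · by_cases hl : l = j
      · subst hl; simp
      · simp [Matrix.single_apply, hl, Ne.symm hl]
    · intro b _ hb; simp [Matrix.single_apply, Ne.symm hb]
    · simp
  have hUi0 : ∀ w, U w → w i0 = 0 := by
    intro w hw
    obtain ⟨j, hj⟩ : ∃ j : Fin n, j ≠ i0 := by
      haveI : Nontrivial (Fin n) := Fin.nontrivial_iff_two_le.2 (by omega)
      exact exists_ne i0
    have ht : tv i0 j hj.symm (1 : F Fq) ∈ Nz Γ D := by
      refine mem_Nz.2 ⟨tv_one_mem hC _ _ _, ?_⟩
      rw [hD, dg_inv, cj_dg_tv]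
      apply tv_mem_K1
      rw [mul_one]
      exact V_single _ (by simp [mD, hj])
    have h1 := congrFun (hw _ ht) j
    rw [htv] at h1
    simpa using h1
  have hUtv : ∀ w, U w → ∀ (i j : Fin n) (h : i ≠ j), i ≠ i0 → j ≠ i0 → U (w ᵥ* (tv i j h 1).1) := by
    intro w hw i j h hi hj g hg
    have hg' := mem_Nz.1 hg
    have ht : cj D⁻¹ (tv i j h 1) ∈ KK Fq n := by
      rw [hD, dg_inv, cj_dg_tv, mem_KK]
      intro k l
      rw [tv_apply]
      refine V.add ?_ ?_
      · rw [Matrix.one_apply]; split_ifs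
        · exact V_one
        · exact V.zero
      · split_ifs
        · rw [mul_one]; exact V_single _ (by simp [mD, hi, hj])
        · exact V.zero
    have h1 : tv i j h 1 * g * (tv i j h 1)⁻¹ ∈ Nz Γ D := by
      refine mem_Nz.2 ⟨mul_mem (mul_mem (tv_one_mem hC _ _ _) hg'.1) (inv_mem (tv_one_mem hC _ _ _)), ?_⟩
      rw [map_mul, map_mul, map_inv]
      exact K1_conj ht hg'.2
    have h2 := hw _ h1
    have h3 : (tv i j h 1).1 * g.1 = (tv i j h 1 * g * (tv i j h 1)⁻¹).1 * (tv i j h 1).1 :=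
      congrArg Subtype.val
        (inv_mul_cancel_right (tv i j h 1 * g) (tv i j h 1)).symm
    rw [Matrix.vecMul_vecMul, h3, ← Matrix.vecMul_vecMul, h2]
  have hUe : ∀ w, U w → ∀ k, k ≠ i0 → w k ≠ 0 → ∀ j, j ≠ i0 → j ≠ k →
      U (Pi.single j 1) := by
    intro w hw k hk hwk j hj hjk g hg
    have h1 := hUtv w hw k j hjk.symm hk hj g hg
    have h2 : w ᵥ* (tv k j hjk.symm 1).1 = w + w k • Pi.single j 1 := by
      funext l
      rw [htv, Pi.add_apply, Pi.smul_apply, Pi.single_apply]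
      by_cases hl : l = j <;> simp [hl]
    rw [h2, Matrix.add_vecMul, hw g hg, add_right_inj, Matrix.smul_vecMul] at h1
    exact smul_right_injective _ hwk h1
  obtain ⟨k, hk, hvk⟩ : ∃ k, k ≠ i0 ∧ v k ≠ 0 := by
    by_contra! hcon
    apply hv0
    funext k
    by_cases hk : k = i0
    · rw [hk, hUi0 v hvU]; rfl
    · exact hcon k hk
  have hall : ∀ j, j ≠ i0 → U (Pi.single j 1) := by
    intro j hj
    by_cases hjk : j = k
    · obtain ⟨l, hl⟩ : ∃ l : Fin n, l ∉ ({i0, k} : Finset (Fin n)) := by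
        by_contra! hcon
        have : (Finset.univ : Finset (Fin n)) ⊆ {i0, k} := fun x _ => hcon x
        have := Finset.card_le_card this
        have h2 := Finset.card_le_two (a := i0) (b := k)
        rw [Finset.card_univ, Fintype.card_fin] at this
        omega
      simp only [Finset.mem_insert, Finset.mem_singleton, not_or] at hl
      have h1 := hUe v hvU k hk hvk l hl.1 hl.2
      exact hUe _ h1 l hl.1 (by simp) j hj (by rw [hjk]; exact Ne.symm hl.2)
    · exact hUe v hvU k hk hvk j hj hjk
  intro i j hi
  have h1 := congrFun (hall i hi g hg) j
  rw [Matrix.single_one_vecMul] at h1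
  have h2 : g i j = (Pi.single i 1 : Fin n → F Fq) j := h1
  rw [h2, Pi.single_apply, Matrix.one_apply]
  exact if_congr eq_comm rfl rfl

lemma tv_comm (i j k : Fin n) (hij : i ≠ j) (hjk : j ≠ k) (hik : i ≠ k) (c d : F Fq) :
    tv i j hij c * tv j k hjk d = tv i k hik (c * d) * (tv j k hjk d * tv i j hij c) := by
  ext1 a b
  rw [tv_mul_apply, tv_mul_apply, tv_mul_apply, tv_mul_apply, tv_mul_apply]
  simp only [tv_apply, Matrix.one_apply]
  by_cases ha : a = i
  · subst ha
    simp only [hij, hij.symm, hjk, hjk.symm, hik, hik.symm, if_true, if_false, false_and, true_and]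
    by_cases hb : b = j
    · subst hb; simp [hjk.symm, hij, hjk]
    · by_cases hb' : b = k
      · subst hb'; simp [hij, hjk, hik]
      · simp [Ne.symm hb, Ne.symm hb']
  · by_cases ha' : a = j
    · subst ha'
      simp only [hij, hij.symm, hjk, hjk.symm, hik, hik.symm, if_true, if_false, false_and, true_and]
      by_cases hb' : b = k
      · subst hb'; simp [hij, hjk, hik]
      · simp [Ne.symm hb']
    · simp [ha, ha', Ne.symm ha, Ne.symm ha']

lemma tv_add (i j : Fin n) (h : i ≠ j) (c d : F Fq) : tv i j h c * tv i j h d = tv i j h (c + d) := by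
  ext1 a b
  rw [tv_mul_apply]
  simp only [tv_apply, Matrix.one_apply]
  by_cases ha : a = i
  · subst ha
    by_cases hb : b = j
    · subst hb; simp [h, h.symm, add_comm]
    · simp [h, h.symm, Ne.symm hb]
  · simp [ha, Ne.symm ha]

lemma exists_third (hn : 3 ≤ n) (i j : Fin n) : ∃ l : Fin n, l ≠ i ∧ l ≠ j := by
  by_contra! hcon
  have : (Finset.univ : Finset (Fin n)) ⊆ {i, j} := fun x _ => by
    by_cases h : x = i
    · simp [h]
    · simp [hcon x h]
  have := Finset.card_le_card this
  have h2 := Finset.card_le_two (a := i) (b := j)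
  rw [Finset.card_univ, Fintype.card_fin] at this
  omega

lemma tv_mem_mul {Γ : Subgroup (SG Fq n)} {i j k : Fin n} (hij : i ≠ j) (hjk : j ≠ k) (hik : i ≠ k)
    {c d : F Fq} (hc : tv i j hij c ∈ Γ) (hd : tv j k hjk d ∈ Γ) : tv i k hik (c * d) ∈ Γ := by
  have h := tv_comm i j k hij hjk hik c d
  have h2 : tv i k hik (c * d) = tv i j hij c * tv j k hjk d * (tv j k hjk d * tv i j hij c)⁻¹ := by
    rw [h, mul_inv_cancel_right]
  rw [h2]
  exact mul_mem (mul_mem hc hd) (inv_mem (mul_mem hd hc))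

lemma step4_spread (hn : 3 ≤ n) {Γ : Subgroup (SG Fq n)} (hC : ∀ h, cS h ∈ Γ) {i j : Fin n} (hij : i ≠ j)
    {c : F Fq} (hc : tv i j hij c ∈ Γ) : ∀ (a b : Fin n) (hab : a ≠ b), tv a b hab c ∈ Γ := by
  have hr : ∀ (i j : Fin n) (hij : i ≠ j), tv i j hij c ∈ Γ → ∀ k (hk : i ≠ k), tv i k hk c ∈ Γ := by
    intro i j hij h k hk
    by_cases hjk : j = k
    · subst hjk; exact h
    · have := tv_mem_mul hij hjk hk h (tv_one_mem hC j k hjk)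
      rwa [mul_one] at this
  have hl : ∀ (i j : Fin n) (hij : i ≠ j), tv i j hij c ∈ Γ → ∀ k (hk : k ≠ j), tv k j hk c ∈ Γ := by
    intro i j hij h k hk
    by_cases hjk : k = i
    · subst hjk; exact h
    · have := tv_mem_mul hjk hij hk (tv_one_mem hC k i hjk) h
      rwa [one_mul] at this
  intro a b hab
  by_cases hb : b = i
  · obtain ⟨k, hki, hkj⟩ := exists_third hn i j
    have h1 := hl i j hij hc k hkj
    have h2 := hr k j hkj h1 b (by rw [hb]; exact hki)
    exact hl _ _ _ h2 a hab
  · exact hl _ _ _ (hr i j hij hc b (Ne.symm hb)) a hab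

lemma step4_poly (hn : 3 ≤ n) {Γ : Subgroup (SG Fq n)} (hC : ∀ h, cS h ∈ Γ) {τ : F Fq}
    (hτ : ∀ (a b : Fin n) (hab : a ≠ b), tv a b hab τ ∈ Γ) (f : Polynomial Fq) :
    ∀ (a b : Fin n) (hab : a ≠ b), tv a b hab (f.eval₂ HahnSeries.C τ) ∈ Γ := by
  induction f using Polynomial.induction_on with
  | C a => intro i j h; rw [Polynomial.eval₂_C]; exact cS_tv_mem hC i j h a
  | add f g hf hg =>
    intro i j h; rw [Polynomial.eval₂_add, ← tv_add]
    exact mul_mem (hf i j h) (hg i j h)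
  | monomial m a hm =>
    intro i j h
    rw [pow_succ, ← mul_assoc, Polynomial.eval₂_mul_X]
    obtain ⟨k, hk, hk'⟩ := exists_third hn i j
    exact tv_mem_mul hk.symm hk' h (hm _ _ _) (hτ _ _ _)

/-- Step 4 together with the final substitution -/
lemma step4 (hn : 3 ≤ n) {p : ℕ} (hp : p.Prime) [CharP Fq p] {Γ : Subgroup (SG Fq n)} (hΓ : FB Γ)
    (hC : ∀ h, cS h ∈ Γ)
    (hM : ∀ z : GF Fq n, Nat.card (SpecialLinearGroup (Fin n) Fq) < 2 * Nat.card (stab Γ z))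
    (hK1 : ∀ g ∈ Γ, g ∈ K1 Fq n → g = 1) (hKK : ∀ g ∈ Γ, g ∈ KK Fq n → ∃ h, cS h = g) :
    ∃ φ : SG Fq n ≃* SG Fq n, Continuous φ ∧ Continuous φ.symm ∧ Γ.map φ.toMonoidHom = SLpoly Fq n := by
  let i0 : Fin n := ⟨0, by omega⟩
  let i1 : Fin n := ⟨1, by omega⟩
  have h01 : i0 ≠ i1 := by simp [i0, i1]
  obtain ⟨γ, hγ, hγK⟩ := step4_exists i0 i1 h01 (hM _) hKK
  obtain ⟨g, hg, hgK, hgV, hgc, hg1⟩ := step4_norm (by omega) hp hΓ hC i0 hγ hγK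
  have hgN : g ∈ Nz Γ (dg (mD i0 2)) := by
    refine mem_Nz.2 ⟨hg, mem_K1.2 fun i j => ?_⟩
    have h1 : ((cj (dg (mD i0 2))⁻¹ g).1 - 1) i j = cj (dg (mD i0 2))⁻¹ g i j - (1 : MF Fq n) i j := rfl
    rw [h1, cj_mD]
    by_cases hi : i = i0
    · by_cases hj : j = i0
      · have := hg1 i j (Or.inr hj)
        rw [hi, hj] at this ⊢
        simpa [single_zero_one] using this
      · rw [Matrix.one_apply_ne (by rw [hi]; exact Ne.symm hj), sub_zero, V_single_mul]
        exact (hgV i j).mono (by simp [hi, hj])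
    · by_cases hj : j = i0
      · rw [hj, hgc i hi, mul_zero, Matrix.one_apply_ne hi, sub_zero]; exact V.zero
      · have := hg1 i j (Or.inl hi)
        simpa [single_zero_one, hi, hj] using this
  have hgu := step4_uni hn hp hΓ hC i0 hgN
  have hg00 : g i0 i0 = 1 := by
    have hbt : (g.1).BlockTriangular id := by
      intro i j hij
      have hi : i ≠ i0 := by
        intro h; rw [h] at hij
        exact absurd hij (by simp [i0, Fin.lt_def])
      have := hgu i j hi
      rw [Matrix.one_apply_ne (show i ≠ j from ne_of_gt hij)] at this
      exact this
    have := Matrix.det_of_upperTriangular hbt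
    rw [g.2, Finset.prod_eq_single i0] at this
    · exact this.symm
    · intro b _ hb
      have := hgu b b hb
      rwa [Matrix.one_apply_eq] at this
    · simp
  obtain ⟨j, hj, hτ⟩ : ∃ j, i0 ≠ j ∧ ¬ V 0 (g i0 j) := by
    by_contra! hcon
    apply hgK
    rw [mem_KK]
    have h1 : ∀ i j, V 0 ((1 : MF Fq n) i j) := by
      intro i j
      rw [Matrix.one_apply]; split_ifs
      · exact V_one
      · exact V.zero
    intro i j
    by_cases hi : i = i0
    · by_cases hj : i0 = j
      · rw [hi, ← hj, hg00]; exact V_one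
      · rw [hi]; exact hcon j hj
    · rw [hgu i j hi]; exact h1 i j
  obtain ⟨k, hk, hkj⟩ := exists_third hn i0 j
  have hmem : tv i0 k hk.symm (g i0 j) ∈ Γ := by
    have h1 : g * tv j k hkj.symm 1 = tv i0 k hk.symm (g i0 j) * (tv j k hkj.symm 1 * g) := by
      ext1 a b
      rw [mul_tv_apply, tv_mul_apply, tv_mul_apply, tv_mul_apply, tv_mul_apply]
      by_cases ha : a = i0
      · subst ha
        rw [if_pos rfl, if_neg hj, if_neg hkj, hgu k b hk]
        by_cases hb : b = k
        · rw [if_pos hb, hb, Matrix.one_apply_eq]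
        · rw [if_neg hb, Matrix.one_apply_ne (Ne.symm hb), mul_zero, add_zero]
      · rw [if_neg ha, hgu a k ha, hgu a j ha, hgu a b ha]
        by_cases haj : a = j
        · subst haj
          rw [if_pos rfl, hgu a b ha, hgu k b hk, Matrix.one_apply_eq]
          by_cases hb : b = k
          · rw [if_pos hb, hb, Matrix.one_apply_eq, one_mul]
          · rw [if_neg hb, Matrix.one_apply_ne (Ne.symm hb), mul_zero, add_zero]
        · rw [if_neg haj, Matrix.one_apply_ne haj, zero_mul, add_zero]
          by_cases hb : b = k
          · rw [if_pos hb, hb]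
          · rw [if_neg hb]
    have h2 : tv i0 k hk.symm (g i0 j) = g * tv j k hkj.symm 1 * (tv j k hkj.symm 1 * g)⁻¹ := by
      rw [h1, mul_inv_cancel_right]
    rw [h2]
    have := tv_one_mem hC j k hkj.symm
    exact mul_mem (mul_mem hg this) (inv_mem (mul_mem this hg))
  refine final_alg Γ (g i0 j) (hgV _ _) ?_ (fun a b hab f => step4_poly hn hC (step4_spread hn hC _ hmem) f a b hab)
    hK1 hKK
  intro h0
  apply hτ
  rw [V_iff]
  intro m hm
  by_cases hm1 : m = -1
  · rw [hm1, h0]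
  · exact V_iff.1 (hgV i0 j) m (by omega)
end

section
variable {n}
variable {k A : Type} [Field k] [Fintype k] [CommRing A] [IsDomain A] (C : k →+* A) (ε : A →+* k)

/-- product homomorphism -/
def prodH (k : Type) [Field k] (n : ℕ) : (Fin n → kˣ) →* kˣ where
  toFun s := ∏ i, s i
  map_one' := by simp
  map_mul' s t := by simp [Finset.prod_mul_distrib]

/-- diagonal torus -/
def dT (s : Fin n → kˣ) (hs : ∏ i, s i = 1) : SpecialLinearGroup (Fin n) k :=
  ⟨Matrix.diagonal fun i => (s i : k), by
    rw [Matrix.det_diagonal, ← Units.coe_prod, hs, Units.val_one]⟩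

lemma dT_mul (s t : Fin n → kˣ) (hs : ∏ i, s i = 1) (ht : ∏ i, t i = 1) (hst : ∏ i, (s * t) i = 1) :
    dT (s * t) hst = dT s hs * dT t ht := by
  apply Subtype.ext
  change _ = Matrix.diagonal _ * Matrix.diagonal _
  rw [Matrix.diagonal_mul_diagonal]; simp [dT]

lemma step3a (hu : ∀ a, ε a ≠ 0 → IsUnit a) (hC : ∀ a, ε (C a) = a)
    (R : SpecialLinearGroup (Fin n) k →* Matrix (Fin n) (Fin n) A)
    (hR : ∀ h i j, ε (R h i j) = h i j) :
    ∃ (Y : (Matrix (Fin n) (Fin n) A)ˣ) (c : k), c ≠ 0 ∧ (∀ i j, ε (Y.1 i j) = if i = j then c else 0) ∧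
      ∀ s hs, R (dT s hs) * Y.1 = Y.1 * Matrix.diagonal fun i => C (s i : k) := by
  classical
  let T := (prodH k n).ker
  haveI : Fintype T := Fintype.ofFinite _
  have hT : ∀ u : T, ∏ i, u.1 i = 1 := fun u => u.2
  let Y : Matrix (Fin n) (Fin n) A := fun a i => ∑ u : T, C ((u.1 i)⁻¹ : kˣ) * R (dT u.1 (hT u)) a i
  have hYε : ∀ i j, ε (Y i j) = if i = j then (Fintype.card T : k) else 0 := by
    intro i j
    simp only [Y, map_sum, map_mul, hC, hR]
    by_cases hij : i = j
    · subst hij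
      rw [if_pos rfl, Finset.sum_congr rfl (g := fun _ => (1 : k))]
      · simp
      · intro u _
        simp [dT]
    · rw [if_neg hij]
      refine Finset.sum_eq_zero fun u _ => ?_
      have : (dT u.1 (hT u)) i j = 0 := Matrix.diagonal_apply_ne _ hij
      rw [this, mul_zero]
  have hc : (Fintype.card T : k) ≠ 0 := by
    intro h0
    have h1 : Fintype.card T ∣ Fintype.card (Fin n → kˣ) := by
      have := Subgroup.card_subgroup_dvd_card T
      rwa [Nat.card_eq_fintype_card, Nat.card_eq_fintype_card] at this
    rw [Fintype.card_fun, Fintype.card_units, Fintype.card_fin] at h1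
    have h2 : (((Fintype.card k - 1) ^ n : ℕ) : k) = 0 := by
      obtain ⟨d, hd⟩ := h1
      rw [hd, Nat.cast_mul, h0, zero_mul]
    rw [Nat.cast_pow, Nat.cast_sub Fintype.card_pos, FiniteField.cast_card_eq_zero] at h2
    simp at h2
  have hdet : IsUnit Y.det := by
    apply hu
    rw [RingHom.map_det]
    have : ε.mapMatrix Y = Matrix.diagonal fun _ => (Fintype.card T : k) := by
      ext1 i j
      rw [RingHom.mapMatrix_apply, Matrix.map_apply, hYε, Matrix.diagonal_apply]
    rw [this, Matrix.det_diagonal, Finset.prod_const]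
    exact pow_ne_zero _ hc
  have hYu : IsUnit Y := (Matrix.isUnit_iff_isUnit_det Y).2 hdet
  refine ⟨hYu.unit, _, hc, fun i j => by rw [IsUnit.unit_spec, hYε], fun s hs => ?_⟩
  rw [IsUnit.unit_spec]
  ext1 a i
  rw [Matrix.mul_diagonal, Matrix.mul_apply]
  let s' : T := ⟨s, hs⟩
  have h1 : ∀ l, R (dT s hs) a l * Y l i =
      ∑ u : T, C ((u.1 i)⁻¹ : kˣ) * (R (dT s hs) a l * R (dT u.1 (hT u)) l i) := by
    intro l
    simp only [Y]
    rw [Finset.mul_sum]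
    exact Finset.sum_congr rfl fun u _ => by ring
  rw [Finset.sum_congr rfl fun l _ => h1 l, Finset.sum_comm]
  have h2 : ∀ u : T, ∑ l, C ((u.1 i)⁻¹ : kˣ) * (R (dT s hs) a l * R (dT u.1 (hT u)) l i) =
      C (s i : k) * (C (((s' * u).1 i)⁻¹ : kˣ) * R (dT (s' * u).1 (hT (s' * u))) a i) := by
    intro u
    rw [← Finset.mul_sum, ← Matrix.mul_apply, ← map_mul, ← dT_mul s u.1 hs (hT u) (hT (s' * u)),
      ← mul_assoc, ← map_mul]
    congr 2
    have : ((s' * u).1 i) = s i * u.1 i := rfl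
    rw [this, ← Units.val_mul]
    congr 1
    rw [_root_.mul_inv_rev, mul_comm (u.1 i)⁻¹, mul_inv_cancel_left]
  rw [Finset.sum_congr rfl fun u _ => h2 u, ← Finset.mul_sum, mul_comm]
  congr 1
  exact Fintype.sum_equiv (Equiv.mulLeft s') _ _ fun u => rfl

end

section
variable {n}
variable {k A : Type} [Field k] [Fintype k] [CommRing A] [IsDomain A] {C : k →+* A} {ε : A →+* k}

/-- two-parameter torus weights -/
def s2 (a b : Fin n) (x y : kˣ) : Fin n → kˣ := fun l => if l = a then x else if l = b then y else 1

lemma prod_s2 {a b : Fin n} (hab : a ≠ b) (x y : kˣ) : ∏ i, s2 a b x y i = x * y := by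
  rw [← Finset.prod_subset (Finset.subset_univ {a, b}), Finset.prod_pair hab]
  · simp [s2, hab.symm]
  · intro l _ hl
    simp only [Finset.mem_insert, Finset.mem_singleton, not_or] at hl
    simp [s2, hl.1, hl.2]

lemma dT_tr (s : Fin n → kˣ) (hs : ∏ i, s i = 1) {i j : Fin n} (hij : i ≠ j) (a : k) :
    dT s hs * SpecialLinearGroup.transvection hij a =
      SpecialLinearGroup.transvection hij ((s i : k) * (s j : k)⁻¹ * a) * dT s hs := by
  apply Subtype.ext
  change Matrix.diagonal _ * (1 + Matrix.single i j a) =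
    (1 + Matrix.single i j _) * Matrix.diagonal _
  ext1 x y
  rw [Matrix.diagonal_mul, Matrix.mul_diagonal, Matrix.add_apply, Matrix.add_apply, Matrix.single_apply,
    Matrix.single_apply, Matrix.one_apply]
  by_cases hx : i = x
  · by_cases hy : j = y
    · subst hx; subst hy
      have : (s j : k) ≠ 0 := Units.ne_zero _
      simp [hij]; field_simp
    · by_cases hxy : x = y
      · subst hxy; simp [hy]
      · simp [hxy, hy]
  · by_cases hxy : x = y
    · subst hxy; simp [hx]
    · simp [hxy, hx]

section
variable (hC : ∀ a, ε (C a) = a)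
    (R : SpecialLinearGroup (Fin n) k →* Matrix (Fin n) (Fin n) A)
    (hR : ∀ h i j, ε (R h i j) = h i j)
    (hT : ∀ s hs, R (dT s hs) = Matrix.diagonal fun i => C (s i : k))

/-- image of an elementary matrix -/
def uR {i j : Fin n} (hij : i ≠ j) (a : k) : Matrix (Fin n) (Fin n) A :=
  R (SpecialLinearGroup.transvection hij a)

include hT in
lemma uR_scale {i j : Fin n} (hij : i ≠ j) (a : k) (s : Fin n → kˣ) (hs : ∏ i, s i = 1) (x y : Fin n) :
    C (s x : k) * uR R hij a x y = uR R hij ((s i : k) * (s j : k)⁻¹ * a) x y * C (s y : k) := by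
  have h := congrArg R (dT_tr s hs hij a)
  rw [map_mul, map_mul, hT] at h
  have := congrFun (congrFun h x) y
  rwa [Matrix.diagonal_mul, Matrix.mul_diagonal] at this

lemma uR_zero {i j : Fin n} (hij : i ≠ j) : uR R hij 0 = 1 := by
  rw [uR, ← map_one R]
  congr 1
  apply Subtype.ext
  change 1 + Matrix.single i j (0 : k) = 1
  simp

lemma uR_add {i j : Fin n} (hij : i ≠ j) (a b : k) : uR R hij (a + b) = uR R hij a * uR R hij b := by
  rw [uR, uR, uR, ← map_mul]
  congr 1
  apply Subtype.ext
  change 1 + Matrix.single i j (a + b) = (1 + Matrix.single i j a) * (1 + Matrix.single i j b)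
  rw [add_mul, mul_add, mul_add, Matrix.single_mul_single_of_ne _ _ _ _ hij.symm, one_mul, one_mul,
    mul_one, Matrix.single_add]
  abel

include hT in
lemma uR_off {r : kˣ} (hr2 : r ^ 2 ≠ 1) (hr3 : r ^ 3 ≠ 1) {i j : Fin n} (hij : i ≠ j) (a : k)
    (x y : Fin n) (hxy : x ≠ y) (h1 : ¬ (x = i ∧ y = j)) (h2 : ¬ (x = j ∧ y = i)) :
    uR R hij a x y = 0 := by
  have key : ∀ (s : Fin n → kˣ) (hs : ∏ i, s i = 1), s i = s j → s x ≠ s y → uR R hij a x y = 0 := by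
    intro s hs hsij hsxy
    have h := uR_scale R hT hij a s hs x y
    rw [hsij, mul_inv_cancel₀ (Units.ne_zero _), one_mul, mul_comm] at h
    have h3 : uR R hij a x y * (C (s x : k) - C (s y : k)) = 0 := by rw [mul_sub, h, sub_self]
    rcases mul_eq_zero.1 h3 with h4 | h4
    · exact h4
    · exact absurd (Units.ext (C.injective (sub_eq_zero.1 h4))) hsxy
  have main : ∀ (z w : Fin n), z ≠ i → z ≠ j → z ≠ w → ∃ s : Fin n → kˣ, ∏ i, s i = 1 ∧ s i = s j ∧ s z ≠ s w := by
    intro z w hzi hzj hzw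
    refine ⟨s2 i z r r⁻¹ * s2 j z r r⁻¹, ?_, ?_, ?_⟩
    · simp only [Pi.mul_apply, Finset.prod_mul_distrib]
      rw [prod_s2 hzi.symm, prod_s2 hzj.symm]; simp
    · simp [s2, hij, hij.symm, hzi.symm, hzj.symm]
    · have hz : (s2 i z r r⁻¹ * s2 j z r r⁻¹) z = r⁻¹ * r⁻¹ := by simp [s2, hzi, hzj]
      rw [hz]
      intro h
      by_cases hwi : w = i
      · subst hwi
        simp only [Pi.mul_apply, s2, if_true, hij, hzi.symm, if_false, mul_one] at h
        apply hr3
        calc r ^ 3 = r * r * r := by rw [pow_succ, pow_two]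
          _ = r * r * (r⁻¹ * r⁻¹) := by rw [h]
          _ = 1 := by group
      · by_cases hwj : w = j
        · subst hwj
          simp only [Pi.mul_apply, s2, if_true, hwi, hzj.symm, if_false, one_mul] at h
          apply hr3
          calc r ^ 3 = r * r * r := by rw [pow_succ, pow_two]
            _ = r * r * (r⁻¹ * r⁻¹) := by rw [h]
            _ = 1 := by group
        · simp only [Pi.mul_apply, s2, hwj, hwi, hzw.symm, if_false, one_mul] at h
          apply hr2
          calc r ^ 2 = r * r * 1 := by rw [mul_one, pow_two]
            _ = r * r * (r⁻¹ * r⁻¹) := by rw [h]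
            _ = 1 := by group
  by_cases hx : x ≠ i ∧ x ≠ j
  · obtain ⟨s, hs, h3, h4⟩ := main x y hx.1 hx.2 hxy
    exact key s hs h3 h4
  · have hy : y ≠ i ∧ y ≠ j := by
      constructor
      · rintro rfl; tauto
      · rintro rfl; tauto
    obtain ⟨s, hs, h3, h4⟩ := main y x hy.1 hy.2 hxy.symm
    exact key s hs h3 h4.symm

include hT in
lemma uR_lam (hn : 3 ≤ n) {i j : Fin n} (hij : i ≠ j) (a : k) (l : kˣ) :
    uR R hij (l * a) i j = C l * uR R hij a i j ∧
    C l * uR R hij (l * a) j i = uR R hij a j i ∧ ∀ x, uR R hij (l * a) x x = uR R hij a x x := by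
  obtain ⟨z, hzi, hzj⟩ := exists_third hn i j
  have hs : ∏ x, s2 i z l l⁻¹ x = 1 := by rw [prod_s2 hzi.symm, mul_inv_cancel]
  have hi : s2 i z l l⁻¹ i = l := by simp [s2]
  have hj : s2 i z l l⁻¹ j = 1 := by simp [s2, hij.symm, hzj.symm]
  have h := uR_scale R hT hij a _ hs
  rw [hi, hj, Units.val_one, inv_one, mul_one] at h
  refine ⟨?_, ?_, ?_⟩
  · have := h i j
    rw [hi, hj] at this
    rw [this]; simp
  · have := h j i
    rw [hi, hj] at this
    rw [mul_comm, ← this]; simp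
  · intro x
    have := h x x
    rw [mul_comm] at this
    have h0 : C (s2 i z l l⁻¹ x : k) ≠ 0 := by
      rw [map_ne_zero]; exact Units.ne_zero _
    exact (mul_right_cancel₀ h0 this).symm

include hR hT in
lemma uR_form (hn : 3 ≤ n) {r : kˣ} (hr2 : r ^ 2 ≠ 1) (hr3 : r ^ 3 ≠ 1) {i j : Fin n} (hij : i ≠ j) (a : k) :
    uR R hij a = 1 + Matrix.single i j (C a * uR R hij 1 i j) := by
  have off := fun a x y => uR_off R hT hr2 hr3 hij a x y
  have hlow : ∀ a, uR R hij a j i = 0 := by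
    intro a
    by_cases ha : a = 0
    · rw [ha, uR_zero]; exact Matrix.one_apply_ne hij.symm
    · obtain ⟨l1, l2, l3⟩ := uR_lam R hT hn hij a r
      have hcomm : uR R hij a * uR R hij (r * a) = uR R hij (r * a) * uR R hij a := by
        rw [← uR_add, ← uR_add, add_comm]
      have h1 := congrFun (congrFun hcomm i) i
      have hsum : ∀ b c, (uR R hij b * uR R hij c) i i =
          uR R hij b i i * uR R hij c i i + uR R hij b i j * uR R hij c j i := by
        intro b c
        rw [Matrix.mul_apply, ← Finset.sum_subset (Finset.subset_univ {i, j}), Finset.sum_pair hij]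
        intro l _ hl
        simp only [Finset.mem_insert, Finset.mem_singleton, not_or] at hl
        rw [off b i l (Ne.symm hl.1) (by tauto) (by tauto), zero_mul]
      rw [hsum, hsum, l1, l3] at h1
      have hβ : uR R hij a i j ≠ 0 := by
        intro h0
        have := hR (SpecialLinearGroup.transvection hij a) i j
        change ε (uR R hij a i j) = (1 + Matrix.single i j a) i j at this
        rw [h0, map_zero, Matrix.add_apply, Matrix.one_apply_ne hij, Matrix.single_apply_same, zero_add] at this
        exact ha this.symm
      have h2 : uR R hij a i j * (uR R hij (r * a) j i * (C ((r : k) ^ 2) - 1)) = 0 := by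
        have h3 := add_left_cancel h1
        rw [map_pow]
        rw [← l2] at h3
        linear_combination -h3
      have h4 : C ((r : k) ^ 2) - 1 ≠ 0 := by
        intro h
        rw [sub_eq_zero, ← map_one C] at h
        apply hr2
        ext
        simpa using C.injective h
      have h5 := ((mul_eq_zero.1 h2).resolve_left hβ)
      have h6 := (mul_eq_zero.1 h5).resolve_right h4
      rw [← l2, h6, mul_zero]
  have off' : ∀ a x y, x ≠ y → ¬ (x = i ∧ y = j) → uR R hij a x y = 0 := by
    intro a x y hxy h1
    by_cases h2 : x = j ∧ y = i
    · rw [h2.1, h2.2, hlow]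
    · exact off a x y hxy h1 h2
  have hdm : ∀ a b x, uR R hij (a + b) x x = uR R hij a x x * uR R hij b x x := by
    intro a b x
    rw [uR_add, Matrix.mul_apply, Finset.sum_eq_single x]
    · intro y _ hy
      by_cases h1 : x = i ∧ y = j
      · rw [off' b y x hy (fun h => hij (by rw [← h1.1, h.2])), mul_zero]
      · rw [off' a x y hy.symm h1, zero_mul]
    · simp
  have hd1 : ∀ a x, uR R hij a x x = 1 := by
    intro a x
    have hr1 : (r : k) - 1 ≠ 0 := by
      intro h
      apply hr2
      have : r = 1 := Units.ext (sub_eq_zero.1 h)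
      rw [this]; simp
    set b := a / ((r : k) - 1) with hb
    have h1 := (uR_lam R hT hn hij b r).2.2 x
    have h2 : (r : k) * b = a + b := by rw [hb]; field_simp; ring
    rw [h2, hdm] at h1
    have h0 : uR R hij b x x ≠ 0 := by
      intro h0
      have := hdm b (-b) x
      rw [add_neg_cancel, uR_zero, h0, zero_mul, Matrix.one_apply_eq] at this
      exact one_ne_zero this
    exact mul_right_cancel₀ h0 (by rw [h1, one_mul])
  ext1 x y
  rw [Matrix.add_apply, Matrix.single_apply, Matrix.one_apply]
  by_cases hxy : x = y
  · subst hxy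
    rw [hd1, if_pos rfl, if_neg, add_zero]
    rintro ⟨rfl, h⟩; exact hij h.symm
  · rw [if_neg hxy, zero_add]
    by_cases h1 : i = x ∧ j = y
    · rw [if_pos h1, ← h1.1, ← h1.2]
      by_cases ha : a = 0
      · rw [ha, uR_zero, map_zero, zero_mul]; exact Matrix.one_apply_ne hij
      · have := (uR_lam R hT hn hij 1 (Units.mk0 a ha)).1
        simpa using this
    · rw [if_neg h1, off' a x y hxy (by tauto)]

include hR hT in
lemma step3b (hn : 3 ≤ n) {r : kˣ} (hr2 : r ^ 2 ≠ 1) (hr3 : r ^ 3 ≠ 1) :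
    ∃ d : Fin n → A, (∀ i, ε (d i) = 1) ∧
      ∀ h, R h * Matrix.diagonal d = Matrix.diagonal d * (h.1).map C := by
  have hform := fun {i j : Fin n} (hij : i ≠ j) a => uR_form R hR hT hn hr2 hr3 hij a
  let c : ∀ i j : Fin n, i ≠ j → A := fun i j hij => uR R hij 1 i j
  have hcε : ∀ i j hij, ε (c i j hij) = 1 := by
    intro i j hij
    have := hR (SpecialLinearGroup.transvection hij 1) i j
    change ε (uR R hij 1 i j) = (1 + Matrix.single i j (1 : k)) i j at this
    rw [Matrix.add_apply, Matrix.one_apply_ne hij, Matrix.single_apply_same, zero_add] at this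
    exact this
  have hc0 : ∀ i j hij, c i j hij ≠ 0 := fun i j hij h => by
    have := hcε i j hij
    rw [h, map_zero] at this; exact zero_ne_one this
  have hcc : ∀ i j l (hij : i ≠ j) (hjl : j ≠ l) (hil : i ≠ l), c i j hij * c j l hjl = c i l hil := by
    intro i j l hij hjl hil
    have h : (SpecialLinearGroup.transvection hij (1 : k)) * SpecialLinearGroup.transvection hjl 1 =
        SpecialLinearGroup.transvection hil 1 * (SpecialLinearGroup.transvection hjl 1 *
          SpecialLinearGroup.transvection hij 1) := by
      apply Subtype.ext
      change (1 + Matrix.single i j 1) * (1 + Matrix.single j l 1) =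
        (1 + Matrix.single i l 1) * ((1 + Matrix.single j l 1) * (1 + Matrix.single i j 1))
      simp only [add_mul, mul_add, one_mul, mul_one, Matrix.single_mul_single_same,
        Matrix.single_mul_single_of_ne _ _ _ _ hil.symm, Matrix.single_mul_single_of_ne _ _ _ _ hjl.symm,
        mul_zero, add_zero]
      abel
    have h2 := congrArg R h
    rw [map_mul, map_mul, map_mul] at h2
    change uR R hij 1 * uR R hjl 1 = uR R hil 1 * (uR R hjl 1 * uR R hij 1) at h2
    rw [hform hij, hform hjl, hform hil] at h2
    simp only [add_mul, mul_add, one_mul, mul_one, Matrix.single_mul_single_same,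
        Matrix.single_mul_single_of_ne _ _ _ _ hil.symm, Matrix.single_mul_single_of_ne _ _ _ _ hjl.symm,
        mul_zero, add_zero, map_one] at h2
    have h3 := congrFun (congrFun h2 i) l
    simp only [Matrix.add_apply, Matrix.single_apply, Matrix.one_apply_ne hil, hij, hjl, hij.symm,
      hjl.symm, if_true, if_false, and_self, false_and, and_false, true_and, and_true, zero_add,
      add_zero] at h3
    exact h3
  let i0 : Fin n := ⟨0, by omega⟩
  let d : Fin n → A := fun i => if h : i = i0 then 1 else c i i0 h
  have hd0 : d i0 = 1 := by simp [d]
  have hd : ∀ i (h : i ≠ i0), d i = c i i0 h := fun i h => by simp [d, h]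
  have hcd : ∀ i j hij, c i j hij * d j = d i := by
    intro i j hij
    by_cases hj : j = i0
    · subst hj; rw [hd0, mul_one, hd i hij]
    · by_cases hi : i = i0
      · subst hi
        rw [hd0, hd j hj]
        obtain ⟨l, hl0, hlj⟩ := exists_third hn i0 j
        apply mul_right_cancel₀ (hc0 i0 l hl0.symm)
        rw [mul_assoc, hcc j i0 l hj hl0.symm hlj.symm, hcc i0 j l hij hlj.symm hl0.symm, one_mul]
      · rw [hd i hi, hd j hj, hcc]
  refine ⟨d, ?_, ?_⟩
  · intro i
    by_cases hi : i = i0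
    · rw [hi, hd0, map_one]
    · rw [hd i hi, hcε]
  · have hdet : ∀ h, Function.Injective fun M : Matrix (Fin n) (Fin n) A => R h * M := by
      intro h M N hMN
      have := congrArg (fun M => R h⁻¹ * M) hMN
      simp only [← mul_assoc, ← map_mul, inv_mul_cancel, map_one, one_mul] at this
      exact this
    let H : Subgroup (SpecialLinearGroup (Fin n) k) :=
      { carrier := {h | R h * Matrix.diagonal d = Matrix.diagonal d * (h.1).map C}
        one_mem' := by
          change R 1 * _ = _ * Matrix.map 1 C
          rw [map_one, one_mul, Matrix.map_one C (map_zero C) (map_one C), mul_one]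
        mul_mem' := by
          intro x y hx hy
          have hx : R x * _ = _ := hx
          have hy : R y * _ = _ := hy
          change R (x * y) * _ = _ * (x.1 * y.1).map C
          rw [map_mul, mul_assoc, hy, ← mul_assoc, hx, mul_assoc, Matrix.map_mul]
        inv_mem' := by
          intro x hx
          have hx : R x * _ = _ := hx
          change R x⁻¹ * _ = _ * (x⁻¹).1.map C
          apply hdet x
          change R x * (_ * _) = R x * (_ * _)
          rw [← mul_assoc, ← map_mul, mul_inv_cancel, map_one, one_mul, ← mul_assoc, hx, mul_assoc,
            ← Matrix.map_mul]
          have : x.1 * (x⁻¹).1 = 1 := congrArg Subtype.val (mul_inv_cancel x)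
          rw [this, Matrix.map_one C (map_zero C) (map_one C), mul_one] }
    have hH : H = ⊤ := SLgen H fun i j hij a => by
      change uR R hij a * _ = _ * (1 + Matrix.single i j a).map C
      rw [hform hij a]
      ext1 x y
      rw [Matrix.mul_diagonal, Matrix.diagonal_mul, Matrix.map_apply, Matrix.add_apply, Matrix.add_apply,
        Matrix.single_apply, Matrix.single_apply, Matrix.one_apply, Matrix.one_apply]
      by_cases hxy : x = y
      · subst hxy
        have : ¬ (i = x ∧ j = x) := fun h => hij (h.1.trans h.2.symm)
        simp [this]
      · by_cases h1 : i = x ∧ j = y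
        · rw [if_pos h1, if_pos h1, if_neg hxy, if_neg hxy, zero_add, zero_add, ← h1.1, ← h1.2, mul_assoc]
          change C a * (c i j hij * d j) = _
          rw [hcd, mul_comm]
        · simp [hxy, h1]
    intro h
    have : h ∈ H := hH ▸ Subgroup.mem_top h
    exact this

end

lemma step3c (hu : ∀ a, ε a ≠ 0 → IsUnit a) (hC : ∀ a, ε (C a) = a) (hn : 3 ≤ n)
    (hk : 7 ≤ Fintype.card k)
    (R : SpecialLinearGroup (Fin n) k →* Matrix (Fin n) (Fin n) A)
    (hR : ∀ h i j, ε (R h i j) = h i j) :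
    ∃ Z : (Matrix (Fin n) (Fin n) A)ˣ, ∀ h, R h * Z.1 = Z.1 * (h.1).map C := by
  classical
  obtain ⟨Y, c, hc, hY, hYT⟩ := step3a C ε hu hC R hR
  let R' : SpecialLinearGroup (Fin n) k →* Matrix (Fin n) (Fin n) A :=
    { toFun := fun h => Y⁻¹.1 * R h * Y.1
      map_one' := by simp
      map_mul' := fun a b => by
        rw [map_mul]
        simp only [mul_assoc, Units.mul_inv_cancel_left] }
  have hYR : ∀ h, Y.1 * R' h = R h * Y.1 := by
    intro h
    change Y.1 * (Y⁻¹.1 * R h * Y.1) = _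
    rw [mul_assoc, Units.mul_inv_cancel_left]
  have hR' : ∀ h i j, ε (R' h i j) = h i j := by
    intro h i j
    have h1 := congrArg (fun M : Matrix (Fin n) (Fin n) A => ε (M i j)) (hYR h)
    simp only [Matrix.mul_apply, map_sum, map_mul, hY, hR] at h1
    simp only [ite_mul, mul_ite, zero_mul, mul_zero, Finset.sum_ite_eq, Finset.sum_ite_eq', Finset.mem_univ,
      if_true] at h1
    rw [mul_comm] at h1
    exact mul_right_cancel₀ hc h1
  have hT' : ∀ s hs, R' (dT s hs) = Matrix.diagonal fun i => C (s i : k) := by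
    intro s hs
    change Y⁻¹.1 * R _ * Y.1 = _
    rw [mul_assoc, hYT, Units.inv_mul_cancel_left]
  obtain ⟨r, hr⟩ := IsCyclic.exists_generator (α := kˣ)
  have hord : orderOf r = Fintype.card k - 1 := by
    rw [orderOf_eq_card_of_forall_mem_zpowers hr, Nat.card_eq_fintype_card, Fintype.card_units]
  have hr2 : r ^ 2 ≠ 1 := fun h => by
    have := orderOf_le_of_pow_eq_one (by norm_num) h
    omega
  have hr3 : r ^ 3 ≠ 1 := fun h => by
    have := orderOf_le_of_pow_eq_one (by norm_num) h
    omega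
  obtain ⟨d, hd, hd2⟩ := step3b R' hR' hT' hn hr2 hr3
  have hdu : IsUnit (Matrix.diagonal d) := by
    rw [Matrix.isUnit_iff_isUnit_det, Matrix.det_diagonal]
    apply hu
    rw [map_prod]; simp [hd]
  refine ⟨Y * hdu.unit, fun h => ?_⟩
  rw [Units.val_mul, IsUnit.unit_spec, ← mul_assoc, ← hYR, mul_assoc, hd2, mul_assoc]
end

section
variable {Fq n}

lemma mem_map_cj {Γ : Subgroup (SG Fq n)} {w : GF Fq n} {g : SG Fq n} :
    g ∈ Γ.map (cj w).toMonoidHom ↔ cj w⁻¹ g ∈ Γ := by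
  constructor
  · rintro ⟨x, hx, rfl⟩
    have : cj w⁻¹ (cj w x) ∈ Γ := by rw [cj_inv_cj]; exact hx
    exact this
  · intro h
    exact ⟨_, h, cj_cj_inv w g⟩

lemma FB_map {Γ : Subgroup (SG Fq n)} (hΓ : FB Γ) (w : GF Fq n) : FB (Γ.map (cj w).toMonoidHom) := by
  intro z m
  refine Set.Finite.subset ((hΓ (w⁻¹ * z) m).image (cj w)) fun g hg => ?_
  refine ⟨cj w⁻¹ g, ⟨mem_map_cj.1 hg.1, fun i j => ?_⟩, cj_cj_inv w g⟩
  rw [_root_.mul_inv_rev, inv_inv, cj_mul, cj_cj_inv]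
  exact hg.2 i j

lemma cj_K1 {w : GF Fq n} (hw : ∀ i j, V 0 (w.1 i j)) (hw' : ∀ i j, V 0 (w⁻¹.1 i j)) {g : SG Fq n}
    (hg : g ∈ K1 Fq n) : cj w g ∈ K1 Fq n := by
  rw [mem_K1] at hg ⊢
  intro i j
  have : (cj w g).1 - 1 = w.1 * (g.1 - 1) * w⁻¹.1 := by
    rw [cj_coe, mul_sub, sub_mul, mul_one, Units.mul_inv]
  rw [this]
  exact V_matmul (V_matmul hw hg) hw' i j

lemma cj_KK {w : GF Fq n} (hw : ∀ i j, V 0 (w.1 i j)) (hw' : ∀ i j, V 0 (w⁻¹.1 i j)) {g : SG Fq n}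
    (hg : g ∈ KK Fq n) : cj w g ∈ KK Fq n := by
  rw [mem_KK] at hg ⊢
  intro i j
  exact V_matmul (V_matmul hw hg) hw' i j

lemma step3 (hn : 3 ≤ n) (hq : 7 ≤ Fintype.card Fq) {Γ : Subgroup (SG Fq n)} (hΓ : FB Γ)
    (hM : Nat.card (SpecialLinearGroup (Fin n) Fq) < 2 * Nat.card (stab Γ 1))
    (hK1 : ∀ g ∈ Γ, g ∈ K1 Fq n → g = 1) :
    ∃ w : GF Fq n, (∀ h, cS h ∈ Γ.map (cj w).toMonoidHom) ∧
      (∀ g ∈ Γ.map (cj w).toMonoidHom, g ∈ K1 Fq n → g = 1) ∧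
      (∀ g ∈ Γ.map (cj w).toMonoidHom, g ∈ KK Fq n → ∃ h, cS h = g) := by
  let H : Subgroup (SO Fq n) := Γ.comap ιK
  let f : H →* SpecialLinearGroup (Fin n) Fq := red.comp H.subtype
  have hfi : Function.Injective f := by
    rw [injective_iff_map_eq_one]
    rintro ⟨h, hh⟩ h1
    have h1 : red h = 1 := h1
    have h2 := hK1 _ (Subgroup.mem_comap.1 hh) (ιK_mem_K1.2 h1)
    exact Subtype.ext (ιK_inj (h2.trans (map_one ιK).symm))
  haveI : Finite H := Finite.of_injective _ hfi
  have hcard : Nat.card (stab Γ 1) ≤ Nat.card H := by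
    have hex : ∀ g : stab Γ (1 : GF Fq n), ∃ h : H, ιK h.1 = g.1 := by
      intro g
      obtain ⟨h1, h2⟩ := mem_stab.1 g.2
      rw [inv_one, cj_one] at h2
      obtain ⟨h, hh⟩ := h2
      exact ⟨⟨h, Subgroup.mem_comap.2 (by rw [hh]; exact h1)⟩, hh⟩
    choose e he using hex
    refine Nat.card_le_card_of_injective e fun a b hab => ?_
    apply Subtype.ext
    rw [← he, ← he, hab]
  have hrange : f.range = ⊤ := by
    by_contra hne
    have h2 : 2 ≤ f.range.index := by
      have h0 : f.range.index ≠ 0 := Subgroup.index_ne_zero_of_finite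
      have h1 : f.range.index ≠ 1 := fun h => hne (Subgroup.index_eq_one.1 h)
      omega
    have h3 := f.range.card_mul_index
    have h4 : Nat.card f.range = Nat.card H :=
      (Nat.card_congr (MonoidHom.ofInjective hfi).toEquiv).symm
    rw [h4] at h3
    nlinarith
  let e : H ≃* SpecialLinearGroup (Fin n) Fq :=
    MulEquiv.ofBijective f ⟨hfi, MonoidHom.range_eq_top.1 hrange⟩
  have he : ∀ h, red (e.symm h).1 = h := fun h => e.apply_symm_apply h
  let R : SpecialLinearGroup (Fin n) Fq →* Matrix (Fin n) (Fin n) (PowerSeries Fq) :=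
    { toFun := fun h => (e.symm h).1.1
      map_one' := by rw [map_one]; rfl
      map_mul' := fun a b => by rw [map_mul]; rfl }
  obtain ⟨Z, hZ⟩ := step3c (C := PowerSeries.C) (ε := PowerSeries.constantCoeff)
    (fun a ha => by rw [PowerSeries.isUnit_iff_constantCoeff]; exact isUnit_iff_ne_zero.2 ha)
    (fun a => by simp) hn hq R (fun h i j => by
      change PowerSeries.constantCoeff ((e.symm h).1.1 i j) = _
      rw [← red_apply, he])
  let z : GF Fq n := Units.map (ofO.mapMatrix : _ →+* MF Fq n).toMonoidHom Z
  have hz : ∀ i j, V 0 (z.1 i j) := fun i j => V_ofPowerSeries _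
  have hz' : ∀ i j, V 0 (z⁻¹.1 i j) := fun i j => V_ofPowerSeries _
  have hcj : ∀ h, cj z (cS h) = ιK (e.symm h).1 := by
    intro h
    apply Subtype.ext
    rw [cj_coe]
    have h1 := congrArg (ofO.mapMatrix : _ →+* MF Fq n) (hZ h)
    rw [map_mul, map_mul] at h1
    have h2 : (ofO.mapMatrix : _ →+* MF Fq n) ((h.1).map PowerSeries.C) = (cS h).1 := by
      ext1 i j
      exact HahnSeries.ofPowerSeries_C (Γ := ℤ) _
    rw [h2] at h1
    change (ιK (e.symm h).1).1 * z.1 = z.1 * (cS h).1 at h1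
    rw [← h1, mul_assoc, Units.mul_inv, mul_one]
  refine ⟨z⁻¹, ?_, ?_, ?_⟩
  · intro h
    rw [mem_map_cj, inv_inv, hcj]
    exact Subgroup.mem_comap.1 (e.symm h).2
  · intro g hg hg1
    rw [mem_map_cj, inv_inv] at hg
    have := hK1 _ hg (cj_K1 hz hz' hg1)
    rw [← cj_inv_cj z g, this, map_one]
  · intro g hg hg1
    rw [mem_map_cj, inv_inv] at hg
    obtain ⟨k, hk⟩ := cj_KK hz hz' hg1
    have hkH : k ∈ H := Subgroup.mem_comap.2 (by rw [hk]; exact hg)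
    refine ⟨e ⟨k, hkH⟩, ?_⟩
    rw [← cj_inv_cj z g, ← hk, ← cj_inv_cj z (cS _), hcj]
    rw [e.symm_apply_apply]

/-- the algebraic part of the theorem -/
lemma algMain (hn : 3 ≤ n) {p : ℕ} (hp : p.Prime) [CharP Fq p] (hq : 7 ≤ Fintype.card Fq)
    {Γ : Subgroup (SG Fq n)} (hΓ : FB Γ)
    (hM : ∀ z : GF Fq n, Nat.card (SpecialLinearGroup (Fin n) Fq) < 2 * Nat.card (stab Γ z)) :
    ∃ φ : SG Fq n ≃* SG Fq n, Continuous φ ∧ Continuous φ.symm ∧ Γ.map φ.toMonoidHom = SLpoly Fq n := by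
  obtain ⟨x, hx⟩ := KM (by omega) hp hΓ
  have hM' : ∀ (Γ : Subgroup (SG Fq n)) (w : GF Fq n),
      (∀ z : GF Fq n, Nat.card (SpecialLinearGroup (Fin n) Fq) < 2 * Nat.card (stab Γ z)) →
      ∀ z, Nat.card (SpecialLinearGroup (Fin n) Fq) < 2 * Nat.card (stab (Γ.map (cj w).toMonoidHom) z) := by
    intro Γ w h z
    rw [stab_map]; exact h _
  have hM1 := hM' Γ x⁻¹ hM
  obtain ⟨w, hC, hK1, hKK⟩ := step3 hn hq (FB_map hΓ x⁻¹) (hM1 1) (by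
    intro g hg hg1
    rw [mem_map_cj, inv_inv] at hg
    have := hx _ hg (by rw [cj_inv_cj]; exact hg1)
    rw [← cj_inv_cj x g, this, map_one])
  obtain ⟨φ, h1, h2, h3⟩ := step4 hn hp (FB_map (FB_map hΓ x⁻¹) w) hC (hM' _ w hM1) hK1 hKK
  refine ⟨((cj x⁻¹).trans (cj w)).trans φ, ?_, ?_, ?_⟩
  · exact h1.comp ((continuous_cj w).comp (continuous_cj x⁻¹))
  · have : (((cj x⁻¹).trans (cj w)).trans φ).symm = (φ.symm.trans (cj w⁻¹)).trans (cj x) := by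
      ext1 g
      rw [MulEquiv.symm_apply_eq]
      simp only [MulEquiv.trans_apply]
      rw [cj_inv_cj, cj_cj_inv, MulEquiv.apply_symm_apply]
    rw [this]
    exact (continuous_cj x).comp ((continuous_cj w⁻¹).comp h2)
  · rw [← h3, Subgroup.map_map, Subgroup.map_map]; rfl
end

section
open scoped Pointwise

lemma FD_lint {G : Type*} [Group G] [TopologicalSpace G] [IsTopologicalGroup G] [MeasurableSpace G]
    [BorelSpace G] [SecondCountableTopology G] (μ : Measure G) [μ.IsMulLeftInvariant]
    (Γ : Subgroup G) [Countable Γ] {s A : Set G} (hs : IsFundamentalDomain Γ s μ)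
    (hA : MeasurableSet A) :
    μ A = ∫⁻ x in s, (({g : Γ | x ∈ g • A}.encard : ℕ∞) : ℝ≥0∞) ∂μ := by
  have h1 : ∀ x : G, (({g : Γ | x ∈ g • A}.encard : ℕ∞) : ℝ≥0∞) =
      ∑' g : Γ, (g • A).indicator (fun _ => (1 : ℝ≥0∞)) x := by
    intro x
    rw [← ENNReal.tsum_set_one]
    exact tsum_subtype {g : Γ | x ∈ g • A} (fun _ => (1 : ℝ≥0∞))
  simp_rw [h1]
  have hm : ∀ g : Γ, MeasurableSet (g • A) := fun g => hA.const_smul g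
  rw [lintegral_tsum fun g => (measurable_const.indicator (hm g)).aemeasurable, hs.measure_eq_tsum]
  refine tsum_congr fun g => ?_
  rw [lintegral_indicator_const (hm g), one_mul, Measure.restrict_apply (hm g)]

lemma FD_le {G : Type*} [Group G] [TopologicalSpace G] [IsTopologicalGroup G] [MeasurableSpace G]
    [BorelSpace G] [SecondCountableTopology G] (μ : Measure G) [μ.IsMulLeftInvariant]
    (Γ : Subgroup G) [Countable Γ] {s A : Set G} (hs : IsFundamentalDomain Γ s μ)
    (hA : MeasurableSet A) (N : ℕ) (h : ∀ x, {g : Γ | x ∈ g • A}.encard ≤ N) :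
    μ A ≤ N * μ s := by
  rw [FD_lint μ Γ hs hA]
  calc _ ≤ ∫⁻ x in s, (N : ℝ≥0∞) ∂μ := lintegral_mono fun x => by
        have := ENat.toENNReal_mono (h x)
        simpa using this
    _ = _ := by simp

lemma FD_ge {G : Type*} [Group G] [TopologicalSpace G] [IsTopologicalGroup G] [MeasurableSpace G]
    [BorelSpace G] [SecondCountableTopology G] (μ : Measure G) [μ.IsMulLeftInvariant]
    (Γ : Subgroup G) [Countable Γ] {s A : Set G} (hs : IsFundamentalDomain Γ s μ)
    (hA : MeasurableSet A) (N : ℕ)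
    (h : ∀ x ∈ ⋃ g : Γ, g • A, (N : ℕ∞) ≤ {g : Γ | x ∈ g • A}.encard) :
    N * μ (s ∩ ⋃ g : Γ, g • A) ≤ μ A := by
  have hm : MeasurableSet (⋃ g : Γ, g • A) := MeasurableSet.iUnion fun g => hA.const_smul g
  rw [FD_lint μ Γ hs hA]
  calc _ = ∫⁻ x in s, (⋃ g : Γ, g • A).indicator (fun _ => (N : ℝ≥0∞)) x ∂μ := by
        rw [lintegral_indicator_const hm, Measure.restrict_apply hm, Set.inter_comm]
    _ ≤ _ := lintegral_mono fun x => by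
        by_cases hx : x ∈ ⋃ g : Γ, g • A
        · rw [Set.indicator_of_mem hx]
          have := ENat.toENNReal_mono (h x hx)
          simpa using this
        · rw [Set.indicator_of_notMem hx]; exact zero_le

lemma mem_smul2 {G : Type*} [Group G] {Γ : Subgroup G} {g : Γ} {w x : G} {B : Set G} :
    x ∈ g • w • B ↔ w⁻¹ * (g : G)⁻¹ * x ∈ B := by
  rw [Set.mem_smul_set_iff_inv_smul_mem, Set.mem_smul_set_iff_inv_smul_mem]
  rw [mul_assoc]; rfl

lemma FD_le2 {G : Type*} [Group G] [TopologicalSpace G] [IsTopologicalGroup G] [MeasurableSpace G]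
    [BorelSpace G] [SecondCountableTopology G] (μ : Measure G) [μ.IsMulLeftInvariant]
    (Γ : Subgroup G) [Countable Γ] {s : Set G} (hs : IsFundamentalDomain Γ s μ)
    (B : Subgroup G) (hBo : IsOpen (B : Set G)) (H : Subgroup G) [Finite H] (w : G)
    (h : ∀ g ∈ Γ, w⁻¹ * g * w ∈ B → g ∈ H) : μ (B : Set G) ≤ Nat.card H * μ s := by
  have hw : μ (w • (B : Set G)) = μ (B : Set G) := measure_smul μ w _
  rw [← hw]
  refine FD_le μ Γ hs (hBo.measurableSet.const_smul w) _ fun x => ?_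
  rcases Set.eq_empty_or_nonempty {g : Γ | x ∈ g • w • (B : Set G)} with he | ⟨g0, hg0⟩
  · rw [he]; simp
  have key : ∀ g : Γ, x ∈ g • w • (B : Set G) → (g : G)⁻¹ * g0 ∈ H := by
    intro g hg
    refine h _ (mul_mem (inv_mem g.2) g0.2) ?_
    have h1 := mem_smul2.1 hg
    have h2 := mem_smul2.1 hg0
    have h3 := mul_mem h1 (inv_mem h2)
    have : w⁻¹ * ((g : G)⁻¹ * g0) * w = w⁻¹ * (g : G)⁻¹ * x * (w⁻¹ * (g0 : G)⁻¹ * x)⁻¹ := by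
      simp only [_root_.mul_inv_rev, inv_inv, mul_assoc, mul_inv_cancel_left]
    rw [this]; exact h3
  have h5 : (H : Set G).encard = (Nat.card H : ℕ∞) := ENat.card_eq_coe_natCard _
  rw [← h5]
  refine Set.encard_le_encard_of_injOn (f := fun g : Γ => (g : G)⁻¹ * g0) (fun g hg => key g hg) ?_
  intro a _ b _ hab
  exact Subtype.ext (inv_injective (mul_right_cancel hab))

/-- Upper bound for a domain, covering by translates of an open subgroup. -/
lemma FD_ge2 {G : Type*} [Group G] [TopologicalSpace G] [IsTopologicalGroup G] [MeasurableSpace G]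
    [BorelSpace G] [SecondCountableTopology G] (μ : Measure G) [μ.IsMulLeftInvariant]
    (Γ : Subgroup G) [Countable Γ] {s : Set G} (hs : IsFundamentalDomain Γ s μ)
    (B : Subgroup G) (hBo : IsOpen (B : Set G)) {ι : Type*} [Countable ι] (y : ι → G)
    (H : ι → Subgroup G) [∀ i, Finite (H i)] (hH : ∀ i, ∀ g ∈ H i, g ∈ Γ ∧ (y i)⁻¹ * g * y i ∈ B)
    (hcov : ∀ x : G, ∃ g ∈ Γ, ∃ i, ∃ b ∈ B, x = g * y i * b) :
    μ s ≤ ∑' i, μ (B : Set G) / Nat.card (H i) := by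
  have h1 : s ⊆ ⋃ i, (s ∩ ⋃ g : Γ, g • y i • (B : Set G)) := by
    intro x hx
    obtain ⟨g, hg, i, b, hb, rfl⟩ := hcov x
    refine Set.mem_iUnion.2 ⟨i, hx, Set.mem_iUnion.2 ⟨⟨g, hg⟩, mem_smul2.2 ?_⟩⟩
    have : (y i)⁻¹ * g⁻¹ * (g * y i * b) = b := by
      simp only [mul_assoc, inv_mul_cancel_left]
    rw [SetLike.mem_coe, this]; exact hb
  refine (measure_mono h1).trans ((measure_iUnion_le _).trans (ENNReal.tsum_le_tsum fun i => ?_))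
  rw [ENNReal.le_div_iff_mul_le (Or.inl (by exact_mod_cast Nat.card_pos.ne')) (Or.inl (by simp)), mul_comm,
    ← measure_smul μ (y i) (B : Set G)]
  refine FD_ge μ Γ hs (hBo.measurableSet.const_smul (y i)) _ fun x hx => ?_
  obtain ⟨g0, hg0⟩ := Set.mem_iUnion.1 hx
  have h5 : (H i : Set G).encard = (Nat.card (H i) : ℕ∞) := ENat.card_eq_coe_natCard _
  rw [← h5]
  have hg1 := mem_smul2.1 hg0
  have h6 : (H i : Set G).encard = (Set.univ : Set (H i)).encard := by
    rw [Set.encard_univ]; rfl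
  rw [h6]
  refine Set.encard_le_encard_of_injOn (f := fun h : H i => g0 * ⟨h, (hH i h h.2).1⟩)
    (fun h _ => ?_) ?_
  · refine mem_smul2.2 ?_
    have h7 := mul_mem (inv_mem (hH i h h.2).2) hg1
    have : ((y i)⁻¹ * (h : G) * y i)⁻¹ * ((y i)⁻¹ * (g0 : G)⁻¹ * x) =
      (y i)⁻¹ * ((g0 * (⟨h, (hH i h h.2).1⟩ : Γ) : Γ) : G)⁻¹ * x := by
      simp only [Subgroup.coe_mul, _root_.mul_inv_rev, inv_inv, mul_assoc, mul_inv_cancel_left]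
    exact this ▸ h7
  · intro a _ b _ hab
    exact Subtype.ext (congrArg (fun t : Γ => (t : G)) (mul_left_cancel hab))

lemma exists_FD {G : Type*} [Group G] [TopologicalSpace G] [IsTopologicalGroup G] [MeasurableSpace G]
    [BorelSpace G] [SecondCountableTopology G] (μ : Measure G)
    (Γ : Subgroup G) [Countable Γ] (B : Subgroup G) (hBo : IsOpen (B : Set G))
    (hB : ∀ g ∈ Γ, g ∈ B → g = 1) : ∃ t : Set G, IsFundamentalDomain Γ t μ := by
  classical
  let z : ℕ → G := TopologicalSpace.denseSeq G
  let U : ℕ → Set G := fun i => {x | ∃ g ∈ Γ, g * x * (z i)⁻¹ ∈ B}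
  have hopen : ∀ (g : G) (i : ℕ), IsOpen {x : G | g * x * (z i)⁻¹ ∈ B} := fun g i =>
    hBo.preimage (by fun_prop : Continuous fun x : G => g * x * (z i)⁻¹)
  have hU : ∀ i, IsOpen (U i) := by
    intro i
    have : U i = ⋃ g ∈ Γ, {x : G | g * x * (z i)⁻¹ ∈ B} := by
      ext x; simp [U]
    rw [this]
    exact isOpen_biUnion fun g _ => hopen g i
  have hUinv : ∀ i, ∀ g ∈ Γ, ∀ x, g * x ∈ U i ↔ x ∈ U i := by
    intro i g hg x
    constructor
    · rintro ⟨a, ha, h⟩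
      exact ⟨a * g, mul_mem ha hg, by rwa [mul_assoc a g x]⟩
    · rintro ⟨a, ha, h⟩
      exact ⟨a * g⁻¹, mul_mem ha (inv_mem hg), by rwa [mul_assoc a, inv_mul_cancel_left]⟩
  have hcov : ∀ x : G, ∃ i, x ∈ U i := by
    intro x
    have ho : IsOpen {y : G | x * y⁻¹ ∈ B} :=
      hBo.preimage (by fun_prop : Continuous fun y : G => x * y⁻¹)
    obtain ⟨i, hi⟩ := (TopologicalSpace.denseRange_denseSeq G).exists_mem_open ho
      ⟨x, by simp [B.one_mem]⟩
    exact ⟨i, 1, Γ.one_mem, by rw [one_mul]; exact hi⟩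
  refine ⟨⋃ i, ({x : G | 1 * x * (z i)⁻¹ ∈ B} ∩ ⋂ j ∈ Finset.range i, (U j)ᶜ),
    IsFundamentalDomain.mk' ?_ fun x => ?_⟩
  · refine (MeasurableSet.iUnion fun i => (hopen 1 i).measurableSet.inter ?_).nullMeasurableSet
    exact Finset.measurableSet_biInter _ fun j _ => (hU j).measurableSet.compl
  · have hmem : ∀ y : G, (y ∈ ⋃ i, ({x : G | 1 * x * (z i)⁻¹ ∈ B} ∩ ⋂ j ∈ Finset.range i, (U j)ᶜ)) ↔
        ∃ i, y * (z i)⁻¹ ∈ B ∧ ∀ j < i, y ∉ U j := by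
      intro y; simp
    obtain ⟨g, hg, hgx⟩ := Nat.find_spec (hcov x)
    have hminx : ∀ j < Nat.find (hcov x), x ∉ U j := fun j hj => Nat.find_min (hcov x) hj
    refine ⟨⟨g, hg⟩, (hmem _).2 ⟨_, hgx, fun j hj => ?_⟩, ?_⟩
    · intro hc
      exact hminx j hj ((hUinv j g hg x).1 hc)
    · rintro ⟨g', hg'⟩ h'
      obtain ⟨i, hi, hi'⟩ := (hmem _).1 h'
      replace hi : g' * x * (z i)⁻¹ ∈ B := hi
      have hii : i = Nat.find (hcov x) := by
        refine le_antisymm ?_ (Nat.find_min' (hcov x) ⟨g', hg', hi⟩)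
        by_contra hlt
        exact hi' _ (not_le.1 hlt) ((hUinv _ g' hg' x).2 (Nat.find_spec (hcov x)))
      rw [hii] at hi
      have h3 := mul_mem hi (inv_mem hgx)
      have h4 : g' * x * (z (Nat.find (hcov x)))⁻¹ * (g * x * (z (Nat.find (hcov x)))⁻¹)⁻¹ = g' * g⁻¹ := by
        simp only [_root_.mul_inv_rev, inv_inv, mul_assoc, mul_inv_cancel_left, inv_mul_cancel_left]
      rw [h4] at h3
      exact Subtype.ext (mul_inv_eq_one.1 (hB _ (mul_mem hg' (inv_mem hg)) h3))
end

section
variable {Fq n}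
open scoped Pointwise

lemma inv_tr (g : SG Fq n) : (g.transpose)⁻¹ = (g⁻¹).transpose := by
  apply Subtype.ext
  rw [Matrix.SpecialLinearGroup.coe_inv, Matrix.SpecialLinearGroup.coe_transpose,
    Matrix.SpecialLinearGroup.coe_transpose, Matrix.SpecialLinearGroup.coe_inv,
    Matrix.adjugate_transpose]

lemma tr_tr (g : SG Fq n) : (g.transpose).transpose = g := by
  apply Subtype.ext
  rw [Matrix.SpecialLinearGroup.coe_transpose, Matrix.SpecialLinearGroup.coe_transpose,
    Matrix.transpose_transpose]

/-- inverse transpose -/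
def itr : SG Fq n ≃* SG Fq n where
  toFun g := (g⁻¹).transpose
  invFun g := (g⁻¹).transpose
  left_inv g := by
    change (((g⁻¹).transpose)⁻¹).transpose = g
    rw [inv_tr, inv_inv, tr_tr]
  right_inv g := by
    change (((g⁻¹).transpose)⁻¹).transpose = g
    rw [inv_tr, inv_inv, tr_tr]
  map_mul' g h := by
    apply Subtype.ext
    simp only [_root_.mul_inv_rev, Matrix.SpecialLinearGroup.coe_mul, Matrix.SpecialLinearGroup.coe_transpose, Matrix.transpose_mul]

lemma itr_apply (g : SG Fq n) : itr g = (g⁻¹).transpose := rfl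

lemma continuous_itr : Continuous (itr : SG Fq n → SG Fq n) := by
  refine continuous_SG fun i j => ?_
  exact (continuous_entry j i).comp continuous_inv

lemma itr_KK {g : SG Fq n} : itr g ∈ KK Fq n ↔ g ∈ KK Fq n := by
  have h : ∀ g : SG Fq n, g ∈ KK Fq n → itr g ∈ KK Fq n := fun g hg =>
    mem_KK.2 fun i j => mem_KK.1 (inv_mem hg) j i
  refine ⟨fun hg => ?_, h g⟩
  have := h _ hg
  rwa [show itr (itr g) = g from itr.left_inv g] at this

lemma cj_itr_cj {D : GF Fq n} (hD : D.1ᵀ = D.1) (g : SG Fq n) : cj D (itr (cj D g)) = itr g := by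
  have hD' : (D⁻¹).1ᵀ = (D⁻¹).1 := by
    rw [Matrix.coe_units_inv, Matrix.transpose_nonsing_inv, hD]
  have h1 : D.1 * D⁻¹.1 = 1 := D.mul_inv
  rw [itr_apply, ← map_inv, itr_apply]
  apply Subtype.ext
  rw [cj_coe, Matrix.SpecialLinearGroup.coe_transpose, cj_coe, Matrix.transpose_mul,
    Matrix.transpose_mul, hD, hD', Matrix.SpecialLinearGroup.coe_transpose]
  rw [← mul_assoc, h1, one_mul, mul_assoc, h1, mul_one]

lemma measure_cj (μ : Measure (SG Fq n)) (hμ : μ.IsHaarMeasure) {D : GF Fq n} (hD : D.1ᵀ = D.1) :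
    μ (cj D⁻¹ ⁻¹' (KK Fq n : Set (SG Fq n))) = μ (KK Fq n : Set (SG Fq n)) := by
  set θ : SG Fq n ≃* SG Fq n := itr.trans (cj D) with hθ
  have hθa : ∀ g, θ g = cj D (itr g) := fun g => rfl
  have hθθ : ∀ g, θ (θ g) = g := by
    intro g
    rw [hθa, hθa, cj_itr_cj hD]; exact itr.left_inv g
  have hc : Continuous θ := (continuous_cj D).comp continuous_itr
  have hsymm : ∀ g, θ.symm g = θ g := fun g => by rw [MulEquiv.symm_apply_eq, hθθ]
  have hc' : Continuous θ.symm := by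
    have : (θ.symm : SG Fq n → SG Fq n) = θ := funext hsymm
    rw [this]; exact hc
  have hH : (Measure.map θ μ).IsHaarMeasure := MulEquiv.isHaarMeasure_map μ θ hc hc'
  have e := Measure.isMulLeftInvariant_eq_smul (Measure.map θ μ) μ
  set c := (Measure.map θ μ).haarScalarFactor μ
  have e2 : Measure.map θ (Measure.map θ μ) = μ := by
    rw [Measure.map_map hc.measurable hc.measurable]
    have : (θ ∘ θ : SG Fq n → SG Fq n) = id := funext hθθ
    rw [this, Measure.map_id]
  have hKo : IsOpen (KK Fq n : Set (SG Fq n)) := isOpen_KK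
  have hK0 : μ (KK Fq n : Set (SG Fq n)) ≠ 0 :=
    (hKo.measure_pos μ ⟨1, (KK Fq n).one_mem⟩).ne'
  have hKt : μ (KK Fq n : Set (SG Fq n)) ≠ ⊤ := isCompact_KK.measure_lt_top.ne
  have e3 : (c : ℝ≥0∞) * (c * μ (KK Fq n : Set (SG Fq n))) = μ (KK Fq n : Set (SG Fq n)) := by
    have : Measure.map θ (Measure.map θ μ) = c • (c • μ) := by
      conv_lhs => rw [e]
      rw [Measure.map_smul, e]
    rw [e2] at this
    conv_rhs => rw [this]
    rw [Measure.coe_nnreal_smul_apply, Measure.coe_nnreal_smul_apply]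
  have hc1 : (c : ℝ≥0∞) = 1 := by
    rw [← mul_assoc] at e3
    have h4 : (c : ℝ≥0∞) * c = 1 := by
      have := ENNReal.mul_right_inj hK0 hKt (b := (c : ℝ≥0∞) * c) (c := 1)
      apply this.1
      rw [mul_one, mul_comm]; exact e3
    have h5 : c * c = 1 := by exact_mod_cast h4
    have h6 : c = 1 := by
      rw [← sq] at h5
      exact (pow_eq_one_iff_of_nonneg zero_le (by norm_num)).1 h5
    rw [h6]; rfl
  have e4 : μ (θ ⁻¹' (KK Fq n : Set (SG Fq n))) = μ (KK Fq n : Set (SG Fq n)) := by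
    rw [← Measure.map_apply hc.measurable hKo.measurableSet, e]
    have : (c • μ) (KK Fq n : Set (SG Fq n)) = (c : ℝ≥0∞) * μ (KK Fq n : Set (SG Fq n)) :=
      Measure.coe_nnreal_smul_apply _ _ _
    rw [this, hc1, one_mul]
  rw [← e4]
  congr 1
  ext g
  simp only [Set.mem_preimage, SetLike.mem_coe]
  rw [← itr_KK, ← hsymm g]
  have : itr (cj D⁻¹ g) = θ.symm g := by
    rw [hsymm, hθa]
    rw [← cj_itr_cj hD, cj_cj_inv]
  rw [this]

lemma countable_of_discrete (Γ : Subgroup (SG Fq n)) (hΓ : DiscreteTopology Γ) : Countable Γ := by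
  exact TopologicalSpace.separableSpace_iff_countable.1 inferInstance

lemma exists_SL_mul (hn : 3 ≤ n) (z : GF Fq n) :
    ∃ (w : SG Fq n) (D : GF Fq n), D.1ᵀ = D.1 ∧ z = (w : GF Fq n) * D := by
  let i0 : Fin n := ⟨0, by omega⟩
  let d : Fin n → F Fq := Function.update 1 i0 z.1.det
  have hz : IsUnit z.1.det := (Matrix.isUnit_iff_isUnit_det _).1 z.isUnit
  have hdet : (Matrix.diagonal d).det = z.1.det := by
    rw [Matrix.det_diagonal, Finset.prod_update_of_mem (Finset.mem_univ _)]
    simp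
  let D : GF Fq n := Matrix.GeneralLinearGroup.mk'' (Matrix.diagonal d) (by rw [hdet]; exact hz)
  have hDv : D.1 = Matrix.diagonal d := rfl
  refine ⟨⟨(z * D⁻¹).1, ?_⟩, D, ?_, ?_⟩
  · have h1 : z.1.det = (z * D⁻¹).1.det * D.1.det := by
      rw [← Matrix.det_mul, ← Units.val_mul]
      simp
    rw [hDv, hdet] at h1
    exact (mul_right_cancel₀ hz.ne_zero (by rw [← h1, one_mul])).symm
  · rw [hDv, Matrix.diagonal_transpose]
  · apply Units.ext
    change z.1 = (z * D⁻¹).1 * D.1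
    rw [← Units.val_mul]; simp

lemma M1 (hn : 3 ≤ n) (μ : Measure (SG Fq n)) (hμ : μ.IsHaarMeasure) (Γ : Subgroup (SG Fq n))
    (hΓ : DiscreteTopology Γ) {s : Set (SG Fq n)} (hs : IsFundamentalDomain Γ s μ) (z : GF Fq n) :
    μ (KK Fq n : Set (SG Fq n)) ≤ Nat.card (stab Γ z) * μ s := by
  have := countable_of_discrete Γ hΓ
  obtain ⟨w, D, hD, rfl⟩ := exists_SL_mul hn z
  rw [← measure_cj μ hμ hD]
  have := finite_stab Γ hΓ ((w : GF Fq n) * D)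
  have hBo : IsOpen (((KK Fq n).comap (cj D⁻¹).toMonoidHom : Subgroup (SG Fq n)) : Set (SG Fq n)) :=
    isOpen_KK.preimage (continuous_cj D⁻¹)
  refine FD_le2 μ Γ hs ((KK Fq n).comap (cj D⁻¹).toMonoidHom) hBo
    (stab Γ ((w : GF Fq n) * D)) w fun g hg h => mem_stab.2 ⟨hg, ?_⟩
  have h1 : cj D⁻¹ (w⁻¹ * g * w) ∈ KK Fq n := Subgroup.mem_comap.1 h
  rw [_root_.mul_inv_rev, cj_mul]
  have h4 := cj_SL w⁻¹ g
  rw [map_inv, inv_inv] at h4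
  rw [h4]; exact h1
end

section
variable {Fq n}

/-- dominant cocharacters -/
abbrev DD (n : ℕ) := {m : Fin n → ℤ // Monotone m ∧ ∑ i, m i = 0}

lemma discrete_SLpoly : DiscreteTopology (SLpoly Fq n) := by
  apply discreteTopology_of_isOpen_singleton_one
  have : ({1} : Set (SLpoly Fq n)) = Subtype.val ⁻¹' (K1 Fq n : Set (SG Fq n)) := by
    ext g
    simp only [Set.mem_singleton_iff, Set.mem_preimage, SetLike.mem_coe]
    refine ⟨fun h => h ▸ (K1 Fq n).one_mem, fun h => Subtype.ext (SLpoly_K1 g.2 h)⟩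
  rw [this]
  exact isOpen_K1.preimage continuous_subtype_val

lemma massMain (hn : 3 ≤ n)
    (hsum : ∑' m : DD n, (Nat.card (SpecialLinearGroup (Fin n) Fq) : ℝ≥0∞) /
      Nat.card (stab (SLpoly Fq n) (dg m.1)) < 2)
    (μ : Measure (SG Fq n)) (hμ : μ.IsHaarMeasure) (Γ : Subgroup (SG Fq n))
    (hΓ : IsLattice Fq n μ Γ)
    (hmin : ∀ Λ : Subgroup (SG Fq n), IsLattice Fq n μ Λ → ∀ s t : Set (SG Fq n),
        IsFundamentalDomain Γ s μ → IsFundamentalDomain Λ t μ → μ s ≤ μ t) (z : GF Fq n) :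
    Nat.card (SpecialLinearGroup (Fin n) Fq) < 2 * Nat.card (stab Γ z) := by
  obtain ⟨hΓd, s, hs, hst⟩ := hΓ
  have hd := discrete_SLpoly (Fq := Fq) (n := n)
  have hcΛ := countable_of_discrete _ hd
  obtain ⟨t, ht⟩ := exists_FD μ (SLpoly Fq n) (K1 Fq n) isOpen_K1 (fun g hg h => SLpoly_K1 hg h)
  have hfin : ∀ m : DD n, Finite (stab (SLpoly Fq n) (dg m.1)) := fun m => finite_stab _ hd _
  have hKo : IsOpen (KK Fq n : Set (SG Fq n)) := isOpen_KK
  have hK0 : μ (KK Fq n : Set (SG Fq n)) ≠ 0 :=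
    (hKo.measure_pos μ ⟨1, (KK Fq n).one_mem⟩).ne'
  have hKt : μ (KK Fq n : Set (SG Fq n)) ≠ ⊤ := isCompact_KK.measure_lt_top.ne
  have h1 : μ t ≤ ∑' m : DD n, μ (KK Fq n : Set (SG Fq n)) /
      Nat.card (stab (SLpoly Fq n) (dg m.1)) := by
    refine FD_ge2 μ (SLpoly Fq n) ht (KK Fq n) hKo (fun m : DD n => yS m.1 m.2.2) 
      (fun m => stab (SLpoly Fq n) (dg m.1)) (fun m g hg => ?_) fun x => ?_
    · obtain ⟨h2, h3⟩ := mem_stab.1 hg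
      refine ⟨h2, ?_⟩
      have h4 := cj_SL (yS m.1 m.2.2)⁻¹ g
      rw [map_inv, inv_inv, yS_GL] at h4
      rw [← h4]; exact h3
    · obtain ⟨e, he, m, hm, hmon, k, hk, h⟩ := birk x
      refine ⟨e⁻¹, ?_, ⟨m, hmon, hm⟩, k, hk, ?_⟩
      · rw [SLpoly_eq]; exact inv_mem he
      · rw [mul_assoc, ← h, inv_mul_cancel_left]
  set c : ℝ≥0∞ := (Nat.card (SpecialLinearGroup (Fin n) Fq) : ℝ≥0∞) with hc
  have hc0 : c ≠ 0 := by
    rw [hc]; exact_mod_cast Nat.card_pos.ne'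
  have hct : c ≠ ⊤ := by simp [hc]
  have h2 : c * μ t < 2 * μ (KK Fq n : Set (SG Fq n)) := by
    calc c * μ t ≤ c * ∑' m : DD n, μ (KK Fq n : Set (SG Fq n)) /
          Nat.card (stab (SLpoly Fq n) (dg m.1)) := by gcongr
      _ = (∑' m : DD n, c / Nat.card (stab (SLpoly Fq n) (dg m.1))) *
          μ (KK Fq n : Set (SG Fq n)) := by
          rw [← ENNReal.tsum_mul_left, ← ENNReal.tsum_mul_right]
          refine tsum_congr fun m => ?_
          simp only [div_eq_mul_inv]; ring
      _ < _ := ENNReal.mul_lt_mul_left hK0 hKt hsum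
  have htt : μ t < ⊤ := by
    by_contra h
    rw [not_lt, top_le_iff] at h
    rw [h, ENNReal.mul_top hc0] at h2
    exact absurd h2 (by simp)
  have hle := hmin _ ⟨hd, t, ht, htt⟩ s t hs ht
  have h3 := M1 hn μ hμ Γ hΓd hs z
  have h4 : c * μ (KK Fq n : Set (SG Fq n)) < (2 * Nat.card (stab Γ z) : ℕ) * μ (KK Fq n : Set (SG Fq n)) := by
    have := finite_stab Γ hΓd z
    have hp : (Nat.card (stab Γ z) : ℝ≥0∞) ≠ 0 := by exact_mod_cast Nat.card_pos.ne'
    calc c * μ (KK Fq n : Set (SG Fq n)) ≤ c * (Nat.card (stab Γ z) * μ t) := by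
          gcongr; exact h3.trans (by gcongr)
      _ = (Nat.card (stab Γ z)) * (c * μ t) := by ring
      _ < (Nat.card (stab Γ z)) * (2 * μ (KK Fq n : Set (SG Fq n))) :=
          ENNReal.mul_lt_mul_right hp (by simp) h2
      _ = _ := by push_cast; ring
  have h5 : c < (2 * Nat.card (stab Γ z) : ℕ) := lt_of_mul_lt_mul_right' h4
  have h6 : (Nat.card (SpecialLinearGroup (Fin n) Fq) : ℝ≥0∞) < (2 * Nat.card (stab Γ z) : ℕ) := h5
  exact_mod_cast h6
end

section
variable {Fq n}
open Polynomial

abbrev Gm (Fq : Type) [Field Fq] {n : ℕ} (m : Fin n → ℤ) :=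
  {M : SpecialLinearGroup (Fin n) Fq // ∀ i j, m j < m i → M i j = 0}

abbrev CI {n : ℕ} (m : Fin n → ℤ) := Σ p : Fin n × Fin n, Fin (m p.2 - m p.1).toNat

def uu (m : Fin n → ℤ) (c : CI m → Fq) : Matrix (Fin n) (Fin n) Fq[X] :=
  Matrix.of fun i j => ∑ d : Fin (m j - m i).toNat, monomial ((d : ℕ) + 1) (c ⟨(i, j), d⟩)

lemma uu_apply (m : Fin n → ℤ) (c : CI m → Fq) (i j) : uu m c i j =
    ∑ d : Fin (m j - m i).toNat, monomial ((d : ℕ) + 1) (c ⟨(i, j), d⟩) := rfl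

lemma uu_coeff (m : Fin n → ℤ) (c : CI m → Fq) (i j) (d : Fin (m j - m i).toNat) :
    (uu m c i j).coeff (d + 1) = c ⟨(i, j), d⟩ := by
  rw [uu_apply, finset_sum_coeff, Finset.sum_eq_single d]
  · simp
  · intro b _ hb
    rw [coeff_monomial, if_neg]
    intro h
    exact hb (Fin.ext (by omega))
  · simp

lemma uu_coeff_zero (m : Fin n → ℤ) (c : CI m → Fq) (i j) : (uu m c i j).coeff 0 = 0 := by
  rw [uu_apply, finset_sum_coeff]
  refine Finset.sum_eq_zero fun d _ => ?_
  rw [coeff_monomial, if_neg (by omega)]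

lemma uu_zero (m : Fin n → ℤ) (c : CI m → Fq) (i j) (h : m j ≤ m i) : uu m c i j = 0 := by
  rw [uu_apply]
  have : IsEmpty (Fin (m j - m i).toNat) := by
    rw [Int.toNat_of_nonpos (by omega)]; infer_instance
  rw [Finset.univ_eq_empty, Finset.sum_empty]

lemma uu_V (m : Fin n → ℤ) (c : CI m → Fq) (i j) : V (m i - m j) (polyEmb Fq (uu m c i j)) := by
  rw [uu_apply, map_sum]
  refine V.sum fun d _ => ?_
  rw [polyEmb_monomial]
  refine V_single _ ?_
  have := d.2
  omega

lemma det_uu (m : Fin n → ℤ) (hm : Monotone m) (c : CI m → Fq) : (1 + uu m c).det = 1 := by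
  rw [Matrix.det_of_upperTriangular]
  · refine Finset.prod_eq_one fun i _ => ?_
    rw [Matrix.add_apply, uu_zero m c i i le_rfl, Matrix.one_apply_eq, add_zero]
  · intro i j hij
    rw [Matrix.add_apply, uu_zero m c i j (hm (le_of_lt hij)), Matrix.one_apply_ne (ne_of_gt (show j < i from hij)), add_zero]

lemma polyEmb_injective : Function.Injective (polyEmb Fq) := by
  intro f g h
  ext d
  rw [← polyEmb_coeff, h, polyEmb_coeff]

def PP (m : Fin n → ℤ) (hm : Monotone m) (x : Gm Fq m × (CI m → Fq)) :
    SpecialLinearGroup (Fin n) Fq[X] :=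
  SpecialLinearGroup.map (Polynomial.C : Fq →+* Fq[X]) x.1.1 * ⟨1 + uu m x.2, det_uu m hm x.2⟩

lemma PP_inj (m : Fin n → ℤ) (hm : Monotone m) :
    Function.Injective (PP (Fq := Fq) m hm) := by
  have h0 : ∀ x : Gm Fq m × (CI m → Fq),
      SpecialLinearGroup.map (Polynomial.evalRingHom (0 : Fq)) (PP m hm x) = x.1.1 := by
    intro x
    rw [PP]
    refine (map_mul (SpecialLinearGroup.map (Polynomial.evalRingHom (0 : Fq))) _ _).trans ?_
    have h1 : SpecialLinearGroup.map (Polynomial.evalRingHom (0 : Fq))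
        (⟨1 + uu m x.2, det_uu m hm x.2⟩ : SpecialLinearGroup (Fin n) Fq[X]) = 1 := by
      ext1 i j
      change Polynomial.eval 0 ((1 + uu m x.2) i j) = (1 : Matrix (Fin n) (Fin n) Fq) i j
      rw [← Polynomial.coeff_zero_eq_eval_zero, Matrix.add_apply, Polynomial.coeff_add, uu_coeff_zero,
        add_zero, Matrix.one_apply, Matrix.one_apply]
      split_ifs <;> simp
    rw [h1, mul_one]
    ext1 i j
    change Polynomial.eval 0 (Polynomial.C (x.1.1 i j)) = _
    simp
  intro x y h
  have h1 : x.1 = y.1 := Subtype.ext (by rw [← h0 x, ← h0 y, h])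
  refine Prod.ext h1 ?_
  rw [PP, PP, h1] at h
  have h2 := congrArg (fun M : SpecialLinearGroup (Fin n) Fq[X] => (M : Matrix (Fin n) (Fin n) Fq[X]))
    (mul_left_cancel h)
  have h3 : uu m x.2 = uu m y.2 := add_left_cancel h2
  funext ⟨⟨i, j⟩, d⟩
  rw [← uu_coeff m x.2, ← uu_coeff m y.2, h3]

lemma PP_mem (m : Fin n → ℤ) (hm : Monotone m) (x : Gm Fq m × (CI m → Fq)) :
    SpecialLinearGroup.map (polyEmb Fq) (PP m hm x) ∈ stab (SLpoly Fq n) (dg m) := by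
  refine mem_stab.2 ⟨⟨_, rfl⟩, mem_KK.2 fun i j => ?_⟩
  rw [dg_inv, cj_dg, V_single_mul]
  change V _ (polyEmb Fq (∑ k, Polynomial.C (x.1.1 i k) * (1 + uu m x.2) k j))
  rw [map_sum]
  refine V.sum fun k _ => ?_
  rw [map_mul, polyEmb_C]
  by_cases h : m k < m i
  · rw [x.1.2 i k h, map_zero, zero_mul]; exact V.zero
  · have h1 : V (m k - m j) (polyEmb Fq ((1 + uu m x.2) k j)) := by
      rw [Matrix.add_apply, map_add]
      refine V.add ?_ (uu_V _ _ _ _)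
      rw [Matrix.one_apply]
      split_ifs with hk
      · rw [hk, sub_self, map_one]; exact V_one
      · rw [map_zero]; exact V.zero
    refine ((V_C _).mul h1).mono ?_
    simp only [Pi.neg_apply]
    omega

lemma C1 (m : Fin n → ℤ) (hm : Monotone m) :
    Nat.card (Gm Fq m) * Fintype.card Fq ^ (∑ p : Fin n × Fin n, (m p.2 - m p.1).toNat) ≤
      Nat.card (stab (SLpoly Fq n) (dg m)) := by
  have := finite_stab (SLpoly Fq n) discrete_SLpoly (dg m)
  have h1 : Nat.card (Gm Fq m × (CI m → Fq)) = 
     Nat.card (Gm Fq m) * Fintype.card Fq ^ (∑ p : Fin n × Fin n, (m p.2 - m p.1).toNat) := by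
    rw [Nat.card_prod, Nat.card_fun, Nat.card_eq_fintype_card (α := Fq),
      Nat.card_eq_fintype_card (α := CI m), Fintype.card_sigma]
    simp
  rw [← h1]
  refine Nat.card_le_card_of_injective
    (fun x => (⟨SpecialLinearGroup.map (polyEmb Fq) (PP m hm x), PP_mem m hm x⟩ :
      stab (SLpoly Fq n) (dg m))) fun x y h => PP_inj m hm ?_
  have h2 := congrArg Subtype.val h
  ext1 i j
  have h3 := congrArg (fun M : SG Fq n => M i j) h2
  exact polyEmb_injective h3

end

section
variable {Fq n}

abbrev GLm (Fq : Type) [Field Fq] {n : ℕ} (m : Fin n → ℤ) :=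
  {M : Matrix (Fin n) (Fin n) Fq // M.det ≠ 0 ∧ ∀ i j, m j < m i → M i j = 0}

def sc (i0 : Fin n) (a : Fq) : Matrix (Fin n) (Fin n) Fq := Matrix.diagonal (Function.update 1 i0 a)

lemma det_sc (i0 : Fin n) (a : Fq) : (sc i0 a).det = a := by
  rw [sc, Matrix.det_diagonal, Finset.prod_update_of_mem (Finset.mem_univ _)]
  simp

lemma sc_mul (i0 : Fin n) (a b : Fq) : sc i0 a * sc i0 b = sc i0 (a * b) := by
  rw [sc, sc, sc, Matrix.diagonal_mul_diagonal]
  congr 1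
  funext j
  by_cases h : j = i0
  · subst h; simp
  · simp [h]

lemma sc_one (i0 : Fin n) : sc i0 (1 : Fq) = 1 := by
  rw [sc]
  have : Function.update (1 : Fin n → Fq) i0 1 = 1 := by
    funext j
    by_cases h : j = i0
    · subst h; simp
    · simp [h]
  rw [this]; exact Matrix.diagonal_one

lemma C2 (i0 : Fin n) (m : Fin n → ℤ) :
    Nat.card (GLm Fq m) ≤ (Fintype.card Fq - 1) * Nat.card (Gm Fq m) := by
  classical
  have h1 : Nat.card (Fqˣ × Gm Fq m) = (Fintype.card Fq - 1) * Nat.card (Gm Fq m) := by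
    rw [Nat.card_prod, Nat.card_eq_fintype_card (α := Fqˣ), Fintype.card_units]
  rw [← h1]
  refine Nat.card_le_card_of_injective (fun M : GLm Fq m =>
    ((Units.mk0 M.1.det M.2.1, ⟨⟨M.1 * sc i0 (M.1.det)⁻¹, ?_⟩, ?_⟩) : Fqˣ × Gm Fq m)) ?_
  · rw [Matrix.det_mul, det_sc, mul_inv_cancel₀ M.2.1]
  · intro i j hij
    change (M.1 * sc i0 (M.1.det)⁻¹) i j = 0
    rw [sc, Matrix.mul_diagonal, M.2.2 i j hij, zero_mul]
  · intro M N h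
    have h2 : M.1.det = N.1.det := congrArg (fun x : Fqˣ × Gm Fq m => (x.1 : Fq)) h
    have h3 : M.1 * sc i0 (M.1.det)⁻¹ = N.1 * sc i0 (N.1.det)⁻¹ :=
      congrArg (fun x : Fqˣ × Gm Fq m => (x.2.1 : Matrix (Fin n) (Fin n) Fq)) h
    apply Subtype.ext
    have h4 := congrArg (· * sc i0 (M.1.det)) h3
    simp only [mul_assoc, sc_mul] at h4
    rw [inv_mul_cancel₀ M.2.1, h2, inv_mul_cancel₀ N.2.1, sc_one, mul_one, mul_one] at h4
    exact h4

lemma C4 (i0 : Fin n) :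
    (Fintype.card Fq - 1) * Nat.card (SpecialLinearGroup (Fin n) Fq) ≤ Fintype.card Fq ^ (n * n) := by
  classical
  have h1 : Nat.card (Fqˣ × SpecialLinearGroup (Fin n) Fq) =
      (Fintype.card Fq - 1) * Nat.card (SpecialLinearGroup (Fin n) Fq) := by
    rw [Nat.card_prod, Nat.card_eq_fintype_card (α := Fqˣ), Fintype.card_units]
  have h2 : Nat.card (Fin n → Fin n → Fq) = Fintype.card Fq ^ (n * n) := by
    rw [Nat.card_eq_fintype_card, Fintype.card_fun, Fintype.card_fun, ← pow_mul, Fintype.card_fin]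
  rw [← h1, ← h2]
  refine Nat.card_le_card_of_injective (fun x : Fqˣ × SpecialLinearGroup (Fin n) Fq =>
    ((x.2 : Matrix (Fin n) (Fin n) Fq) * sc i0 (x.1 : Fq) : Matrix (Fin n) (Fin n) Fq)) ?_
  intro x y h
  replace h : (x.2 : Matrix (Fin n) (Fin n) Fq) * sc i0 (x.1 : Fq) = 
    (y.2 : Matrix (Fin n) (Fin n) Fq) * sc i0 (y.1 : Fq) := h
  have h3 : (x.1 : Fq) = y.1 := by
    have := congrArg Matrix.det h
    rwa [Matrix.det_mul, Matrix.det_mul, det_sc, det_sc, x.2.2, y.2.2, one_mul, one_mul] at this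
  refine Prod.ext (Units.ext h3) (Subtype.ext ?_)
  have h4 := congrArg (· * sc i0 ((x.1 : Fq)⁻¹)) h
  simp only [mul_assoc, sc_mul] at h4
  rw [← h3, mul_inv_cancel₀ x.1.ne_zero, sc_one, mul_one, mul_one] at h4
  exact h4

lemma LIcount {W : Type} [AddCommGroup W] [Module Fq W] [Finite W] (r : ℕ) :
    ∀ S : Fin r → Set W, ∏ j : Fin r, (Nat.card (S j) - Fintype.card Fq ^ (j : ℕ)) ≤
      Nat.card {v : Fin r → W // LinearIndependent Fq v ∧ ∀ j, v j ∈ S j} := by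
  induction r with
  | zero =>
    intro S
    rw [Fin.prod_univ_zero]
    have : Nonempty {v : Fin 0 → W // LinearIndependent Fq v ∧ ∀ j, v j ∈ S j} :=
      ⟨⟨fun i => i.elim0, linearIndependent_empty_type, fun j => j.elim0⟩⟩
    exact Nat.card_pos
  | succ r ih =>
    intro S
    classical
    have := Fintype.ofFinite W
    let T := {v : Fin r → W // LinearIndependent Fq v ∧ ∀ j, v j ∈ S j.castSucc}
    have := Fintype.ofFinite T
    have h1 : Nat.card (Σ v : T, {w : W // w ∈ S (Fin.last r) ∧ w ∉ Submodule.span Fq (Set.range v.1)}) ≤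
        Nat.card {v : Fin (r + 1) → W // LinearIndependent Fq v ∧ ∀ j, v j ∈ S j} := by
      refine Nat.card_le_card_of_injective (fun x => ⟨Fin.snoc x.1.1 x.2.1, ?_, ?_⟩) ?_
      · rw [linearIndependent_finSnoc]
        exact ⟨x.1.2.1, x.2.2.2⟩
      · intro j
        refine Fin.lastCases ?_ (fun i => ?_) j
        · rw [Fin.snoc_last]; exact x.2.2.1
        · rw [Fin.snoc_castSucc]; exact x.1.2.2 i
      · rintro ⟨⟨v, hv⟩, ⟨w, hw⟩⟩ ⟨⟨v', hv'⟩, ⟨w', hw'⟩⟩ h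
        have h2 := congrArg Subtype.val h
        obtain ⟨h3, h4⟩ := Fin.snoc_injective2 (α := fun _ => W) h2
        subst h3; subst h4; rfl
    refine le_trans ?_ h1
    rw [Nat.card_sigma, Fin.prod_univ_castSucc]
    have h5 : ∀ v : T, Nat.card (S (Fin.last r)) - Fintype.card Fq ^ r ≤
        Nat.card {w : W // w ∈ S (Fin.last r) ∧ w ∉ Submodule.span Fq (Set.range v.1)} := by
      intro v
      have hsp : Nat.card (Submodule.span Fq (Set.range v.1)) = Fintype.card Fq ^ r := by
        rw [Nat.card_eq_fintype_card, Module.card_eq_pow_finrank (K := Fq),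
          finrank_span_eq_card v.2.1, Fintype.card_fin]
      rw [← hsp]
      have h6 : (S (Fin.last r)).ncard - (Submodule.span Fq (Set.range v.1) : Set W).ncard ≤
        (S (Fin.last r) \ (Submodule.span Fq (Set.range v.1) : Set W)).ncard :=
        Set.le_ncard_diff _ _
      exact h6
    calc _ ≤ Nat.card T * (Nat.card (S (Fin.last r)) - Fintype.card Fq ^ r) := 
          Nat.mul_le_mul_right _ (ih fun j => S j.castSucc)
      _ = ∑ v : T, (Nat.card (S (Fin.last r)) - Fintype.card Fq ^ r) := by
          rw [Finset.sum_const, smul_eq_mul, Finset.card_univ, Nat.card_eq_fintype_card]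
      _ ≤ _ := Finset.sum_le_sum fun v _ => h5 v

def dd (m : Fin n → ℤ) (j : Fin n) : ℕ := Nat.card {i : Fin n // m i ≤ m j}

lemma C3 (m : Fin n → ℤ) :
    ∏ j : Fin n, (Fintype.card Fq ^ dd m j - Fintype.card Fq ^ (j : ℕ)) ≤ Nat.card (GLm Fq m) := by
  classical
  let S : Fin n → Set (Fin n → Fq) := fun j => {v | ∀ i, m j < m i → v i = 0}
  have hS : ∀ j, Fintype.card Fq ^ dd m j ≤ Nat.card (S j) := by
    intro j
    have : Nat.card ({i : Fin n // m i ≤ m j} → Fq) = Fintype.card Fq ^ dd m j := by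
      rw [Nat.card_fun, Nat.card_eq_fintype_card (α := Fq), dd]
    rw [← this]
    refine Nat.card_le_card_of_injective (fun f => (⟨fun i => if h : m i ≤ m j then f ⟨i, h⟩ else 0, ?_⟩ : S j)) ?_
    · intro i hi
      exact dif_neg (not_le.2 hi)
    · intro f g h
      funext ⟨i, hi⟩
      have := congrFun (congrArg Subtype.val h) i
      simpa [hi] using this
  calc _ ≤ ∏ j : Fin n, (Nat.card (S j) - Fintype.card Fq ^ (j : ℕ)) :=
        Finset.prod_le_prod' fun j _ => Nat.sub_le_sub_right (hS j) _
    _ ≤ _ := LIcount n S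
    _ ≤ _ := by
        refine Nat.card_le_card_of_injective (fun v => (⟨(Matrix.of v.1)ᵀ, ?_, ?_⟩ : GLm Fq m)) ?_
        · rw [Matrix.det_transpose]
          have h1 := (Matrix.linearIndependent_rows_iff_isUnit (A := Matrix.of v.1)).1 v.2.1
          exact ((Matrix.isUnit_iff_isUnit_det _).1 h1).ne_zero
        · intro i j hij
          exact v.2.2 j i hij
        · intro v w h
          have h1 := Matrix.transpose_injective (congrArg Subtype.val h)
          exact Subtype.ext h1
end

section
variable {Fq n}

def QQ (m : Fin n → ℤ) : ℕ := ∑ p : Fin n × Fin n, (m p.2 - m p.1 - 1).toNat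

lemma le_dd (m : Fin n → ℤ) (hm : Monotone m) (j : Fin n) : (j : ℕ) + 1 ≤ dd m j := by
  have : Nat.card (Fin (j + 1)) = j + 1 := by simp
  rw [← this, dd]
  refine Nat.card_le_card_of_injective (fun i => (⟨⟨i.1, by omega⟩, hm (Fin.mk_le_of_le_val (by omega))⟩ :
    {i : Fin n // m i ≤ m j})) ?_
  intro a b h
  have := congrArg (fun x : {i : Fin n // m i ≤ m j} => (x.1 : ℕ)) h
  exact Fin.ext this

lemma EQ_eq (m : Fin n → ℤ) : n * n + QQ m = ∑ j, dd m j + ∑ p : Fin n × Fin n, (m p.2 - m p.1).toNat := by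
  have h1 : ∀ p : Fin n × Fin n, 1 + (m p.2 - m p.1 - 1).toNat =
      (if m p.2 ≤ m p.1 then 1 else 0) + (m p.2 - m p.1).toNat := by
    intro p; split_ifs <;> omega
  have h2 : ∑ p : Fin n × Fin n, 1 = n * n := by simp
  have h3 : ∑ p : Fin n × Fin n, (if m p.2 ≤ m p.1 then 1 else 0) = ∑ j, dd m j := by
    rw [Fintype.sum_prod_type]
    refine Finset.sum_congr rfl fun j _ => ?_
    simp only [dd, Nat.card_eq_fintype_card]
    rw [Fintype.card_subtype, Finset.card_filter]
  rw [← h2, ← h3, QQ, ← Finset.sum_add_distrib, ← Finset.sum_add_distrib]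
  exact Finset.sum_congr rfl fun p _ => h1 p

lemma C5 (hn : 3 ≤ n) (m : Fin n → ℤ) (hm : Monotone m) :
    (Nat.card (SpecialLinearGroup (Fin n) Fq) : ℝ) *
      (∏ j : Fin n, (1 - ((Fintype.card Fq : ℝ)⁻¹) ^ (dd m j - j))) * (Fintype.card Fq : ℝ) ^ QQ m ≤
      Nat.card (stab (SLpoly Fq n) (dg m)) := by
  have hq1 : 1 < Fintype.card Fq := Fintype.one_lt_card
  set q := Fintype.card Fq with hq
  let i0 : Fin n := ⟨0, by omega⟩
  have c1 : (Nat.card (Gm Fq m) : ℝ) * (q : ℝ) ^ (∑ p : Fin n × Fin n, (m p.2 - m p.1).toNat) ≤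
      Nat.card (stab (SLpoly Fq n) (dg m)) := by exact_mod_cast C1 m hm
  have hq1' : (1 : ℝ) < q := by exact_mod_cast hq1
  have c2 : (Nat.card (GLm Fq m) : ℝ) ≤ ((q : ℝ) - 1) * Nat.card (Gm Fq m) := by
    have : (Nat.card (GLm Fq m) : ℝ) ≤ ((q - 1 : ℕ) : ℝ) * Nat.card (Gm Fq m) := by
      exact_mod_cast C2 i0 m
    rwa [Nat.cast_sub hq1.le, Nat.cast_one] at this
  have c4 : ((q : ℝ) - 1) * Nat.card (SpecialLinearGroup (Fin n) Fq) ≤ (q : ℝ) ^ (n * n) := by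
    have : ((q - 1 : ℕ) : ℝ) * Nat.card (SpecialLinearGroup (Fin n) Fq) ≤ (q : ℝ) ^ (n * n) := by
      exact_mod_cast C4 (Fq := Fq) i0
    rwa [Nat.cast_sub hq1.le, Nat.cast_one] at this
  set R : ℝ := ∏ j : Fin n, (1 - ((q : ℝ)⁻¹) ^ (dd m j - j)) with hR
  have hR0 : 0 ≤ R := Finset.prod_nonneg fun j _ => by
    have : ((q : ℝ)⁻¹) ^ (dd m j - j) ≤ 1 := pow_le_one₀ (by positivity) (inv_le_one_of_one_le₀ hq1'.le)
    linarith
  have c3 : (q : ℝ) ^ (∑ j, dd m j) * R ≤ Nat.card (GLm Fq m) := by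
    have h1 : ((∏ j : Fin n, (q ^ dd m j - q ^ (j : ℕ)) : ℕ) : ℝ) = (q : ℝ) ^ (∑ j, dd m j) * R := by
      rw [Nat.cast_prod, hR, ← Finset.prod_pow_eq_pow_sum, ← Finset.prod_mul_distrib]
      refine Finset.prod_congr rfl fun j _ => ?_
      have hj : (j : ℕ) ≤ dd m j := by have := le_dd m hm j; omega
      rw [Nat.cast_sub (Nat.pow_le_pow_right (by omega) hj)]
      push_cast
      have h2 : (q : ℝ) ^ dd m j = (q : ℝ) ^ (j : ℕ) * (q : ℝ) ^ (dd m j - j) := by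
        rw [← pow_add]; congr 1; omega
      rw [mul_sub, mul_one, inv_pow]
      congr 1
      rw [h2, mul_assoc, mul_inv_cancel₀ (by positivity), mul_one]
    rw [← h1]; exact_mod_cast C3 (Fq := Fq) m
  have hpos : (0 : ℝ) < (q : ℝ) - 1 := by linarith
  refine le_of_mul_le_mul_left ?_ hpos
  calc ((q : ℝ) - 1) * ((Nat.card (SpecialLinearGroup (Fin n) Fq) : ℝ) * R * (q : ℝ) ^ QQ m)
      = (((q : ℝ) - 1) * (Nat.card (SpecialLinearGroup (Fin n) Fq) : ℝ)) * (R * (q : ℝ) ^ QQ m) := by ring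
    _ ≤ (q : ℝ) ^ (n * n) * (R * (q : ℝ) ^ QQ m) := by gcongr
    _ = (q : ℝ) ^ (n * n + QQ m) * R := by rw [pow_add]; ring
    _ = ((q : ℝ) ^ (∑ j, dd m j) * R) * (q : ℝ) ^ (∑ p : Fin n × Fin n, (m p.2 - m p.1).toNat) := by
        rw [EQ_eq, pow_add]; ring
    _ ≤ (((q : ℝ) - 1) * Nat.card (Gm Fq m)) * (q : ℝ) ^ (∑ p : Fin n × Fin n, (m p.2 - m p.1).toNat) := by
        exact mul_le_mul_of_nonneg_right (c3.trans c2) (by positivity)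
    _ = ((q : ℝ) - 1) * ((Nat.card (Gm Fq m)) * (q : ℝ) ^ (∑ p : Fin n × Fin n, (m p.2 - m p.1).toNat)) := by ring
    _ ≤ _ := by gcongr
end

section
variable {Fq n}

lemma one_sub_sum_le {ι : Type*} (s : Finset ι) (f : ι → ℝ) (h0 : ∀ i ∈ s, 0 ≤ f i)
    (h1 : ∀ i ∈ s, f i ≤ 1) : 1 - ∑ i ∈ s, f i ≤ ∏ i ∈ s, (1 - f i) := by
  classical
  induction s using Finset.induction_on with
  | empty => simp
  | insert a s ha ih =>
    rw [Finset.sum_insert ha, Finset.prod_insert ha]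
    have i1 := ih (fun i hi => h0 i (Finset.mem_insert_of_mem hi)) fun i hi => h1 i (Finset.mem_insert_of_mem hi)
    have a0 := h0 a (Finset.mem_insert_self _ _)
    have a1 := h1 a (Finset.mem_insert_self _ _)
    have s0 : 0 ≤ ∑ i ∈ s, f i := Finset.sum_nonneg fun i hi => h0 i (Finset.mem_insert_of_mem hi)
    nlinarith [mul_le_mul_of_nonneg_left i1 (sub_nonneg.2 a1), mul_nonneg a0 s0]

def ss (m : Fin n → ℤ) : ℕ := ∑ i, (m i).toNat

lemma ss_neg (m : Fin n → ℤ) (h : ∑ i, m i = 0) : ∑ i, (-m i).toNat = ss m := by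
  have h1 : ∑ i, m i = ∑ i, (((m i).toNat : ℤ) - ((-m i).toNat : ℤ)) :=
    Finset.sum_congr rfl fun i _ => by omega
  rw [h, Finset.sum_sub_distrib] at h1
  rw [ss]
  have : ((∑ i, (-m i).toNat : ℕ) : ℤ) = ((∑ i, (m i).toNat : ℕ) : ℤ) := by push_cast; linarith
  exact_mod_cast this

lemma card_ne_le (m : Fin n → ℤ) (h : ∑ i, m i = 0) :
    (Finset.univ.filter fun i => ¬ m i = 0).card ≤ 2 * ss m := by
  have h1 : 2 * ss m = ∑ i, ((m i).toNat + (-m i).toNat) := by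
    rw [Finset.sum_add_distrib, ss_neg m h, ss]; ring
  rw [h1, Finset.card_filter]
  exact Finset.sum_le_sum fun i _ => by split_ifs <;> omega

lemma prodR (m : Fin n → ℤ) (hm : Monotone m) (h : ∑ i, m i = 0) {x : ℝ} (hx0 : 0 ≤ x) (hx : x ≤ 1/7) :
    (5/6 : ℝ) * (6/7) ^ (2 * ss m) ≤ ∏ j : Fin n, (1 - x ^ (dd m j - j)) := by
  rw [← Finset.prod_filter_mul_prod_filter_not Finset.univ (fun i => m i = 0)]
  have hle : ∀ j, x ^ (dd m j - j) ≤ x := by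
    intro j
    have := le_dd m hm j
    calc x ^ (dd m j - j) ≤ x ^ 1 := pow_le_pow_of_le_one hx0 (by linarith) (by omega)
      _ = x := pow_one x
  have hA : (5/6 : ℝ) ≤ ∏ j ∈ Finset.univ.filter (fun i => m i = 0), (1 - x ^ (dd m j - j)) := by
    refine le_trans ?_ (one_sub_sum_le _ _ (fun j _ => by positivity) fun j _ => (hle j).trans (by linarith))
    have hsum : ∑ j ∈ Finset.univ.filter (fun i => m i = 0), x ^ (dd m j - (j : ℕ)) ≤ x * (1 - x)⁻¹ := by
      have h1 : ∀ j ∈ Finset.univ.filter (fun i => m i = 0), x ^ (dd m j - (j : ℕ)) = x * x ^ (dd m j - (j : ℕ) - 1) := by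
        intro j _
        have := le_dd m hm j
        rw [← pow_succ']; congr 1; omega
      rw [Finset.sum_congr rfl h1, ← Finset.mul_sum]
      refine mul_le_mul_of_nonneg_left ?_ hx0
      have h2 : Set.InjOn (fun j : Fin n => dd m j - (j : ℕ) - 1)
          (Finset.univ.filter (fun i => m i = 0) : Finset (Fin n)) := by
        intro a ha b hb hab
        have ha' : m a = 0 := by simpa using ha
        have hb' : m b = 0 := by simpa using hb
        have hd : dd m a = dd m b := by rw [dd, dd, ha', hb']
        have l1 := le_dd m hm a
        have l2 := le_dd m hm b
        replace hab : dd m a - (a : ℕ) - 1 = dd m b - (b : ℕ) - 1 := hab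
        exact Fin.ext (by omega)
      rw [← Finset.sum_image (f := fun t => x ^ t) h2, ← tsum_geometric_of_lt_one hx0 (by linarith)]
      exact (summable_geometric_of_lt_one hx0 (by linarith)).sum_le_tsum _ (fun t _ => by positivity)
    have : x * (1 - x)⁻¹ ≤ 1/6 := by
      rw [← div_eq_mul_inv, div_le_div_iff₀ (by linarith) (by norm_num)]
      linarith
    linarith
  have hB : (6/7 : ℝ) ^ (2 * ss m) ≤ ∏ j ∈ Finset.univ.filter (fun i => ¬ m i = 0), (1 - x ^ (dd m j - j)) := by
    calc (6/7 : ℝ) ^ (2 * ss m) ≤ (6/7) ^ (Finset.univ.filter fun i => ¬ m i = 0).card :=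
          pow_le_pow_of_le_one (by norm_num) (by norm_num) (card_ne_le m h)
      _ = ∏ j ∈ Finset.univ.filter (fun i => ¬ m i = 0), (6/7 : ℝ) := by rw [Finset.prod_const]
      _ ≤ _ := Finset.prod_le_prod (fun _ _ => by norm_num) fun j _ => by
          have := hle j; linarith
  exact mul_le_mul hA hB (by positivity) (le_trans (by norm_num) hA)

lemma QQ_ge (m : Fin n → ℤ) (h : ∑ i, m i = 0) (hs : 1 ≤ ss m) : 2 * ss m ≤ QQ m + 1 := by
  set P := Finset.univ.filter fun i => 0 < m i with hP
  set N := Finset.univ.filter fun i => m i < 0 with hN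
  have sP : ∑ i ∈ P, m i = ss m := by
    rw [ss, hP, Finset.sum_filter]; push_cast
    exact Finset.sum_congr rfl fun i _ => by split_ifs <;> omega
  have sN : ∑ i ∈ N, (-m i) = ss m := by
    rw [← ss_neg m h, hN, Finset.sum_filter]; push_cast
    exact Finset.sum_congr rfl fun i _ => by split_ifs <;> omega
  have a1 : (P.card : ℤ) ≤ ss m := by
    rw [← sP, Finset.cast_card]
    exact Finset.sum_le_sum fun i hi => by have := (Finset.mem_filter.1 hi).2; omega
  have b1 : (N.card : ℤ) ≤ ss m := by
    rw [← sN, Finset.cast_card]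
    exact Finset.sum_le_sum fun i hi => by have := (Finset.mem_filter.1 hi).2; omega
  have a0 : (1 : ℤ) ≤ P.card := by
    rcases P.eq_empty_or_nonempty with he | he
    · rw [he, Finset.sum_empty] at sP; omega
    · have := he.card_pos; omega
  have b0 : (1 : ℤ) ≤ N.card := by
    rcases N.eq_empty_or_nonempty with he | he
    · rw [he, Finset.sum_empty] at sN; omega
    · have := he.card_pos; omega
  have hQ : (∑ p ∈ N ×ˢ P, (m p.2 - m p.1 - 1) : ℤ) ≤ QQ m := by
    rw [QQ]; push_cast
    calc (∑ p ∈ N ×ˢ P, (m p.2 - m p.1 - 1) : ℤ) ≤ ∑ p ∈ N ×ˢ P, max (m p.2 - m p.1 - 1) 0 :=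
          Finset.sum_le_sum fun p _ => le_max_left _ _
      _ ≤ ∑ p : Fin n × Fin n, max (m p.2 - m p.1 - 1) 0 :=
          Finset.sum_le_sum_of_subset_of_nonneg (Finset.subset_univ _) fun _ _ _ => le_max_right _ _
      _ ≤ _ := Finset.sum_le_sum fun p _ => by omega
  have hE : (∑ p ∈ N ×ˢ P, (m p.2 - m p.1 - 1) : ℤ) =
      N.card * ss m + P.card * ss m - N.card * P.card := by
    rw [Finset.sum_product]
    have : ∀ i ∈ N, ∑ j ∈ P, (m j - m i - 1) = ss m + P.card * (-m i) - P.card := by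
      intro i _
      rw [Finset.sum_sub_distrib, Finset.sum_sub_distrib, sP]
      simp; ring
    rw [Finset.sum_congr rfl this, Finset.sum_sub_distrib, Finset.sum_add_distrib, ← Finset.mul_sum, sN]
    simp
  rw [hE] at hQ
  have : (2 * ss m : ℤ) ≤ QQ m + 1 := by
    nlinarith [mul_nonneg (sub_nonneg.2 b0) (sub_nonneg.2 a1),
      mul_nonneg (sub_nonneg.2 a0) (sub_nonneg.2 (a0.trans a1))]
  exact_mod_cast this

lemma C6 (hn : 3 ≤ n) (hq : 7 ≤ Fintype.card Fq) (m : Fin n → ℤ) (hm : Monotone m)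
    (h : ∑ i, m i = 0) (hs : 1 ≤ ss m) :
    (Nat.card (SpecialLinearGroup (Fin n) Fq) : ℝ) * (5 * 36 ^ ss m) ≤
      42 * Nat.card (stab (SLpoly Fq n) (dg m)) := by
  have hq' : (7 : ℝ) ≤ Fintype.card Fq := by exact_mod_cast hq
  have h1 := C5 (Fq := Fq) hn m hm
  have h2 := prodR m hm h (x := (Fintype.card Fq : ℝ)⁻¹) (by positivity)
    (by rw [one_div]; exact inv_anti₀ (by norm_num) hq')
  have h3 : (7 : ℝ) ^ (2 * ss m) ≤ 7 * (Fintype.card Fq : ℝ) ^ QQ m := by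
    calc (7 : ℝ) ^ (2 * ss m) ≤ 7 ^ (QQ m + 1) := pow_le_pow_right₀ (by norm_num) (QQ_ge m h hs)
      _ = 7 * 7 ^ QQ m := pow_succ' _ _
      _ ≤ _ := by gcongr
  have h4 : (5/6 : ℝ) * 36 ^ ss m ≤ 7 * ((∏ j : Fin n, (1 - ((Fintype.card Fq : ℝ)⁻¹) ^ (dd m j - j))) *
      (Fintype.card Fq : ℝ) ^ QQ m) := by
    have e : (36 : ℝ) ^ ss m = (6/7) ^ (2 * ss m) * 7 ^ (2 * ss m) := by
      rw [← mul_pow, pow_mul]; norm_num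
    calc (5/6 : ℝ) * 36 ^ ss m = ((5/6) * (6/7) ^ (2 * ss m)) * 7 ^ (2 * ss m) := by rw [e]; ring
      _ ≤ (∏ j : Fin n, (1 - ((Fintype.card Fq : ℝ)⁻¹) ^ (dd m j - j))) * (7 * (Fintype.card Fq : ℝ) ^ QQ m) :=
          mul_le_mul h2 h3 (by positivity) (le_trans (by positivity) h2)
      _ = _ := by ring
  have h5 : (0 : ℝ) ≤ Nat.card (SpecialLinearGroup (Fin n) Fq) := by positivity
  have h6 := mul_le_mul_of_nonneg_left h4 h5
  rw [mul_assoc] at h1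
  nlinarith

lemma C7 (m : Fin n → ℤ) (h : ∀ i, m i = 0) :
    Nat.card (SpecialLinearGroup (Fin n) Fq) ≤ Nat.card (stab (SLpoly Fq n) (dg m)) := by
  have h1 := C1 (Fq := Fq) m (fun i j _ => by rw [h, h])
  have h2 : Nat.card (SpecialLinearGroup (Fin n) Fq) ≤ Nat.card (Gm Fq m) :=
    Nat.card_le_card_of_injective (fun M => (⟨M, fun i j hij => by rw [h, h] at hij; omega⟩ : Gm Fq m))
      fun a b hab => congrArg Subtype.val hab
  have h3 : 0 < Fintype.card Fq ^ (∑ p : Fin n × Fin n, (m p.2 - m p.1).toNat) :=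
    pow_pos Fintype.card_pos _
  nlinarith
end

section
variable {Fq n}

lemma mono_eq {m m' : Fin n → ℤ} (hm : Monotone m) (hm' : Monotone m')
    (h : ∀ x : ℤ, x ≠ 0 → (Finset.univ.filter fun i => m i = x).card =
      (Finset.univ.filter fun i => m' i = x).card) : m = m' := by
  classical
  have h0 : ∀ x : ℤ, (Finset.univ.filter fun i => m i = x).card =
      (Finset.univ.filter fun i => m' i = x).card := by
    intro x
    by_cases hx : x ≠ 0
    · exact h x hx
    · push Not at hx
      subst hx
      let T : Finset ℤ := (Finset.univ.image m ∪ Finset.univ.image m') ∪ {0}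
      have e1 := Finset.card_eq_sum_card_fiberwise (f := m) (s := Finset.univ) (t := T)
        (fun i _ => by simp [T])
      have e2 := Finset.card_eq_sum_card_fiberwise (f := m') (s := Finset.univ) (t := T)
        (fun i _ => by simp [T])
      have h0T : (0 : ℤ) ∈ T := by simp [T]
      rw [← Finset.add_sum_erase _ _ h0T] at e1 e2
      have e3 : ∑ x ∈ T.erase 0, (Finset.univ.filter fun i => m i = x).card =
          ∑ x ∈ T.erase 0, (Finset.univ.filter fun i => m' i = x).card :=
        Finset.sum_congr rfl fun x hx => h x (Finset.ne_of_mem_erase hx)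
      omega
  have hp : (List.ofFn m).Perm (List.ofFn m') := by
    rw [List.perm_iff_count]
    intro x
    have hc : ∀ f : Fin n → ℤ, (List.ofFn f).count x = (Finset.univ.filter fun i => f i = x).card := by
      intro f
      rw [List.ofFn_eq_map, List.count, List.countP_map, Finset.card_def, Finset.filter_val]
      rw [← Multiset.countP_eq_card_filter]
      change _ = Multiset.countP _ (Multiset.ofList (List.finRange n))
      rw [Multiset.coe_countP]
      congr 1
    rw [hc, hc, h0]
  exact List.ofFn_injective (hp.eq_of_sortedLE hm.sortedLE_ofFn hm'.sortedLE_ofFn)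

abbrev EN := Σ s : ℕ, (Nat.Partition s × Nat.Partition s)

lemma enc_p1 (m : DD n) : (Finset.univ.val.map fun i => (m.1 i).toNat).sum = ss m.1 := rfl

lemma enc_p2 (m : DD n) : (Finset.univ.val.map fun i => (-m.1 i).toNat).sum = ss m.1 :=
  ss_neg m.1 m.2.2

def enc (m : DD n) : EN :=
  ⟨ss m.1, Nat.Partition.ofSums _ (Finset.univ.val.map fun i => (m.1 i).toNat) (enc_p1 m),
    Nat.Partition.ofSums _ (Finset.univ.val.map fun i => (-m.1 i).toNat) (enc_p2 m)⟩

lemma enc_inj : Function.Injective (enc (n := n)) := by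
  intro m m' h
  have h1 : (enc m).2.1.parts = (enc m').2.1.parts := by rw [h]
  have h2 : (enc m).2.2.parts = (enc m').2.2.parts := by rw [h]
  refine Subtype.ext (mono_eq m.2.1 m'.2.1 fun x hx => ?_)
  rcases lt_or_gt_of_ne hx with hx | hx
  · have h3 := (Nat.Partition.count_ofSums_of_ne_zero (enc_p2 m) (i := (-x).toNat) (by omega)).symm.trans
      ((congrArg (Multiset.count (-x).toNat) h2).trans
        (Nat.Partition.count_ofSums_of_ne_zero (enc_p2 m') (i := (-x).toNat) (by omega)))
    rw [Multiset.count_map, Multiset.count_map] at h3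
    have h4 : ∀ f : Fin n → ℤ, (Finset.univ.filter fun i => f i = x).card =
        (Multiset.filter (fun i => (-x).toNat = (-f i).toNat) Finset.univ.val).card := by
      intro f
      rw [Finset.card_def, Finset.filter_val]
      congr 1
      refine Multiset.filter_congr fun i _ => ?_
      omega
    rw [h4, h4, h3]
  · have h3 := (Nat.Partition.count_ofSums_of_ne_zero (enc_p1 m) (i := x.toNat) (by omega)).symm.trans
      ((congrArg (Multiset.count x.toNat) h1).trans
        (Nat.Partition.count_ofSums_of_ne_zero (enc_p1 m') (i := x.toNat) (by omega)))
    rw [Multiset.count_map, Multiset.count_map] at h3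
    have h4 : ∀ f : Fin n → ℤ, (Finset.univ.filter fun i => f i = x).card =
        (Multiset.filter (fun i => x.toNat = (f i).toNat) Finset.univ.val).card := by
      intro f
      rw [Finset.card_def, Finset.filter_val]
      congr 1
      refine Multiset.filter_congr fun i _ => ?_
      omega
    rw [h4, h4, h3]

lemma card_part (s : ℕ) : Fintype.card (Nat.Partition s) ≤ 2 ^ (s - 1) := by
  rw [← composition_card]
  exact Fintype.card_le_of_surjective _ Nat.Partition.ofComposition_surj

def ww (s : ℕ) : ℝ≥0∞ := if s = 0 then 1 else ENNReal.ofReal (42 / (5 * 36 ^ s))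

lemma ratio_le (hn : 3 ≤ n) (hq : 7 ≤ Fintype.card Fq) (m : DD n) :
    (Nat.card (SpecialLinearGroup (Fin n) Fq) : ℝ≥0∞) / Nat.card (stab (SLpoly Fq n) (dg m.1)) ≤
      ww (ss m.1) := by
  have := finite_stab (SLpoly Fq n) discrete_SLpoly (dg m.1)
  have hpos : 0 < Nat.card (stab (SLpoly Fq n) (dg m.1)) := Nat.card_pos
  have hpos' : (Nat.card (stab (SLpoly Fq n) (dg m.1)) : ℝ≥0∞) ≠ 0 := by exact_mod_cast hpos.ne'
  refine ENNReal.div_le_of_le_mul ?_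
  rw [ww]
  split_ifs with hs
  · rw [one_mul]
    have hz : ∀ i, m.1 i = 0 := by
      have e1 : ∀ i, (m.1 i).toNat = 0 := fun i => by
        simpa using (Finset.sum_eq_zero_iff.1 hs) i (Finset.mem_univ i)
      have e2 : ∀ i, (-m.1 i).toNat = 0 := fun i => by
        rw [← ss_neg m.1 m.2.2] at hs
        simpa using (Finset.sum_eq_zero_iff.1 hs) i (Finset.mem_univ i)
      intro i
      have := e1 i; have := e2 i; omega
    exact_mod_cast C7 m.1 hz
  · have h6 := C6 hn hq m.1 m.2.1 m.2.2 (Nat.one_le_iff_ne_zero.2 hs)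
    have h7 : (Nat.card (SpecialLinearGroup (Fin n) Fq) : ℝ) ≤
        42 / (5 * 36 ^ ss m.1) * Nat.card (stab (SLpoly Fq n) (dg m.1)) := by
      rw [div_mul_eq_mul_div, le_div_iff₀ (by positivity)]; exact h6
    have h8 := ENNReal.ofReal_le_ofReal h7
    rwa [ENNReal.ofReal_mul (by positivity), ENNReal.ofReal_natCast, ENNReal.ofReal_natCast] at h8

lemma sum_lt (hn : 3 ≤ n) (hq : 7 ≤ Fintype.card Fq) :
    ∑' m : DD n, (Nat.card (SpecialLinearGroup (Fin n) Fq) : ℝ≥0∞) /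
      Nat.card (stab (SLpoly Fq n) (dg m.1)) < 2 := by
  have h1 : ∑' m : DD n, (Nat.card (SpecialLinearGroup (Fin n) Fq) : ℝ≥0∞) /
      Nat.card (stab (SLpoly Fq n) (dg m.1)) ≤ ∑' e : EN, ww e.1 :=
    (ENNReal.tsum_le_tsum fun m => ratio_le hn hq m).trans
      (ENNReal.tsum_comp_le_tsum_of_injective enc_inj fun e : EN => ww e.1)
  have h2 : ∑' e : EN, ww e.1 ≤ ∑' s : ℕ, ENNReal.ofReal (if s = 0 then 1 else (42/180 : ℝ) * (1/9) ^ (s - 1)) := by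
    rw [ENNReal.tsum_sigma']
    refine ENNReal.tsum_le_tsum fun s => ?_
    rw [tsum_fintype]
    change ∑ b : Nat.Partition s × Nat.Partition s, ww s ≤ _
    rw [Finset.sum_const, Finset.card_univ, Fintype.card_prod, nsmul_eq_mul]
    have h3 := card_part s
    rcases s with _ | s
    · have h4 : Fintype.card (Nat.Partition 0) ≤ 1 := by simpa using h3
      have h5 : Fintype.card (Nat.Partition 0) * Fintype.card (Nat.Partition 0) ≤ 1 := by nlinarith
      have h6 : ((Fintype.card (Nat.Partition 0) * Fintype.card (Nat.Partition 0) : ℕ) : ℝ≥0∞) ≤ 1 := by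
        exact_mod_cast h5
      simpa [ww] using h6
    · have h4 : Fintype.card (Nat.Partition (s + 1)) ≤ 2 ^ s := by simpa using h3
      have h5 : Fintype.card (Nat.Partition (s + 1)) * Fintype.card (Nat.Partition (s + 1)) ≤ 4 ^ s := by
        calc _ ≤ 2 ^ s * 2 ^ s := Nat.mul_le_mul h4 h4
          _ = 4 ^ s := by rw [← mul_pow]; norm_num
      have h6 : ((Fintype.card (Nat.Partition (s + 1)) * Fintype.card (Nat.Partition (s + 1)) : ℕ) : ℝ≥0∞) ≤
          ENNReal.ofReal (4 ^ s) := by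
        rw [show (4 : ℝ) ^ s = ((4 ^ s : ℕ) : ℝ) by push_cast; rfl, ENNReal.ofReal_natCast]
        exact_mod_cast h5
      rw [ww, if_neg (Nat.succ_ne_zero s), if_neg (Nat.succ_ne_zero s)]
      refine (mul_le_mul_left h6 _).trans ?_
      rw [← ENNReal.ofReal_mul (by positivity)]
      apply ENNReal.ofReal_le_ofReal
      rw [Nat.add_sub_cancel, pow_succ]
      have : (36 : ℝ) ^ s = 4 ^ s * 9 ^ s := by rw [← mul_pow]; norm_num
      rw [this, one_div, inv_pow]
      field_simp
      norm_num
  have hg := (hasSum_geometric_of_lt_one (r := (1/9 : ℝ)) (by norm_num) (by norm_num)).mul_left (42/180 : ℝ)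
  have hs : HasSum (fun s : ℕ => if s = 0 then (1 : ℝ) else (42/180 : ℝ) * (1/9) ^ (s - 1))
      ((42/180 : ℝ) * (1 - 1/9)⁻¹ + 1) := by
    refine (hasSum_nat_add_iff' (f := fun s : ℕ => if s = 0 then (1 : ℝ) else (42/180 : ℝ) * (1/9) ^ (s - 1)) 1).1 ?_
    simpa using hg
  refine lt_of_le_of_lt (h1.trans h2) ?_
  rw [← ENNReal.ofReal_tsum_of_nonneg (fun s => by split_ifs <;> positivity) hs.summable, hs.tsum_eq]
  rw [show (2 : ℝ≥0∞) = ENNReal.ofReal 2 by simp, ENNReal.ofReal_lt_ofReal_iff (by norm_num)]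
  norm_num
end

/-- Main theorem, type A case: a lattice of minimum covolume in `SL_n(𝔽_q((t⁻¹)))` is,
up to a bicontinuous automorphism, `SL_n(𝔽_q[t])`. -/
theorem minCovolume_lattice_eq_SL_poly
    (p q : ℕ) (hp : p.Prime) (hp5 : 5 < p) (hq : ∃ k : ℕ, 0 < k ∧ q = p ^ k)
    (hcard : Fintype.card Fq = q) (hn : 3 ≤ n)
    (μ : Measure (SpecialLinearGroup (Fin n) (F Fq))) (hμ : μ.IsHaarMeasure)
    (Γ : Subgroup (SpecialLinearGroup (Fin n) (F Fq)))
    (hΓ : IsLattice Fq n μ Γ)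
    (hmin : ∀ Λ : Subgroup (SpecialLinearGroup (Fin n) (F Fq)), IsLattice Fq n μ Λ →
      ∀ s t : Set (SpecialLinearGroup (Fin n) (F Fq)),
        IsFundamentalDomain Γ s μ → IsFundamentalDomain Λ t μ → μ s ≤ μ t) :
    ∃ φ : SpecialLinearGroup (Fin n) (F Fq) ≃* SpecialLinearGroup (Fin n) (F Fq),
      Continuous φ ∧ Continuous φ.symm ∧ Subgroup.map φ.toMonoidHom Γ = SLpoly Fq n := by
  obtain ⟨k, hk, rfl⟩ := hq
  haveI : Fact p.Prime := ⟨hp⟩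
  haveI : CharP Fq p := charP_of_card_eq_prime_pow hcard
  have h7 : 7 ≤ p := by
    rcases Nat.lt_or_ge p 7 with h | h
    · have h6 : p = 6 := by omega
      subst h6
      exact absurd hp (by norm_num)
    · exact h
  have hq7 : 7 ≤ Fintype.card Fq := by
    rw [hcard]
    exact h7.trans (Nat.le_self_pow hk.ne' p)
  exact algMain hn hp hq7 (FB_of_discrete Γ hΓ.1)
    (massMain hn (sum_lt hn hq7) μ hμ Γ hΓ hmin)
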